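/- Let p be an odd prime, let PU(p) be the quotient of SU(p) by its center with the quotient topology, and let π : SU(p) → PU(p) be the quotient map. Suppose f : PU(p) × PU(p) → SU(p) is a continuous map satisfying f(π(u), π(v)) = uvu⁻¹v⁻¹ for all u, v ∈ SU(p). Then every continuous map g : PU(p) × PU(p) → SU(p) that is homotopic to f is surjective. -/

import Mathlib

/-- The special unitary group `SU(n)`: the subgroup of the unitary group
`U(n) = Matrix.unitaryGroup (Fin n) ℂ` consisting of matrices of determinant `1`. -/
def SU (n : ℕ) : Subgroup (Matrix.unitaryGroup (Fin n) ℂ) where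
  carrier := {A | (A : Matrix (Fin n) (Fin n) ℂ).det = 1}
  mul_mem' := by
    intro a b ha hb
    simp only [Set.mem_setOf_eq] at *
    simp [Matrix.UnitaryGroup.mul_val, Matrix.det_mul, ha, hb]
  one_mem' := by simp
  inv_mem' := by
    intro a ha
    simp only [Set.mem_setOf_eq] at *
    show ((a⁻¹ : Matrix.unitaryGroup (Fin n) ℂ) : Matrix (Fin n) (Fin n) ℂ).det = 1
    rw [Matrix.UnitaryGroup.inv_val, Matrix.star_eq_conjTranspose, Matrix.det_conjTranspose, ha]
    simp

/-- The projective unitary group `PU(n)`: the quotient of `SU(n)` by its center,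
with the quotient topology. -/
abbrev PU (n : ℕ) := SU n ⧸ Subgroup.center (SU n)


section WrapA

set_option linter.unusedSectionVars false

open MeasureTheory Set Filter Topology Metric

section PartA
variable {E : Type*} [NormedAddCommGroup E] [NormedSpace ℝ E]

/-- evaluation ring hom on continuous functions -/
def evC (x : E) : C(E, ℝ) →+* ℝ where
  toFun f := f x
  map_one' := rfl
  map_mul' _ _ := rfl
  map_zero' := rfl
  map_add' _ _ := rfl

theorem evC_apply (x : E) (a : C(E, ℝ)) : evC x a = a x := rfl

def PolyAlong (F : ℝ → E → ℝ) : Prop :=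
  ∃ q : Polynomial C(E, ℝ), ∀ (x : E) (t : ℝ), F t x = q.eval₂ (evC x) t

theorem PolyAlong.add {F G : ℝ → E → ℝ} (hF : PolyAlong F) (hG : PolyAlong G) :
    PolyAlong (fun t x => F t x + G t x) := by
  obtain ⟨q, hq⟩ := hF
  obtain ⟨r, hr⟩ := hG
  exact ⟨q + r, fun x t => by
    simp only [Polynomial.eval₂_add, hq, hr]⟩

theorem PolyAlong.mul {F G : ℝ → E → ℝ} (hF : PolyAlong F) (hG : PolyAlong G) :
    PolyAlong (fun t x => F t x * G t x) := by
  obtain ⟨q, hq⟩ := hF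
  obtain ⟨r, hr⟩ := hG
  exact ⟨q * r, fun x t => by
    simp only [Polynomial.eval₂_mul, hq, hr]⟩

theorem PolyAlong.affine (a b : C(E, ℝ)) : PolyAlong (fun t x => a x + t * b x) := by
  refine ⟨Polynomial.C a + Polynomial.X * Polynomial.C b, fun x t => ?_⟩
  simp only [Polynomial.eval₂_add, Polynomial.eval₂_mul, Polynomial.eval₂_C, Polynomial.eval₂_X,
    evC_apply, mul_comm]

variable [FiniteDimensional ℝ E]

theorem PolyAlong.det {h : E → E} (hh : ContDiff ℝ 1 h) :
    PolyAlong (fun t x => (fderiv ℝ h x + t • ContinuousLinearMap.id ℝ E).det) := by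
  classical
  let b := Module.finBasis ℝ E
  have hc : Continuous (fderiv ℝ h) := hh.continuous_fderiv one_ne_zero
  have hij : ∀ i j, Continuous (fun x => b.repr (fderiv ℝ h x (b j)) i) := by
    intro i j
    have : Continuous (b.coord i) := LinearMap.continuous_of_finiteDimensional _
    exact this.comp (hc.clm_apply continuous_const)
  let M : Matrix (Fin (Module.finrank ℝ E)) (Fin (Module.finrank ℝ E)) (Polynomial C(E, ℝ)) :=
    Matrix.of fun i j => Polynomial.C ⟨_, hij i j⟩ + (if i = j then Polynomial.X else 0)
  refine ⟨M.det, fun x t => ?_⟩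
  have h1 : M.det.eval₂ (evC x) t = Polynomial.eval₂RingHom (evC x) t M.det := rfl
  rw [h1, RingHom.map_det]
  show LinearMap.det _ = _
  rw [← LinearMap.det_toMatrix b]
  congr 1
  ext i j
  rw [LinearMap.toMatrix_apply]
  by_cases hij' : i = j
  · subst hij'
    simp [M, evC_apply]
  · simp [M, evC_apply, hij']

variable [MeasurableSpace E] [BorelSpace E] (μ : Measure E) [μ.IsAddHaarMeasure]

theorem PolyAlong.integral {F : ℝ → E → ℝ} (hF : PolyAlong F) {K : Set E} (hK : IsCompact K) :
    ∃ q : Polynomial ℝ, ∀ t, ∫ x in K, F t x ∂μ = q.eval t := by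
  obtain ⟨q, hq⟩ := hF
  refine ⟨∑ k ∈ Finset.range (q.natDegree + 1), Polynomial.C (∫ x in K, q.coeff k x ∂μ) * Polynomial.X ^ k, fun t => ?_⟩
  have : ∀ x, F t x = ∑ k ∈ Finset.range (q.natDegree + 1), q.coeff k x * t ^ k := by
    intro x
    rw [hq, Polynomial.eval₂_eq_sum_range]
    rfl
  simp_rw [this]
  rw [integral_finsetSum]
  · rw [Polynomial.eval_finsetSum]
    refine Finset.sum_congr rfl fun k _ => ?_
    rw [integral_mul_const]
    simp
  · intro k _
    exact (((q.coeff k).continuous.mul continuous_const).continuousOn).integrableOn_compact hK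

theorem exists_det_pos (C : ℝ) : ∃ T : ℝ, 0 < T ∧ ∀ t, T < t → ∀ D : E →L[ℝ] E, ‖D‖ ≤ C →
    0 < (D + t • ContinuousLinearMap.id ℝ E).det := by
  have hcont : Continuous (fun A : E →L[ℝ] E => A.det) := ContinuousLinearMap.continuous_det
  have h1 : (ContinuousLinearMap.id ℝ E).det = 1 := by
    show LinearMap.det (LinearMap.id) = (1:ℝ)
    exact LinearMap.det_id
  have hnh : ∀ᶠ A in 𝓝 (ContinuousLinearMap.id ℝ E), 0 < A.det := by
    apply hcont.continuousAt.eventually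
    simp only [h1]
    exact lt_mem_nhds one_pos
  obtain ⟨e, he, hb⟩ := Metric.eventually_nhds_iff.1 hnh
  refine ⟨max 1 (C / e), by positivity, fun t ht D hD => ?_⟩
  have ht0 : 0 < t := lt_trans (by positivity) ht
  have hCt : C / e < t := lt_of_le_of_lt (le_max_right _ _) ht
  have : D + t • ContinuousLinearMap.id ℝ E = t • (ContinuousLinearMap.id ℝ E + t⁻¹ • D) := by
    rw [smul_add, smul_smul, mul_inv_cancel₀ ht0.ne', one_smul, add_comm]
  rw [this]
  have hdet : (t • (ContinuousLinearMap.id ℝ E + t⁻¹ • D)).det = t ^ Module.finrank ℝ E * (ContinuousLinearMap.id ℝ E + t⁻¹ • D).det := by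
    show LinearMap.det (t • ((ContinuousLinearMap.id ℝ E + t⁻¹ • D : E →L[ℝ] E) : E →ₗ[ℝ] E)) = _
    rw [LinearMap.det_smul]
  rw [hdet]
  refine mul_pos (by positivity) (hb ?_)
  rw [dist_eq_norm, add_sub_cancel_left, norm_smul, norm_inv, Real.norm_of_nonneg ht0.le]
  rw [div_lt_iff₀ he] at hCt
  rw [inv_mul_lt_iff₀ ht0]
  linarith

theorem integral_shift {h : E → E} (hh : ContDiff ℝ 1 h) (hs : HasCompactSupport h) :
    ∃ T : ℝ, 0 < T ∧ ∀ t, T < t → Function.Bijective (fun x => h x + t • x) ∧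
      ∀ (K : Set E), MeasurableSet K → ∀ g : E → ℝ,
        ∫ x in K, g (h x + t • x) * (fderiv ℝ h x + t • ContinuousLinearMap.id ℝ E).det ∂μ
          = ∫ y in (fun x => h x + t • x) '' K, g y ∂μ := by
  obtain ⟨C, hC⟩ := hh.lipschitzWith_of_hasCompactSupport hs one_ne_zero
  obtain ⟨T, hT, hdet⟩ := exists_det_pos (E := E) C
  refine ⟨max T C, lt_max_of_lt_left hT, fun t ht => ?_⟩
  have htT : T < t := lt_of_le_of_lt (le_max_left _ _) ht
  have htC : (C:ℝ) < t := lt_of_le_of_lt (le_max_right _ _) ht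
  have ht0 : 0 < t := hT.trans htT
  have hbij : Function.Bijective (fun x => h x + t • x) := by
    let e : E ≃L[ℝ] E := ContinuousLinearEquiv.smulLeft (Units.mk0 t ht0.ne')
    have happ : ApproximatesLinearOn (fun x => h x + t • x) (e : E →L[ℝ] E) univ C := by
      intro x _ y _
      have : h x + t • x - (h y + t • y) - (e : E →L[ℝ] E) (x - y) = h x - h y := by
        have : (e : E →L[ℝ] E) (x - y) = t • (x - y) := rfl
        rw [this, smul_sub]; abel
      rw [this]
      simpa [dist_eq_norm] using hC.dist_le_mul x y
    have hc : Subsingleton E ∨ C < ‖(e.symm : E →L[ℝ] E)‖₊⁻¹ := by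
      rcases subsingleton_or_nontrivial E with h | h
      · exact Or.inl h
      · right
        have h2 : ‖(e.symm : E →L[ℝ] E)‖ = t⁻¹ := by
          have : (e.symm : E →L[ℝ] E) = t⁻¹ • ContinuousLinearMap.id ℝ E := by
            ext x
            rfl
          rw [this, norm_smul, ContinuousLinearMap.norm_id, norm_inv, Real.norm_of_nonneg ht0.le, mul_one]
        rw [← NNReal.coe_lt_coe, NNReal.coe_inv, coe_nnnorm, h2, inv_inv]
        exact htC
    exact (happ.toHomeomorph _ hc).bijective
  refine ⟨hbij, fun K hK g => ?_⟩
  have hd : ∀ x ∈ K, HasFDerivWithinAt (fun x => h x + t • x) (fderiv ℝ h x + t • ContinuousLinearMap.id ℝ E) K x := by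
    intro x _
    have h1 : HasFDerivAt h (fderiv ℝ h x) x := (hh.differentiable one_ne_zero x).hasFDerivAt
    exact (h1.add ((hasFDerivAt_id x).const_smul t)).hasFDerivWithinAt
  rw [integral_image_eq_integral_abs_det_fderiv_smul μ hK hd hbij.injective.injOn]
  refine integral_congr_ae (Eventually.of_forall fun x => ?_)
  have hn : ‖fderiv ℝ h x‖ ≤ C := norm_fderiv_le_of_lipschitz ℝ hC
  simp only [smul_eq_mul]
  rw [abs_of_pos (hdet t htT _ hn), mul_comm]

theorem invariance_poly {h₀ h₁ : E → E} (hh₀ : ContDiff ℝ 1 h₀) (hs₀ : HasCompactSupport h₀)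
    (hh₁ : ContDiff ℝ 1 h₁) (hs₁ : HasCompactSupport h₁) {K : Set E} (hK : IsCompact K)
    (heq : ∀ x ∉ K, h₀ x = h₁ x) (g : E → ℝ)
    (hg₀ : PolyAlong (fun t x => g (h₀ x + t • x))) (hg₁ : PolyAlong (fun t x => g (h₁ x + t • x))) :
    ∫ x in K, g (h₀ x) * (fderiv ℝ h₀ x).det ∂μ = ∫ x in K, g (h₁ x) * (fderiv ℝ h₁ x).det ∂μ := by
  obtain ⟨T₀, hT₀, H₀⟩ := integral_shift μ hh₀ hs₀
  obtain ⟨T₁, hT₁, H₁⟩ := integral_shift μ hh₁ hs₁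
  obtain ⟨q₀, hq₀⟩ := (hg₀.mul (PolyAlong.det hh₀)).integral μ hK
  obtain ⟨q₁, hq₁⟩ := (hg₁.mul (PolyAlong.det hh₁)).integral μ hK
  have key : q₀ - q₁ = 0 := by
    apply Polynomial.eq_zero_of_infinite_isRoot
    apply Set.Infinite.mono _ (Set.Ioi_infinite (max T₀ T₁))
    intro t ht
    have ht0 : T₀ < t := lt_of_le_of_lt (le_max_left _ _) ht
    have ht1 : T₁ < t := lt_of_le_of_lt (le_max_right _ _) ht
    obtain ⟨b0, i0⟩ := H₀ t ht0
    obtain ⟨b1, i1⟩ := H₁ t ht1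
    have him : (fun x => h₀ x + t • x) '' K = (fun x => h₁ x + t • x) '' K := by
      have e0 := image_compl_eq (s := K) b0
      have e1 := image_compl_eq (s := K) b1
      have : (fun x => h₀ x + t • x) '' Kᶜ = (fun x => h₁ x + t • x) '' Kᶜ := by
        apply image_congr
        intro x hx
        simp only [heq x hx]
      rw [e0, e1] at this
      exact compl_injective this
    show (q₀ - q₁).IsRoot t
    rw [Polynomial.IsRoot, Polynomial.eval_sub, ← hq₀, ← hq₁, i0 K hK.measurableSet, i1 K hK.measurableSet, him, sub_self]
  have := hq₀ 0
  have h2 := hq₁ 0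
  simp only [zero_smul, add_zero] at this h2
  rw [this, h2, sub_eq_zero.1 key]

end PartA

end WrapA

section WrapB
set_option linter.unusedSectionVars false

open MeasureTheory Set Filter Topology Metric

section PartB
variable {E : Type*} [NormedAddCommGroup E] [NormedSpace ℝ E] [FiniteDimensional ℝ E]

theorem approx_poly (g : E → ℝ) (hg : Continuous g) {K : Set E} (hK : IsCompact K) {ε : ℝ} (hε : 0 < ε) :
    ∃ r : E → ℝ, Continuous r ∧ (∀ y ∈ K, |r y - g y| < ε) ∧
      ∀ h : E → E, Continuous h → PolyAlong (fun t x => r (h x + t • x)) := by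
  haveI : CompactSpace K := isCompact_iff_compactSpace.1 hK
  let S : Set C(K, ℝ) := {a | ∃ l : E →L[ℝ] ℝ, ∀ y : K, a y = l y}
  let A : Subalgebra ℝ C(K, ℝ) := Algebra.adjoin ℝ S
  have hsep : A.SeparatesPoints := by
    intro x y hxy
    have hne : (x : E) - y ≠ 0 := fun h => hxy (Subtype.ext (sub_eq_zero.1 h))
    obtain ⟨l, hl⟩ := SeparatingDual.exists_ne_zero (R := ℝ) hne
    refine ⟨fun z : K => l z, ⟨⟨fun z : K => l z, by fun_prop⟩, Algebra.subset_adjoin ⟨l, fun _ => rfl⟩, rfl⟩, ?_⟩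
    intro h
    apply hl
    rw [map_sub]
    exact sub_eq_zero.2 h
  have htop := ContinuousMap.subalgebra_topologicalClosure_eq_top_of_separatesPoints A hsep
  let gK : C(K, ℝ) := ⟨fun y => g y, by fun_prop⟩
  have hmem : gK ∈ closure (A : Set C(K, ℝ)) := by
    have : gK ∈ A.topologicalClosure := by rw [htop]; trivial
    exact this
  obtain ⟨a, ha, hdist⟩ := Metric.mem_closure_iff.1 hmem ε hε
  have key : ∃ r : E → ℝ, Continuous r ∧ (∀ y : K, r y = a y) ∧
      ∀ h : E → E, Continuous h → PolyAlong (fun t x => r (h x + t • x)) := by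
    refine Algebra.adjoin_induction (p := fun (a : C(K, ℝ)) _ => ∃ r : E → ℝ, Continuous r ∧ (∀ y : K, r y = a y) ∧
      ∀ h : E → E, Continuous h → PolyAlong (fun t x => r (h x + t • x))) ?_ ?_ ?_ ?_ ha
    · rintro x ⟨l, hl⟩
      refine ⟨l, l.continuous, fun y => (hl y).symm, fun h hh => ?_⟩
      have := PolyAlong.affine (E := E) ⟨fun x => l (h x), by fun_prop⟩ ⟨fun x => l x, by fun_prop⟩
      simpa using this
    · intro c
      refine ⟨fun _ => c, continuous_const, fun y => rfl, fun h hh => ?_⟩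
      have := PolyAlong.affine (E := E) ⟨fun _ => c, by fun_prop⟩ ⟨fun _ => 0, by fun_prop⟩
      simpa using this
    · rintro x y _ _ ⟨r, hr, hr1, hr2⟩ ⟨s, hs, hs1, hs2⟩
      exact ⟨fun z => r z + s z, hr.add hs, fun z => by simp [hr1, hs1], fun h hh => (hr2 h hh).add (hs2 h hh)⟩
    · rintro x y _ _ ⟨r, hr, hr1, hr2⟩ ⟨s, hs, hs1, hs2⟩
      exact ⟨fun z => r z * s z, hr.mul hs, fun z => by simp [hr1, hs1], fun h hh => (hr2 h hh).mul (hs2 h hh)⟩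
  obtain ⟨r, hr, hr1, hr2⟩ := key
  refine ⟨r, hr, fun y hy => ?_, hr2⟩
  have := (ContinuousMap.dist_lt_iff hε).1 hdist ⟨y, hy⟩
  rw [Real.dist_eq, abs_sub_comm, ← hr1] at this
  exact this

variable [MeasurableSpace E] [BorelSpace E] (μ : Measure E) [μ.IsAddHaarMeasure]

theorem invariance {h₀ h₁ : E → E} (hh₀ : ContDiff ℝ 1 h₀) (hs₀ : HasCompactSupport h₀)
    (hh₁ : ContDiff ℝ 1 h₁) (hs₁ : HasCompactSupport h₁) {K : Set E} (hK : IsCompact K)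
    (heq : ∀ x ∉ K, h₀ x = h₁ x) (g : E → ℝ) (hg : Continuous g) :
    ∫ x in K, g (h₀ x) * (fderiv ℝ h₀ x).det ∂μ = ∫ x in K, g (h₁ x) * (fderiv ℝ h₁ x).det ∂μ := by
  have hd : ∀ h : E → E, ContDiff ℝ 1 h → Continuous (fun x => (fderiv ℝ h x).det) := fun h hh =>
    ContinuousLinearMap.continuous_det.comp (hh.continuous_fderiv one_ne_zero)
  have hi : ∀ (h : E → E) (r : E → ℝ), ContDiff ℝ 1 h → Continuous r →
      IntegrableOn (fun x => r (h x) * (fderiv ℝ h x).det) K μ := fun h r hh hr =>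
    ((hr.comp hh.continuous).mul (hd h hh)).continuousOn.integrableOn_compact hK
  have hest : ∀ (h : E → E), ContDiff ℝ 1 h → ∀ (r : E → ℝ), Continuous r → ∀ ε : ℝ, 
      (∀ y ∈ h '' K, |r y - g y| < ε) →
      |∫ x in K, r (h x) * (fderiv ℝ h x).det ∂μ - ∫ x in K, g (h x) * (fderiv ℝ h x).det ∂μ|
        ≤ ε * ∫ x in K, |(fderiv ℝ h x).det| ∂μ := by
    intro h hh r hr ε hε
    rw [← integral_sub (hi h r hh hr) (hi h g hh hg), ← integral_const_mul]
    refine (abs_integral_le_integral_abs).trans ?_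
    refine setIntegral_mono_on ?_ ?_ hK.measurableSet ?_
    · exact ((hi h r hh hr).sub (hi h g hh hg)).abs
    · exact (continuous_const.mul (hd h hh).abs).continuousOn.integrableOn_compact hK
    · intro x hx
      rw [← sub_mul, abs_mul]
      exact mul_le_mul_of_nonneg_right (hε _ (mem_image_of_mem _ hx)).le (abs_nonneg _)
  set D := ∫ x in K, |(fderiv ℝ h₀ x).det| ∂μ + ∫ x in K, |(fderiv ℝ h₁ x).det| ∂μ with hD
  by_contra hne
  set a := ∫ x in K, g (h₀ x) * (fderiv ℝ h₀ x).det ∂μ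
  set b := ∫ x in K, g (h₁ x) * (fderiv ℝ h₁ x).det ∂μ
  have hab : 0 < |a - b| := abs_pos.2 (sub_ne_zero.2 hne)
  have hD0 : 0 ≤ ∫ x in K, |(fderiv ℝ h₀ x).det| ∂μ := integral_nonneg fun x => abs_nonneg _
  have hD1 : 0 ≤ ∫ x in K, |(fderiv ℝ h₁ x).det| ∂μ := integral_nonneg fun x => abs_nonneg _
  have hDD : 0 < D + 1 := by positivity
  set ε := |a - b| / (2 * (D + 1)) with hε
  have hεp : 0 < ε := by positivity
  obtain ⟨r, hr, hrg, hrp⟩ := approx_poly g hg ((hK.image hh₀.continuous).union (hK.image hh₁.continuous)) hεp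
  have e := invariance_poly μ hh₀ hs₀ hh₁ hs₁ hK heq r (hrp _ hh₀.continuous) (hrp _ hh₁.continuous)
  have e0 := hest h₀ hh₀ r hr ε (fun y hy => hrg y (Or.inl hy))
  have e1 := hest h₁ hh₁ r hr ε (fun y hy => hrg y (Or.inr hy))
  rw [e] at e0
  have h3 : |a - b| ≤ ε * D := by
    rw [hD, mul_add]
    rw [abs_sub_comm] at e0
    refine (abs_sub_le a _ b).trans (add_le_add e0 e1)
  have h4 : ε * D < |a - b| := by
    rw [hε, div_mul_eq_mul_div, div_lt_iff₀ (by positivity)]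
    nlinarith
  linarith

end PartB

end WrapB

section WrapC
set_option linter.unusedSectionVars false

open MeasureTheory Set Filter Topology Metric

section PartC
variable {E : Type*} [NormedAddCommGroup E] [NormedSpace ℝ E] [FiniteDimensional ℝ E]

theorem exists_equiv_of_det_ne_zero (D : E →L[ℝ] E) (h : D.det ≠ 0) :
    ∃ e : E ≃L[ℝ] E, (e : E →L[ℝ] E) = D := by
  exact ⟨ContinuousLinearMap.toContinuousLinearEquivOfDetNeZero D h, by ext x; rfl⟩

theorem exists_local {h : E → E} (hh : ContDiff ℝ 1 h) {x : E} (hx : (fderiv ℝ h x).det ≠ 0) :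
    ∃ U : Set E, IsOpen U ∧ x ∈ U ∧ InjOn h U ∧
      (∀ z ∈ U, SignType.sign (fderiv ℝ h z).det = SignType.sign (fderiv ℝ h x).det) ∧
      ∀ W ∈ 𝓝 x, h '' W ∈ 𝓝 (h x) := by
  obtain ⟨e, he⟩ := exists_equiv_of_det_ne_zero _ hx
  have hs : HasStrictFDerivAt h (e : E →L[ℝ] E) x := by
    rw [he]; exact (hh.contDiffAt).hasStrictFDerivAt one_ne_zero
  have hd : Continuous (fun x => (fderiv ℝ h x).det) :=
    ContinuousLinearMap.continuous_det.comp (hh.continuous_fderiv one_ne_zero)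
  have hsg : ∀ᶠ z in 𝓝 x, SignType.sign (fderiv ℝ h z).det = SignType.sign (fderiv ℝ h x).det := by
    rcases lt_or_gt_of_ne hx with h0 | h0
    · filter_upwards [hd.continuousAt.eventually (gt_mem_nhds h0)] with z hz
      rw [sign_neg hz, sign_neg h0]
    · filter_upwards [hd.continuousAt.eventually (lt_mem_nhds h0)] with z hz
      rw [sign_pos hz, sign_pos h0]
  obtain ⟨V, hV, hVo, hxV⟩ := _root_.eventually_nhds_iff.1 hsg
  let φ := hs.toOpenPartialHomeomorph h
  refine ⟨V ∩ φ.source, hVo.inter φ.open_source, ⟨hxV, hs.mem_toOpenPartialHomeomorph_source⟩, ?_, ?_, ?_⟩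
  · exact φ.injOn.mono inter_subset_right
  · intro z hz
    exact hV z hz.1
  · intro W hW
    rw [← hs.map_nhds_eq_of_equiv]
    exact image_mem_map hW

variable [MeasurableSpace E] [BorelSpace E] (μ : Measure E) [μ.IsAddHaarMeasure]

theorem local_count {h : E → E} (hh : ContDiff ℝ 1 h) {K : Set E} (hK : IsCompact K) (y : E)
    (hreg : ∀ x ∈ K, h x = y → (fderiv ℝ h x).det ≠ 0 ∧ x ∈ interior K) :
    ∃ F : Finset E, (∀ x, x ∈ F ↔ x ∈ K ∧ h x = y) ∧ ∃ ε : ℝ, 0 < ε ∧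
      ∀ g : E → ℝ, Continuous g → (∀ z, ε ≤ dist z y → g z = 0) →
        ∫ x in K, g (h x) * (fderiv ℝ h x).det ∂μ
          = (∑ x ∈ F, (SignType.sign (fderiv ℝ h x).det : ℝ)) * ∫ z, g z ∂μ := by
  classical
  let Z : Set E := K ∩ h ⁻¹' {y}
  have hZc : IsCompact Z := hK.inter_right (isClosed_singleton.preimage hh.continuous)
  have hex : ∀ x : E, ∃ U : Set E, x ∈ Z → (IsOpen U ∧ x ∈ U ∧ InjOn h U ∧
      (∀ z ∈ U, SignType.sign (fderiv ℝ h z).det = SignType.sign (fderiv ℝ h x).det) ∧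
      ∀ W ∈ 𝓝 x, h '' W ∈ 𝓝 (h x)) := by
    intro x
    by_cases hx : x ∈ Z
    · obtain ⟨U, hU⟩ := exists_local hh (hreg x hx.1 hx.2).1
      exact ⟨U, fun _ => hU⟩
    · exact ⟨∅, fun h => absurd h hx⟩
  choose U hU using hex
  have hZf : Z.Finite := by
    obtain ⟨t, ht⟩ := hZc.elim_nhds_subcover' (fun x _ => U x) (fun x hx => (hU x hx).1.mem_nhds (hU x hx).2.1)
    refine (t.finite_toSet.image (fun z : Z => (z : E))).subset ?_
    intro z hz
    obtain ⟨w, hw, hzw⟩ := mem_iUnion₂.1 (ht hz)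
    refine ⟨w, hw, ?_⟩
    refine (hU w w.2).2.2.1 (hU w w.2).2.1 hzw ?_
    have h1 : h z = y := hz.2
    have h2 : h w = y := w.2.2
    rw [h1, h2]
  obtain ⟨S, hS, hSd⟩ := hZf.t2_separation
  let V : E → Set E := fun x => U x ∩ S x ∩ interior K
  have hVo : ∀ x ∈ Z, IsOpen (V x) := fun x hx => ((hU x hx).1.inter (hS x).2).inter isOpen_interior
  have hVx : ∀ x ∈ Z, x ∈ V x := fun x hx => ⟨⟨(hU x hx).2.1, (hS x).1⟩, (hreg x hx.1 hx.2).2⟩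
  have hVK : ∀ x, V x ⊆ K := fun x z hz => interior_subset hz.2
  let F := hZf.toFinset
  have hFZ : ∀ x, x ∈ F ↔ x ∈ Z := fun x => hZf.mem_toFinset
  let O : Set E := ⋃ x ∈ F, V x
  have hOo : IsOpen O := isOpen_biUnion fun x hx => hVo x ((hFZ x).1 hx)
  have hKO : IsCompact (K \ O) := hK.diff hOo
  have hyn : y ∉ h '' (K \ O) := by
    rintro ⟨x, ⟨hx, hxO⟩, hxy⟩
    exact hxO (mem_iUnion₂.2 ⟨x, (hFZ x).2 ⟨hx, hxy⟩, hVx x ⟨hx, hxy⟩⟩)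
  have hn1 : (h '' (K \ O))ᶜ ∈ 𝓝 y := (hKO.image hh.continuous).isClosed.isOpen_compl.mem_nhds hyn
  have hn2 : (⋂ x ∈ F, h '' V x) ∈ 𝓝 y := by
    rw [biInter_finset_mem]
    intro x hx
    have hxZ := (hFZ x).1 hx
    have := (hU x hxZ).2.2.2.2 (V x) ((hVo x hxZ).mem_nhds (hVx x hxZ))
    rwa [show h x = y from hxZ.2] at this
  obtain ⟨ε, hε, hball⟩ := Metric.mem_nhds_iff.1 (inter_mem hn1 hn2)
  refine ⟨F, fun x => hFZ x, ε, hε, fun g hg hgz => ?_⟩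
  have hg0 : ∀ z, z ∉ ball y ε → g z = 0 := fun z hz => hgz z (not_lt.1 hz)
  have hgint : IntegrableOn (fun x => g (h x) * (fderiv ℝ h x).det) K μ :=
    ((hg.comp hh.continuous).mul (ContinuousLinearMap.continuous_det.comp
      (hh.continuous_fderiv one_ne_zero))).continuousOn.integrableOn_compact hK
  have hOK : O ⊆ K := iUnion₂_subset fun x _ => hVK x
  have h1 : ∫ x in K, g (h x) * (fderiv ℝ h x).det ∂μ = ∫ x in O, g (h x) * (fderiv ℝ h x).det ∂μ := by
    refine (setIntegral_eq_of_subset_of_forall_sdiff_eq_zero hK.measurableSet hOK ?_)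
    intro x hx
    have : h x ∉ ball y ε := fun hb => (hball hb).1 (mem_image_of_mem _ hx)
    rw [hg0 _ this, zero_mul]
  rw [h1, integral_biUnion_finset, Finset.sum_mul]
  · refine Finset.sum_congr rfl fun x hx => ?_
    have hxZ := (hFZ x).1 hx
    have hsub : ball y ε ⊆ h '' V x := fun z hz => by
      have := (hball hz).2
      exact mem_iInter₂.1 this x hx
    have e1 : ∫ z, g z ∂μ = ∫ z in h '' V x, g z ∂μ := by
      rw [setIntegral_eq_integral_of_forall_compl_eq_zero]
      intro z hz
      exact hg0 z fun hb => hz (hsub hb)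
    have hinj : InjOn h (V x) := (hU x hxZ).2.2.1.mono fun z hz => hz.1.1
    have hm : MeasurableSet (V x) := (hVo x hxZ).measurableSet
    rw [e1, integral_image_eq_integral_abs_det_fderiv_smul μ hm
      (fun z _ => (hh.differentiable one_ne_zero z).hasFDerivAt.hasFDerivWithinAt) hinj, ← integral_const_mul]
    refine setIntegral_congr_fun hm fun z hz => ?_
    have hsg := (hU x hxZ).2.2.2.1 z hz.1.1
    simp only [smul_eq_mul]
    rw [← hsg, ← mul_assoc, sign_mul_abs, mul_comm]
  · exact fun x hx => (hVo x ((hFZ x).1 hx)).measurableSet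
  · intro a ha b hb hab
    have := hSd ((hFZ a).1 ha) ((hFZ b).1 hb) hab
    exact this.mono (fun z hz => hz.1.2) (fun z hz => hz.1.2)
  · exact fun x hx => hgint.mono_set (hVK x)

end PartC

end WrapC

section WrapD
set_option linter.unusedSectionVars false

open MeasureTheory Set Filter Topology Metric

section PartD
variable {E : Type*} [NormedAddCommGroup E] [NormedSpace ℝ E] [FiniteDimensional ℝ E]
variable [MeasurableSpace E] [BorelSpace E] (μ : Measure E) [μ.IsAddHaarMeasure]

structure IsMoll (f : E → ℝ) (δ : ℝ) : Prop where
  smooth : ContDiff ℝ 1 f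
  nonneg : ∀ x, 0 ≤ f x
  supp : Function.support f ⊆ ball 0 δ
  int_one : ∫ x, f x ∂μ = 1

theorem exists_moll (N : E → ℝ) (hN : ContDiff ℝ 1 N) (hN0 : N 0 = 0) (hN1 : ∀ x, ‖x‖ ^ 2 ≤ N x)
    {δ : ℝ} (hδ : 0 < δ) : ∃ f : E → ℝ, IsMoll μ f δ ∧ ∀ x y, N x = N y → f x = f y := by
  let f₀ : E → ℝ := fun x => Real.smoothTransition (1 - N x / δ ^ 2)
  have hs : ContDiff ℝ 1 f₀ := Real.smoothTransition.contDiff.comp (contDiff_const.sub (hN.div_const _))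
  have hnn : ∀ x, 0 ≤ f₀ x := fun x => Real.smoothTransition.nonneg _
  have hsupp : Function.support f₀ ⊆ ball 0 δ := by
    intro x hx
    rw [mem_ball_zero_iff]
    by_contra hge
    apply hx
    apply Real.smoothTransition.zero_of_nonpos
    have : δ ^ 2 ≤ N x := (pow_le_pow_left₀ hδ.le (not_lt.1 hge) 2).trans (hN1 x)
    rw [sub_nonpos, one_le_div (by positivity)]
    exact this
  have hcs : HasCompactSupport f₀ := by
    refine HasCompactSupport.of_support_subset_isCompact (isCompact_closedBall (0:E) δ) (hsupp.trans ball_subset_closedBall)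
  have hpos : 0 < ∫ x, f₀ x ∂μ := by
    refine hs.continuous.integral_pos_of_hasCompactSupport_nonneg_nonzero hcs hnn (x := 0) ?_
    simp [f₀, hN0, Real.smoothTransition.one]
  set c := ∫ x, f₀ x ∂μ with hc
  refine ⟨fun x => c⁻¹ * f₀ x, ⟨contDiff_const.mul hs, fun x => mul_nonneg (inv_nonneg.2 hpos.le) (hnn x), ?_, ?_⟩, ?_⟩
  · intro x hx
    apply hsupp
    intro h0
    apply hx
    simp only [h0, mul_zero]
  · rw [integral_const_mul, ← hc, inv_mul_cancel₀ hpos.ne']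
  · intro x y hxy
    simp only [f₀, hxy]

variable {μ}

/-- mollification -/
noncomputable def moll (μ : Measure E) (f : E → ℝ) (h : E → E) : E → E :=
  MeasureTheory.convolution f h (ContinuousLinearMap.lsmul ℝ ℝ) μ

theorem moll_apply (f : E → ℝ) (h : E → E) (x : E) : moll μ f h x = ∫ t, f t • h (x - t) ∂μ := rfl

variable {f : E → ℝ} {δ : ℝ}

theorem IsMoll.hasCompactSupport (hf : IsMoll μ f δ) : HasCompactSupport f :=
  HasCompactSupport.of_support_subset_isCompact (isCompact_closedBall (0:E) δ) (hf.supp.trans ball_subset_closedBall)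

theorem IsMoll.contDiff (hf : IsMoll μ f δ) {h : E → E} (hh : Continuous h) : ContDiff ℝ 1 (moll μ f h) :=
  hf.hasCompactSupport.contDiff_convolution_left _ (n := 1) hf.smooth hh.locallyIntegrable

theorem IsMoll.compactSupport (hf : IsMoll μ f δ) {h : E → E} (hh : HasCompactSupport h) :
    HasCompactSupport (moll μ f h) :=
  HasCompactSupport.convolution _ hf.hasCompactSupport hh

theorem IsMoll.dist_le (hf : IsMoll μ f δ) {h : E → E} (hh : Continuous h) {x : E} {ε : ℝ} (hε : 0 ≤ ε)
    (hd : ∀ z ∈ ball x δ, dist (h z) (h x) ≤ ε) : dist (moll μ f h x) (h x) ≤ ε :=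
  MeasureTheory.dist_convolution_le hε hf.supp hf.nonneg hf.int_one hh.aestronglyMeasurable hd

theorem IsMoll.integrable (hf : IsMoll μ f δ) {h : E → E} (hh : Continuous h) (x : E) :
    Integrable (fun t => f t • h (x - t)) μ := by
  apply Continuous.integrable_of_hasCompactSupport
  · exact hf.smooth.continuous.smul (hh.comp (continuous_const.sub continuous_id))
  · exact hf.hasCompactSupport.smul_right

theorem IsMoll.integrable_self (hf : IsMoll μ f δ) : Integrable f μ :=
  hf.smooth.continuous.integrable_of_hasCompactSupport hf.hasCompactSupport

theorem IsMoll.symm (hf : IsMoll μ f δ) {h : E → E} (r : E →L[ℝ] E) (hr : r.det = 1)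
    (hfr : ∀ t, f (r t) = f t) {x : E} (hx : ∀ z ∈ ball x δ, h (r z) = h z) :
    moll μ f h (r x) = moll μ f h x := by
  rw [moll_apply, moll_apply]
  have hd : r.det ≠ 0 := by rw [hr]; exact one_ne_zero
  obtain ⟨e, he⟩ := exists_equiv_of_det_ne_zero r hd
  have hmp : MeasurePreserving (fun t => r t) μ μ := by
    refine ⟨r.continuous.measurable, ?_⟩
    have := Measure.map_linearMap_addHaar_eq_smul_addHaar μ (f := (r : E →ₗ[ℝ] E)) hd
    have h2 : LinearMap.det (r : E →ₗ[ℝ] E) = 1 := hr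
    rw [h2] at this
    simpa using this
  have hemb : MeasurableEmbedding (fun t => r t) := by
    have : (fun t => r t) = e := by ext t; rw [← he]; rfl
    rw [this]
    exact e.toHomeomorph.measurableEmbedding
  rw [← hmp.integral_comp hemb]
  refine integral_congr_ae (Eventually.of_forall fun t => ?_)
  simp only
  by_cases ht : f t = 0
  · rw [hfr, ht, zero_smul, zero_smul]
  · have htb : t ∈ ball (0:E) δ := hf.supp ht
    rw [hfr, ← map_sub, hx]
    simpa [dist_eq_norm] using htb

theorem IsMoll.approx (hf : IsMoll μ f δ) {h : E → E} (hh : Continuous h) {L : E →L[ℝ] E} {x : E} {r : ℝ}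
    {c : NNReal} (hc : ApproximatesLinearOn h L (ball x (r + δ)) c) :
    ApproximatesLinearOn (moll μ f h) L (ball x r) c := by
  intro u hu v hv
  have h1 : moll μ f h u - moll μ f h v - L (u - v) =
      ∫ t, f t • (h (u - t) - h (v - t) - L (u - v)) ∂μ := by
    simp_rw [smul_sub]
    rw [integral_sub, integral_sub (hf.integrable hh u) (hf.integrable hh v), moll_apply, moll_apply,
      integral_smul_const, hf.int_one, one_smul]
    · exact (hf.integrable hh u).sub (hf.integrable hh v)
    · exact hf.integrable_self.smul_const _
  rw [h1]
  have h2 : (c : ℝ) * ‖u - v‖ = ∫ t, f t * (c * ‖u - v‖) ∂μ := by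
    rw [integral_mul_const, hf.int_one, one_mul]
  rw [h2]
  refine norm_integral_le_of_norm_le (hf.integrable_self.mul_const _) (Eventually.of_forall fun t => ?_)
  rw [norm_smul, Real.norm_of_nonneg (hf.nonneg t)]
  by_cases ht : f t = 0
  · rw [ht, zero_mul, zero_mul]
  · have htb : ‖t‖ < δ := by simpa using hf.supp ht
    refine mul_le_mul_of_nonneg_left ?_ (hf.nonneg t)
    have hmem : ∀ w ∈ ball x r, w - t ∈ ball x (r + δ) := by
      intro w hw
      rw [mem_ball, dist_eq_norm] at *
      calc ‖w - t - x‖ = ‖(w - x) - t‖ := by congr 1; abel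
        _ ≤ ‖w - x‖ + ‖t‖ := norm_sub_le _ _
        _ < r + δ := add_lt_add hw htb
    have := hc _ (hmem u hu) _ (hmem v hv)
    rwa [sub_sub_sub_cancel_right] at this

end PartD

end WrapD

section WrapE
set_option linter.unusedSectionVars false

open MeasureTheory Set Filter Topology Metric

section PartE
variable {E : Type*} [NormedAddCommGroup E] [NormedSpace ℝ E] [FiniteDimensional ℝ E]
variable [MeasurableSpace E] [BorelSpace E] (μ : Measure E) [μ.IsAddHaarMeasure]

theorem step_eq {h₀ h₁ : E → E} (hh₀ : ContDiff ℝ 1 h₀) (hs₀ : HasCompactSupport h₀)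
    (hh₁ : ContDiff ℝ 1 h₁) {R η : ℝ} (hR : 0 < R) (hη : 0 < η)
    (g : E → ℝ) (hg : Continuous g) (hgz : ∀ z, η ≤ ‖z‖ → g z = 0)
    (hsh : ∀ x, R ≤ ‖x‖ → ‖x‖ ≤ R + 1 → 2 * η ≤ ‖h₀ x‖ ∧ 2 * η ≤ ‖h₁ x‖ ∧ ‖h₁ x - h₀ x‖ ≤ η) :
    ∫ x in closedBall 0 (R + 1), g (h₀ x) * (fderiv ℝ h₀ x).det ∂μ =
      ∫ x in closedBall 0 (R + 1), g (h₁ x) * (fderiv ℝ h₁ x).det ∂μ := by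
  let χ : ContDiffBump (0 : E) := ⟨R + 1 / 3, R + 2 / 3, by linarith, by linarith⟩
  have hχc : ContDiff ℝ 1 χ := χ.contDiff
  let h₂ : E → E := fun x => h₀ x + χ x • (h₁ x - h₀ x)
  have hh₂ : ContDiff ℝ 1 h₂ := hh₀.add (hχc.smul (hh₁.sub hh₀))
  have hs₂ : HasCompactSupport h₂ := hs₀.add χ.hasCompactSupport.smul_right
  have hout : ∀ x ∉ closedBall (0:E) (R + 1), h₀ x = h₂ x := by
    intro x hx
    have : χ x = 0 := by
      apply χ.zero_of_le_dist
      rw [mem_closedBall, not_le] at hx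
      show R + 2 / 3 ≤ dist x 0
      linarith
    simp only [h₂, this, zero_smul, add_zero]
  rw [invariance μ hh₀ hs₀ hh₂ hs₂ (isCompact_closedBall _ _) hout g hg]
  refine setIntegral_congr_fun measurableSet_closedBall fun x hx => ?_
  have hx1 : ‖x‖ ≤ R + 1 := by simpa using hx
  by_cases hxR : R ≤ ‖x‖
  · obtain ⟨a, b, c⟩ := hsh x hxR hx1
    rw [hgz (h₁ x) (by linarith), hgz (h₂ x)]
    · simp
    · have h3 : ‖χ x • (h₁ x - h₀ x)‖ ≤ η := by
        rw [norm_smul, Real.norm_of_nonneg (χ.nonneg)]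
        calc χ x * ‖h₁ x - h₀ x‖ ≤ 1 * η := mul_le_mul χ.le_one c (norm_nonneg _) zero_le_one
          _ = η := one_mul _
      have h4 : ‖h₀ x‖ ≤ ‖h₂ x‖ + ‖χ x • (h₁ x - h₀ x)‖ := by
        have : h₀ x = h₂ x - χ x • (h₁ x - h₀ x) := by simp [h₂]
        calc ‖h₀ x‖ = ‖h₂ x - χ x • (h₁ x - h₀ x)‖ := by rw [← this]
          _ ≤ _ := norm_sub_le _ _
      linarith
  · have hev : h₂ =ᶠ[𝓝 x] h₁ := by
      have : ∀ᶠ z in 𝓝 x, ‖z‖ < R := by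
        apply continuous_norm.continuousAt.eventually (gt_mem_nhds (not_le.1 hxR))
      filter_upwards [this] with z hz
      have : χ z = 1 := by
        apply χ.one_of_mem_closedBall
        rw [mem_closedBall, dist_zero_right]
        show ‖z‖ ≤ R + 1/3
        linarith
      simp [h₂, this]
    rw [hev.fderiv_eq, hev.eq_of_nhds]

/-- cutoff -/
noncomputable def cutoff (R : ℝ) (x : E) : ℝ := max 0 (min 1 (R + 3 - ‖x‖))

theorem cutoff_cont (R : ℝ) : Continuous (cutoff R : E → ℝ) := by
  unfold cutoff; fun_prop

theorem cutoff_one {R : ℝ} {x : E} (hx : ‖x‖ ≤ R + 2) : cutoff R x = 1 := by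
  unfold cutoff
  rw [min_eq_left (by linarith), max_eq_right zero_le_one]

theorem cutoff_cs (R : ℝ) : HasCompactSupport (cutoff R : E → ℝ) := by
  refine HasCompactSupport.of_support_subset_isCompact (isCompact_closedBall (0:E) (R + 3)) ?_
  intro x hx
  rw [mem_closedBall_zero_iff]
  by_contra h
  apply hx
  unfold cutoff
  rw [max_eq_left]
  exact (min_le_right _ _).trans (by linarith)

theorem exists_lower {X : Type*} [TopologicalSpace X] {C : Set X} (hC : IsCompact C) (F : X → E)
    (hF : ContinuousOn F C) (h0 : ∀ x ∈ C, F x ≠ 0) : ∃ η > 0, ∀ x ∈ C, η ≤ ‖F x‖ := by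
  rcases C.eq_empty_or_nonempty with h | h
  · exact ⟨1, one_pos, by simp [h]⟩
  · obtain ⟨x, hx, hm⟩ := hC.exists_isMinOn h hF.norm
    exact ⟨‖F x‖, norm_pos_iff.2 (h0 x hx), fun y hy => hm hy⟩

theorem degree_zero (H : ℝ → E → E) (hH : Continuous (Function.uncurry H)) {R : ℝ} (hR : 0 < R)
    (hRH : ∀ s ∈ Icc (0:ℝ) 1, ∀ x, R ≤ ‖x‖ → H s x ≠ 0) (h1 : ∀ x, H 1 x ≠ 0) :
    ∃ η > 0, ∀ ε > 0, ∃ δ₀ > 0, ∀ (f : E → ℝ) (δ : ℝ), δ ≤ δ₀ → IsMoll μ f δ →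
      (∀ x ∈ closedBall (0:E) (R + 1), dist (moll μ f (fun x => cutoff R x • H 0 x) x) (H 0 x) ≤ ε) ∧
      ∀ y, ‖y‖ < η → (∀ x ∈ closedBall (0:E) (R + 1), moll μ f (fun x => cutoff R x • H 0 x) x = y →
          (fderiv ℝ (moll μ f (fun x => cutoff R x • H 0 x)) x).det ≠ 0) →
        ∃ F : Finset E, (∀ x, x ∈ F ↔ x ∈ closedBall (0:E) (R + 1) ∧
            moll μ f (fun x => cutoff R x • H 0 x) x = y) ∧
          ∑ x ∈ F, (SignType.sign (fderiv ℝ (moll μ f (fun x => cutoff R x • H 0 x)) x).det : ℤ) = 0 := by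
  have hHx : ∀ s, Continuous (H s) := fun s => hH.comp (by fun_prop : Continuous fun x : E => (s, x))
  -- lower bounds
  have hKc : IsCompact (closedBall (0:E) (R + 1)) := isCompact_closedBall _ _
  have hSh : IsCompact (closedBall (0:E) (R + 1) ∩ {x | R ≤ ‖x‖}) :=
    hKc.inter_right (isClosed_le continuous_const continuous_norm)
  obtain ⟨η₁, hη₁, hl₁⟩ := exists_lower ((isCompact_Icc (a := (0:ℝ)) (b := 1)).prod hSh) (Function.uncurry H)
    hH.continuousOn (fun x hx => hRH x.1 hx.1 x.2 hx.2.2)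
  obtain ⟨η₂, hη₂, hl₂⟩ := exists_lower hKc (H 1) (hHx 1).continuousOn (fun x _ => h1 x)
  set η := min η₁ η₂ / 4 with hηd
  have hη : 0 < η := by positivity
  have h41 : 4 * η ≤ η₁ := by rw [hηd]; linarith [min_le_left η₁ η₂]
  have h42 : 4 * η ≤ η₂ := by rw [hηd]; linarith [min_le_right η₁ η₂]
  refine ⟨η, hη, fun ε hε => ?_⟩
  set ε₀ := min ε (η / 4) with hε₀d
  have hε₀ : 0 < ε₀ := by positivity
  have hε1 : ε₀ ≤ ε := min_le_left _ _
  have hε2 : ε₀ ≤ η / 4 := min_le_right _ _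
  have huc : UniformContinuousOn (Function.uncurry H) (Icc (0:ℝ) 1 ×ˢ closedBall (0:E) (R + 2)) :=
    (isCompact_Icc.prod (isCompact_closedBall _ _)).uniformContinuousOn_of_continuous hH.continuousOn
  obtain ⟨δ₁, hδ₁, hd⟩ := Metric.uniformContinuousOn_iff.1 huc ε₀ hε₀
  refine ⟨min δ₁ 1, by positivity, fun f δ hδ hf => ?_⟩
  have hδ1 : δ ≤ δ₁ := hδ.trans (min_le_left _ _)
  have hδ2 : δ ≤ 1 := hδ.trans (min_le_right _ _)
  set Ψ : ℝ → E → E := fun s => moll μ f (fun x => cutoff R x • H s x) with hΨ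
  have hcc : ∀ s, Continuous (fun x => cutoff R x • H s x) := fun s => (cutoff_cont R).smul (hHx s)
  have hΨc : ∀ s, ContDiff ℝ 1 (Ψ s) := fun s => hf.contDiff (hcc s)
  have hΨs : ∀ s, HasCompactSupport (Ψ s) := fun s => hf.compactSupport (cutoff_cs R).smul_right
  have hdist : ∀ s ∈ Icc (0:ℝ) 1, ∀ x ∈ closedBall (0:E) (R + 1), dist (Ψ s x) (H s x) ≤ ε₀ := by
    intro s hs x hx
    rw [mem_closedBall_zero_iff] at hx
    have e : (fun x => cutoff R x • H s x) x = H s x := by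
      simp only [cutoff_one (show ‖x‖ ≤ R + 2 by linarith), one_smul]
    rw [← e]
    refine hf.dist_le (hcc s) hε₀.le fun z hz => ?_
    have hzn : ‖z‖ ≤ R + 2 := by
      have : ‖z - x‖ < δ := by simpa [dist_eq_norm] using hz
      have h2 : ‖z‖ ≤ ‖z - x‖ + ‖x‖ := by simpa using norm_add_le (z - x) x
      linarith
    simp only [cutoff_one hzn, cutoff_one (show ‖x‖ ≤ R + 2 by linarith), one_smul]
    refine (hd (s, z) ⟨hs, by simpa using hzn⟩ (s, x) ⟨hs, by simpa using (by linarith : ‖x‖ ≤ R + 2)⟩ ?_).le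
    rw [Prod.dist_eq, dist_self, max_eq_right dist_nonneg]
    exact lt_of_lt_of_le hz hδ1
  have h0mem : (0:ℝ) ∈ Icc (0:ℝ) 1 := ⟨le_rfl, zero_le_one⟩
  have h1mem : (1:ℝ) ∈ Icc (0:ℝ) 1 := ⟨zero_le_one, le_rfl⟩
  refine ⟨fun x hx => (hdist 0 h0mem x hx).trans hε1, fun y hy hreg => ?_⟩
  have hlow : ∀ s ∈ Icc (0:ℝ) 1, ∀ x, R ≤ ‖x‖ → ‖x‖ ≤ R + 1 → 2 * η ≤ ‖Ψ s x‖ := by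
    intro s hs x hx1 hx2
    have hxm : x ∈ closedBall (0:E) (R + 1) := by simpa using hx2
    have a := hl₁ (s, x) ⟨hs, hxm, hx1⟩
    have b := hdist s hs x hxm
    rw [dist_eq_norm] at b
    have c : ‖H s x‖ ≤ ‖Ψ s x‖ + ‖Ψ s x - H s x‖ := by
      have := norm_sub_le (Ψ s x) (Ψ s x - H s x)
      simpa using this
    have d : ‖Function.uncurry H (s, x)‖ = ‖H s x‖ := rfl
    linarith
  have hJ : ∀ (g : E → ℝ), Continuous g → (∀ z, η ≤ ‖z‖ → g z = 0) →
      ∫ x in closedBall 0 (R + 1), g (Ψ 0 x) * (fderiv ℝ (Ψ 0) x).det ∂μ = 0 := by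
    intro g hg hgz
    obtain ⟨n, hn⟩ := exists_nat_gt (1 / δ₁)
    have hn0 : (0:ℝ) < n := lt_trans (by positivity) hn
    have hstep : ∀ k : ℕ, k ≤ n → 
        ∫ x in closedBall 0 (R + 1), g (Ψ 0 x) * (fderiv ℝ (Ψ 0) x).det ∂μ =
        ∫ x in closedBall 0 (R + 1), g (Ψ (k / n) x) * (fderiv ℝ (Ψ (k / n)) x).det ∂μ := by
      intro k
      induction k with
      | zero => intro _; simp
      | succ k ih =>
        intro hk
        rw [ih (by omega)]
        have hkn : ((k:ℝ) + 1) ≤ n := by exact_mod_cast hk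
        have m0 : (k:ℝ) / n ∈ Icc (0:ℝ) 1 := ⟨by positivity, by rw [div_le_one hn0]; linarith⟩
        have m1 : ((k + 1 : ℕ):ℝ) / n ∈ Icc (0:ℝ) 1 := ⟨by positivity, by push_cast; rw [div_le_one hn0]; linarith⟩
        refine step_eq μ (hΨc _) (hΨs _) (hΨc _) hR hη g hg hgz fun x hx1 hx2 => ⟨hlow _ m0 x hx1 hx2, hlow _ m1 x hx1 hx2, ?_⟩
        have hxm : x ∈ closedBall (0:E) (R + 1) := by simpa using hx2
        have hxm2 : x ∈ closedBall (0:E) (R + 2) := by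
          rw [mem_closedBall_zero_iff]; linarith
        have a := hdist _ m0 x hxm
        have b := hdist _ m1 x hxm
        have c := hd (((k + 1 : ℕ):ℝ) / n, x) ⟨m1, hxm2⟩ ((k:ℝ) / n, x) ⟨m0, hxm2⟩ (by
          rw [Prod.dist_eq, dist_self, max_eq_left dist_nonneg, Real.dist_eq, ← sub_div]
          push_cast
          rw [add_sub_cancel_left, abs_of_pos (by positivity)]
          rw [div_lt_iff₀ hδ₁] at hn
          rw [div_lt_iff₀ hn0]
          linarith)
        rw [← dist_eq_norm]
        have t1 := dist_triangle (Ψ (((k + 1 : ℕ):ℝ) / n) x) (H (((k + 1 : ℕ):ℝ) / n) x) (Ψ ((k:ℝ) / n) x)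
        have t2 := dist_triangle (H (((k + 1 : ℕ):ℝ) / n) x) (H ((k:ℝ) / n) x) (Ψ ((k:ℝ) / n) x)
        rw [dist_comm (H ((k:ℝ) / n) x)] at t2
        have c' : dist (H (((k + 1 : ℕ):ℝ) / n) x) (H ((k:ℝ) / n) x) < ε₀ := c
        linarith
    rw [hstep n le_rfl, div_self hn0.ne']
    have : ∀ x ∈ closedBall (0:E) (R + 1), g (Ψ 1 x) * (fderiv ℝ (Ψ 1) x).det = 0 := by
      intro x hx
      rw [hgz, zero_mul]
      have a := hl₂ x hx
      have b := hdist 1 h1mem x hx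
      rw [dist_eq_norm] at b
      have c : ‖H 1 x‖ ≤ ‖Ψ 1 x‖ + ‖Ψ 1 x - H 1 x‖ := by
        have := norm_sub_le (Ψ 1 x) (Ψ 1 x - H 1 x)
        simpa using this
      linarith
    rw [setIntegral_congr_fun measurableSet_closedBall this]
    simp
  obtain ⟨F, hF, e, he, hcount⟩ := local_count μ (hΨc 0) hKc y (fun x hx hxy => ⟨hreg x hx hxy, by
    apply ball_subset_interior_closedBall
    rw [mem_ball_zero_iff]
    by_contra hge
    have hx' : ‖x‖ ≤ R + 1 := by simpa using hx
    have := hlow 0 h0mem x (by linarith) hx'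
    rw [hxy] at this
    linarith⟩)
  refine ⟨F, hF, ?_⟩
  set e' := min e (η - ‖y‖) with he'
  have he'p : 0 < e' := lt_min he (by linarith)
  let g : E → ℝ := fun z => max 0 (e' - dist z y)
  have hg : Continuous g := by fun_prop
  have hgn : ∀ z, 0 ≤ g z := fun z => le_max_left _ _
  have hg0 : ∀ z, e' ≤ dist z y → g z = 0 := fun z hz => max_eq_left (by linarith)
  have hc1 := hcount g hg (fun z hz => hg0 z ((min_le_left _ _).trans hz))
  rw [hJ g hg (fun z hz => hg0 z ((min_le_right _ _).trans (by
    rw [dist_eq_norm]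
    have := norm_sub_norm_le z y
    linarith)))] at hc1
  have hgs : HasCompactSupport g := by
    refine HasCompactSupport.of_support_subset_isCompact (isCompact_closedBall y e') ?_
    intro z hz
    rw [mem_closedBall]
    by_contra hlt
    exact hz (hg0 z (not_le.1 hlt).le)
  have hpos : 0 < ∫ z, g z ∂μ := by
    refine hg.integral_pos_of_hasCompactSupport_nonneg_nonzero hgs hgn (x := y) ?_
    simp only [g, dist_self, sub_zero]
    rw [max_eq_right he'p.le]
    exact he'p.ne'
  have hsum : ∑ x ∈ F, (SignType.sign (fderiv ℝ (Ψ 0) x).det : ℝ) = 0 := by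
    rcases mul_eq_zero.1 hc1.symm with h | h
    · exact h
    · exact absurd h hpos.ne'
  have : ((∑ x ∈ F, (SignType.sign (fderiv ℝ (Ψ 0) x).det : ℤ) : ℤ) : ℝ) = 0 := by
    rw [Int.cast_sum]
    refine Eq.trans ?_ hsum
    refine Finset.sum_congr rfl fun x _ => ?_
    generalize SignType.sign (fderiv ℝ (Ψ 0) x).det = a
    cases a <;> simp
  exact_mod_cast this

end PartE

end WrapE

section WrapF
set_option linter.unusedSectionVars false
open MeasureTheory Set Filter Topology Metric
section PartF
variable {E : Type*} [NormedAddCommGroup E] [NormedSpace ℝ E] [FiniteDimensional ℝ E]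

theorem dvd_sum_of_free {p : ℕ} (hp : p.Prime) {X : Type*} (S : Finset X) (ρ : X → X)
    (hS : ∀ x ∈ S, ρ x ∈ S) (hρ : ∀ x ∈ S, ρ^[p] x = x) (hfree : ∀ x ∈ S, ρ x ≠ x) (g : X → ℤ)
    (hg : ∀ x ∈ S, g (ρ x) = g x) : (p : ℤ) ∣ ∑ x ∈ S, g x := by
  classical
  have : Fact p.Prime := ⟨hp⟩
  rw [← Finset.sum_fiberwise_of_maps_to (s := S) (t := S.image g) (g := g) (fun x hx => Finset.mem_image_of_mem _ hx)]
  refine Finset.dvd_sum fun a _ => ?_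
  rw [Finset.sum_congr rfl (g := fun _ => a) (fun x hx => (Finset.mem_filter.1 hx).2), Finset.sum_const, nsmul_eq_mul]
  refine Dvd.dvd.mul_right ?_ _
  set T := S.filter (fun x => g x = a)
  have hT : ∀ x ∈ T, ρ x ∈ T := fun x hx => by
    rw [Finset.mem_filter] at hx ⊢
    exact ⟨hS x hx.1, (hg x hx.1).trans hx.2⟩
  let φ : Function.End T := fun x => ⟨ρ x, hT x x.2⟩
  have hφ : ∀ n : ℕ, ∀ x : T, ((φ ^ n) x : X) = ρ^[n] x := by
    intro n
    induction n with
    | zero => intro x; rfl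
    | succ n ih =>
      intro x
      rw [pow_succ, Function.iterate_succ_apply]
      exact ih (φ x)
  have h1 : φ ^ p ^ 1 = 1 := by
    funext x
    rw [pow_one]
    exact Subtype.ext ((hφ p x).trans (hρ x (Finset.mem_filter.1 x.2).1))
  have h2 := Equiv.Perm.card_fixedPoints_modEq h1
  have h3 : Fintype.card (Function.fixedPoints φ) = 0 := by
    rw [Fintype.card_eq_zero_iff]
    exact ⟨fun x => hfree x.1.1 (Finset.mem_filter.1 x.1.2).1 (congrArg Subtype.val x.2)⟩
  rw [h3, Nat.modEq_zero_iff_dvd, Fintype.card_coe] at h2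
  exact_mod_cast h2

theorem local_unique [Nontrivial E] (L : E →L[ℝ] E) (hL : L.det ≠ 0) : ∃ c : NNReal, 0 < c ∧
    ∀ (x : E) (r : ℝ), 0 < r → ∃ η > 0, ∀ Ψ : E → E, ContDiff ℝ 1 Ψ →
      ApproximatesLinearOn Ψ L (ball x r) c → ‖Ψ x‖ ≤ η → ∀ y, ‖y‖ ≤ η →
      (∃ z ∈ ball x r, Ψ z = y) ∧ (∀ z ∈ ball x r, ∀ z' ∈ ball x r, Ψ z = Ψ z' → z = z') ∧
      ∀ z ∈ ball x r, SignType.sign (fderiv ℝ Ψ z).det = SignType.sign L.det := by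
  obtain ⟨e, he⟩ := exists_equiv_of_det_ne_zero L hL
  have hdc : Continuous fun D : E →L[ℝ] E => D.det := ContinuousLinearMap.continuous_det
  obtain ⟨c₁, hc₁, hc₁'⟩ := Metric.continuousAt_iff.1 (hdc.continuousAt (x := L)) |L.det| (abs_pos.2 hL)
  have hN : 0 < ‖(e.symm : E →L[ℝ] E)‖₊⁻¹ := by
    have : (e.symm : E →L[ℝ] E) ≠ 0 := by
      intro h
      obtain ⟨x, hx⟩ := exists_ne (0:E)
      apply hx
      have := congrArg e (DFunLike.congr_fun h (e x))
      have h3 : e.symm (e x) = 0 := by simpa using DFunLike.congr_fun h (e x)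
      simpa using h3
    exact inv_pos.2 (nnnorm_pos.2 this)
  let c : NNReal := min (‖(e.symm : E →L[ℝ] E)‖₊⁻¹) (c₁.toNNReal) / 2
  have hc0 : 0 < c := by
    have : 0 < c₁.toNNReal := Real.toNNReal_pos.2 hc₁
    have := lt_min hN this
    exact half_pos this
  have hc1 : c < ‖(e.symm : E →L[ℝ] E)‖₊⁻¹ :=
    (half_lt_self (lt_min hN (Real.toNNReal_pos.2 hc₁))).trans_le (min_le_left _ _)
  have hc2 : (c:ℝ) < c₁ := by
    have : c < c₁.toNNReal :=
      (half_lt_self (lt_min hN (Real.toNNReal_pos.2 hc₁))).trans_le (min_le_right _ _)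
    have h2 : (c:ℝ) < (c₁.toNNReal : ℝ) := by exact_mod_cast this
    rwa [Real.coe_toNNReal _ hc₁.le] at h2
  refine ⟨c, hc0, fun x r hr => ?_⟩
  have hgap : (0:ℝ) < (‖(e.symm : E →L[ℝ] E)‖₊ : ℝ)⁻¹ - c := by
    rw [sub_pos]
    exact_mod_cast hc1
  set η := ((‖(e.symm : E →L[ℝ] E)‖₊ : ℝ)⁻¹ - c) * (r / 2) / 2 with hη
  refine ⟨η, by positivity, fun Ψ hΨ hap hx y hy => ⟨?_, ?_, ?_⟩⟩
  · rw [← he] at hap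
    have hs := hap.surjOn_closedBall_of_nonlinearRightInverse e.toNonlinearRightInverse (b := x) (ε := r/2) (by positivity)
      (closedBall_subset_ball (by linarith))
    have hy' : y ∈ closedBall (Ψ x) (((e.toNonlinearRightInverse.nnnorm : ℝ)⁻¹ - c) * (r/2)) := by
      rw [mem_closedBall, dist_eq_norm]
      have e1 : ((e.toNonlinearRightInverse.nnnorm : ℝ)⁻¹ - c) * (r/2) = 2 * η := by
        rw [hη]
        show ((‖(e.symm : E →L[ℝ] E)‖₊ : ℝ)⁻¹ - c) * (r / 2) = _
        ring
      rw [e1]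
      exact (norm_sub_le _ _).trans (by linarith)
    obtain ⟨z, hz, hzy⟩ := hs hy'
    exact ⟨z, closedBall_subset_ball (by linarith) hz, hzy⟩
  · rw [← he] at hap
    intro z hz z' hz' h
    exact hap.injOn (Or.inr hc1) hz hz' h
  · intro z hz
    have h1 := hap.lipschitzOnWith
    have hd : HasFDerivAt Ψ (fderiv ℝ Ψ z) z := (hΨ.differentiable one_ne_zero z).hasFDerivAt
    have h2 : HasFDerivAt (Ψ - ⇑L) (fderiv ℝ Ψ z - L) z := hd.sub L.hasFDerivAt
    have h3 := h2.le_of_lipschitzOn (isOpen_ball.mem_nhds hz) h1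
    have h4 := hc₁' (x := fderiv ℝ Ψ z) (by rw [dist_eq_norm]; linarith)
    rw [Real.dist_eq, abs_lt] at h4
    rcases lt_or_gt_of_ne hL with h | h
    · rw [abs_of_neg h] at h4
      rw [sign_neg h, sign_neg (by linarith)]
    · rw [abs_of_pos h] at h4
      rw [sign_pos h, sign_pos (by linarith)]

end PartF

end WrapF

section WrapG
set_option linter.unusedSectionVars false
open MeasureTheory Set Filter Topology Metric
section PartG
variable {E : Type*} [NormedAddCommGroup E] [NormedSpace ℝ E] [FiniteDimensional ℝ E]

theorem det_one_of_pow {p : ℕ} (hodd : Odd p) (ρ : E →L[ℝ] E) (h : ρ ^ p = 1) : ρ.det = 1 := by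
  have h1 : (ρ : E →ₗ[ℝ] E) ^ p = 1 := by
    have := congrArg (fun D : E →L[ℝ] E => (D : E →ₗ[ℝ] E)) h
    simpa using this
  have h2 : (LinearMap.det (ρ : E →ₗ[ℝ] E)) ^ p = 1 := by
    rw [← map_pow, h1, map_one]
  have : StrictMono fun x : ℝ => x ^ p := hodd.strictMono_pow
  exact this.injective (by simpa using h2)

theorem thmD [Nontrivial E] {p : ℕ} (hp : p.Prime) (hodd : Odd p) {m : ℕ} (ρ : Fin m → E →L[ℝ] E)
    (hρp : ∀ i, ρ i ^ p = 1) (hρn : ∀ i x, ‖ρ i x‖ = ‖x‖) (r : Fin m → E → ℝ)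
    (hrl : ∀ i, LipschitzWith 1 (r i)) (hrρ : ∀ i j x, r j (ρ i x) = r j x)
    (hrf : ∀ i x, ρ i x = x → r i x ≤ 0)
    (N : E → ℝ) (hN : ContDiff ℝ 1 N) (hN0 : N 0 = 0) (hN1 : ∀ x, ‖x‖ ^ 2 ≤ N x)
    (hNρ : ∀ i x, N (ρ i x) = N x)
    (H : ℝ → E → E) (hH : Continuous (Function.uncurry H)) {R : ℝ} (hR : 0 < R)
    (hRH : ∀ s ∈ Icc (0:ℝ) 1, ∀ x, R ≤ ‖x‖ → H s x ≠ 0) (h1 : ∀ x, H 1 x ≠ 0)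
    (hHρ : ∀ i x, 1 ≤ r i x → H 0 (ρ i x) = H 0 x)
    (P : Finset E) (hP : ∀ x, (∀ i, r i x ≤ 5 / 4) → H 0 x = 0 → x ∈ P)
    (hP0 : ∀ x ∈ P, H 0 x = 0) (hPr : ∀ x ∈ P, ∀ i, r i x < 5 / 4)
    (L : E → E →L[ℝ] E) (hL : ∀ x ∈ P, HasStrictFDerivAt (H 0) (L x) x)
    (hsign : (∀ x ∈ P, 0 < (L x).det) ∨ (∀ x ∈ P, (L x).det < 0)) : p ∣ P.card := by
  classical
  let _ : MeasurableSpace E := borel E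
  have : BorelSpace E := ⟨rfl⟩
  let μ : Measure E := Measure.addHaar
  have hH0 : Continuous (H 0) := hH.comp (by fun_prop : Continuous fun x : E => ((0:ℝ), x))
  have hLne : ∀ x ∈ P, (L x).det ≠ 0 := by
    intro x hx
    rcases hsign with h | h
    · exact (h x hx).ne'
    · exact (h x hx).ne
  have hrc : ∀ i, Continuous (r i) := fun i => (hrl i).continuous
  have hdet1 : ∀ i, (ρ i).det = 1 := fun i => det_one_of_pow hodd _ (hρp i)
  have hPR : ∀ x ∈ P, ‖x‖ < R := by
    intro x hx
    by_contra h
    exact hRH 0 ⟨le_rfl, zero_le_one⟩ x (not_lt.1 h) (hP0 x hx)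
  have hc : ∀ x : E, ∃ c : NNReal, x ∈ P → 0 < c ∧
    ∀ (x' : E) (r : ℝ), 0 < r → ∃ η > 0, ∀ Ψ : E → E, ContDiff ℝ 1 Ψ →
      ApproximatesLinearOn Ψ (L x) (ball x' r) c → ‖Ψ x'‖ ≤ η → ∀ y, ‖y‖ ≤ η →
      (∃ z ∈ ball x' r, Ψ z = y) ∧ (∀ z ∈ ball x' r, ∀ z' ∈ ball x' r, Ψ z = Ψ z' → z = z') ∧
      ∀ z ∈ ball x' r, SignType.sign (fderiv ℝ Ψ z).det = SignType.sign (L x).det := by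
    intro x
    by_cases hx : x ∈ P
    · obtain ⟨c, h⟩ := local_unique (L x) (hLne x hx)
      exact ⟨c, fun _ => h⟩
    · exact ⟨0, fun h => absurd h hx⟩
  choose c hc using hc
  -- choose the radius
  have hrad : ∀ᶠ t : ℝ in 𝓝[>] 0, ∀ x ∈ P, ApproximatesLinearOn (H 0) (L x) (ball x (2 * t)) (c x) ∧
      (∀ z ∈ ball x (2 * t), ∀ i, r i z < 5 / 4) ∧ (∀ z ∈ ball x (2 * t), ‖z‖ < R) ∧
      ∀ x' ∈ P, x' ≠ x → 2 * t ≤ dist x x' := by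
    rw [eventually_all_finset]
    intro x hx
    have key : ∀ s : Set E, s ∈ 𝓝 x → ∀ᶠ t : ℝ in 𝓝[>] 0, ball x (2 * t) ⊆ s := by
      intro s hs
      obtain ⟨e, he, hes⟩ := Metric.mem_nhds_iff.1 hs
      have : ∀ᶠ t : ℝ in 𝓝[>] 0, t < e / 2 := nhdsWithin_le_nhds (Iio_mem_nhds (by positivity))
      filter_upwards [this] with t ht
      exact (ball_subset_ball (by linarith)).trans hes
    obtain ⟨s, hs, hsa⟩ := (hL x hx).approximates_deriv_on_nhds (Or.inr (hc x hx).1)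
    have e1 := key s hs
    have e2 := key {z | ∀ i, r i z < 5 / 4} (by
      have : {z | ∀ i, r i z < 5 / 4} = ⋂ i, {z | r i z < 5 / 4} := by ext; simp
      rw [this]
      exact (isOpen_iInter_of_finite fun i => isOpen_lt (hrc i) continuous_const).mem_nhds (by
        simpa using hPr x hx))
    have e3 := key {z | ‖z‖ < R} ((isOpen_lt continuous_norm continuous_const).mem_nhds (hPR x hx))
    have e4 : ∀ᶠ t : ℝ in 𝓝[>] 0, ∀ x' ∈ P, x' ≠ x → 2 * t ≤ dist x x' := by
      rw [eventually_all_finset]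
      intro x' _
      by_cases hxx : x' = x
      · exact Eventually.of_forall fun t h => absurd hxx h
      · have hd : 0 < dist x x' := dist_pos.2 (Ne.symm hxx)
        have : ∀ᶠ t : ℝ in 𝓝[>] 0, t < dist x x' / 2 := nhdsWithin_le_nhds (Iio_mem_nhds (by positivity))
        filter_upwards [this] with t ht _
        linarith
    filter_upwards [e1, e2, e3, e4] with t a1 a2 a3 a4
    exact ⟨hsa.mono_set a1, fun z hz => a2 hz, fun z hz => a3 hz, a4⟩
  obtain ⟨t, ht, ht0⟩ := (hrad.and self_mem_nhdsWithin).exists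
  have hη : ∀ x : E, ∃ η > 0, x ∈ P → ∀ Ψ : E → E, ContDiff ℝ 1 Ψ →
      ApproximatesLinearOn Ψ (L x) (ball x t) (c x) → ‖Ψ x‖ ≤ η → ∀ y, ‖y‖ ≤ η →
      (∃ z ∈ ball x t, Ψ z = y) ∧ (∀ z ∈ ball x t, ∀ z' ∈ ball x t, Ψ z = Ψ z' → z = z') ∧
      ∀ z ∈ ball x t, SignType.sign (fderiv ℝ Ψ z).det = SignType.sign (L x).det := by
    intro x
    by_cases hx : x ∈ P
    · obtain ⟨η, h0, h⟩ := (hc x hx).2 x t ht0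
      exact ⟨η, h0, fun _ => h⟩
    · exact ⟨1, one_pos, fun h => absurd h hx⟩
  choose ηx hηx0 hηx using hη
  -- the rest
  have hCc : IsCompact (closedBall (0:E) (R + 1) ∩ ({x | ∀ i, r i x ≤ 5 / 4} ∩ ⋂ x ∈ P, (ball x t)ᶜ)) := by
    refine (isCompact_closedBall _ _).inter_right (IsClosed.inter ?_ ?_)
    · have : {z | ∀ i, r i z ≤ 5 / 4} = ⋂ i, {z | r i z ≤ 5 / 4} := by ext; simp
      rw [this]
      exact isClosed_iInter fun i => isClosed_le (hrc i) continuous_const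
    · exact isClosed_biInter fun x _ => isOpen_ball.isClosed_compl
  obtain ⟨η₂, hη₂, hlow⟩ := exists_lower hCc (H 0) hH0.continuousOn (by
    rintro x ⟨_, h2, h3⟩ h0
    have := mem_iInter₂.1 h3 x (hP x h2 h0)
    exact this (mem_ball_self ht0))
  obtain ⟨ηd, hηd, hdeg⟩ := degree_zero μ H hH hR hRH h1
  have hη' : ∀ᶠ η : ℝ in 𝓝[>] 0, (∀ x ∈ P, η ≤ ηx x) ∧ 2 * η < η₂ ∧ η ≤ ηd := by
    have g : ∀ a : ℝ, 0 < a → ∀ᶠ η : ℝ in 𝓝[>] 0, η < a := fun a ha =>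
      nhdsWithin_le_nhds (Iio_mem_nhds ha)
    refine Eventually.and ?_ (Eventually.and ?_ ?_)
    · rw [eventually_all_finset]
      intro x _
      filter_upwards [g _ (hηx0 x)] with η h using h.le
    · filter_upwards [g (η₂ / 2) (by positivity)] with η h
      linarith
    · filter_upwards [g _ hηd] with η h using h.le
  obtain ⟨η, ⟨hη1, hη2, hη3⟩, hη0⟩ := (hη'.and self_mem_nhdsWithin).exists
  obtain ⟨δ₀, hδ₀, hdeg⟩ := hdeg η hη0
  set δ := min δ₀ (min t (1 / 8)) with hδ
  have hδ0 : 0 < δ := by positivity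
  have hδ1 : δ ≤ δ₀ := min_le_left _ _
  have hδ2 : δ ≤ t := (min_le_right _ _).trans (min_le_left _ _)
  have hδ3 : δ ≤ 1 / 8 := (min_le_right _ _).trans (min_le_right _ _)
  obtain ⟨f, hf, hfN⟩ := exists_moll μ N hN hN0 hN1 hδ0
  obtain ⟨hdist, hdeg⟩ := hdeg f δ hδ1 hf
  set h : E → E := fun x => cutoff R x • H 0 x with hh
  have hhc : Continuous h := (cutoff_cont R).smul hH0
  set Ψ := moll μ f h with hΨd
  have hΨ : ContDiff ℝ 1 Ψ := hf.contDiff hhc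
  -- Sard
  have hsard : μ (Ψ '' {x | (fderiv ℝ Ψ x).det = 0}) = 0 := by
    refine addHaar_image_eq_zero_of_det_fderivWithin_eq_zero μ (f' := fderiv ℝ Ψ) (fun x _ => ?_) (fun x hx => hx)
    exact ((hΨ.differentiable one_ne_zero x).hasFDerivAt).hasFDerivWithinAt
  obtain ⟨y, hyb, hyn⟩ : ∃ y ∈ ball (0:E) η, y ∉ Ψ '' {x | (fderiv ℝ Ψ x).det = 0} := by
    by_contra hcon
    push Not at hcon
    have := measure_mono_null (fun y hy => hcon y hy : ball (0:E) η ⊆ _) hsard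
    exact (measure_ball_pos μ (0:E) hη0).ne' this
  rw [mem_ball_zero_iff] at hyb
  obtain ⟨F, hF, hsum⟩ := hdeg y (hyb.trans_le hη3) (fun x _ hxy h0 => hyn ⟨x, h0, hxy⟩)
  -- local
  have hloc : ∀ x ∈ P, (∃ z ∈ ball x t, Ψ z = y) ∧ (∀ z ∈ ball x t, ∀ z' ∈ ball x t, Ψ z = Ψ z' → z = z') ∧
      ∀ z ∈ ball x t, SignType.sign (fderiv ℝ Ψ z).det = SignType.sign (L x).det := by
    intro x hx
    obtain ⟨a1, a2, a3, a4⟩ := ht x hx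
    refine hηx x hx Ψ hΨ (hf.approx hhc ?_) ?_ y (hyb.le.trans (hη1 x hx))
    · have a5 := a1.mono_set (ball_subset_ball (by linarith : t + δ ≤ 2 * t))
      intro u hu v hv
      have := a5 u hu v hv
      have hu' := a3 u (ball_subset_ball (by linarith) hu)
      have hv' := a3 v (ball_subset_ball (by linarith) hv)
      simp only [hh, cutoff_one (show ‖u‖ ≤ R + 2 by linarith), cutoff_one (show ‖v‖ ≤ R + 2 by linarith), one_smul]
      exact this
    · have b := hdist x (by rw [mem_closedBall_zero_iff]; linarith [hPR x hx])
      rw [hP0 x hx, dist_zero_right] at b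
      exact b.trans (hη1 x hx)
  -- symmetry
  have hsym : ∀ i x, 9 / 8 ≤ r i x → Ψ (ρ i x) = Ψ x := by
    intro i x hx
    refine hf.symm (ρ i) (hdet1 i) (fun t => hfN _ _ (hNρ i t)) fun z hz => ?_
    have hz1 : 1 ≤ r i z := by
      have a := (hrl i).dist_le_mul z x
      rw [Real.dist_eq, abs_le] at a
      have b : dist z x < δ := hz
      have a1 := a.1
      simp only [NNReal.coe_one, one_mul] at a1
      linarith
    simp only [hh]
    rw [hHρ i z hz1]
    simp only [cutoff, hρn]
  have hsymd : ∀ i x, 9 / 8 < r i x → (fderiv ℝ Ψ (ρ i x)).det = (fderiv ℝ Ψ x).det := by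
    intro i x hx
    have e1 : (fun z => Ψ (ρ i z)) =ᶠ[𝓝 x] Ψ := by
      filter_upwards [(isOpen_lt continuous_const (hrc i)).mem_nhds hx] with z hz
      exact hsym i z (le_of_lt hz)
    have e2 : HasFDerivAt (fun z => Ψ (ρ i z)) ((fderiv ℝ Ψ (ρ i x)).comp (ρ i)) x :=
      ((hΨ.differentiable one_ne_zero (ρ i x)).hasFDerivAt).comp x (ρ i).hasFDerivAt
    rw [← e1.fderiv_eq, e2.fderiv]
    have : LinearMap.det (((fderiv ℝ Ψ (ρ i x)) : E →ₗ[ℝ] E) * (ρ i : E →ₗ[ℝ] E)) = _ := map_mul _ _ _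
    have h2 : LinearMap.det (ρ i : E →ₗ[ℝ] E) = 1 := hdet1 i
    rw [h2, mul_one] at this
    exact this.symm
  -- combinatorics
  let A : E → Finset (Fin m) := fun x => Finset.univ.filter fun i => 5 / 4 < r i x
  have hsplit := Finset.sum_fiberwise F A (fun x => (SignType.sign (fderiv ℝ Ψ x).det : ℤ))
  rw [hsum] at hsplit
  have hrest : ∀ B : Finset (Fin m), B ≠ ∅ →
      (p : ℤ) ∣ ∑ x ∈ F.filter (fun x => A x = B), (SignType.sign (fderiv ℝ Ψ x).det : ℤ) := by
    intro B hB
    obtain ⟨i, hi⟩ := Finset.nonempty_of_ne_empty hB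
    have hri : ∀ x ∈ F.filter (fun x => A x = B), 5 / 4 < r i x := by
      intro x hx
      have := (Finset.mem_filter.1 hx).2
      rw [← this] at hi
      exact (Finset.mem_filter.1 hi).2
    refine dvd_sum_of_free hp _ (ρ i) ?_ ?_ ?_ _ ?_
    · intro x hx
      have h5 := hri x hx
      rw [Finset.mem_filter, hF] at hx ⊢
      refine ⟨⟨?_, ?_⟩, ?_⟩
      · have := hx.1.1
        rw [mem_closedBall_zero_iff] at this ⊢
        rwa [hρn]
      · exact (hsym i x (by linarith)).trans hx.1.2
      · rw [← hx.2]
        simp only [A, hrρ]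
    · intro x _
      have := DFunLike.congr_fun (hρp i) x
      rw [ContinuousLinearMap.coe_pow'] at this
      exact this
    · intro x hx hfix
      have := hrf i x hfix
      linarith [hri x hx]
    · intro x hx
      rw [hsymd i x (by linarith [hri x hx])]
  have hmain : ∑ x ∈ F.filter (fun x => A x = ∅), (SignType.sign (fderiv ℝ Ψ x).det : ℤ) =
      ∑ x ∈ P, (SignType.sign (L x).det : ℤ) := by
    symm
    choose! z hz1 hz2 using fun x hx => (hloc x hx).1
    refine Finset.sum_bij (fun x _ => z x) ?_ ?_ ?_ ?_
    · intro x hx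
      obtain ⟨a1, a2, a3, a4⟩ := ht x hx
      have hzb : z x ∈ ball x (2 * t) := ball_subset_ball (by linarith) (hz1 x hx)
      rw [Finset.mem_filter, hF]
      refine ⟨⟨?_, hz2 x hx⟩, ?_⟩
      · rw [mem_closedBall_zero_iff]
        linarith [a3 _ hzb]
      · simp only [A, Finset.filter_eq_empty_iff]
        intro i _
        exact not_lt.2 (a2 _ hzb i).le
    · intro x hx x' hx' hzz
      by_contra hne
      have := (ht x hx).2.2.2 x' hx' (Ne.symm hne)
      have b1 : dist (z x) x < t := hz1 x hx
      have b2 : dist (z x') x' < t := hz1 x' hx'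
      rw [← hzz] at b2
      have := dist_triangle_left x x' (z x)
      linarith
    · intro w hw
      rw [Finset.mem_filter, hF] at hw
      obtain ⟨⟨hw1, hw2⟩, hw3⟩ := hw
      simp only [A, Finset.filter_eq_empty_iff] at hw3
      have hw4 : ∀ i, r i w ≤ 5 / 4 := fun i => not_lt.1 (hw3 (Finset.mem_univ i))
      have : ∃ x ∈ P, w ∈ ball x t := by
        by_contra hcon
        push Not at hcon
        have h1 := hlow w ⟨hw1, hw4, mem_iInter₂.2 fun x hx => hcon x hx⟩
        have h2 := hdist w hw1
        rw [hw2, dist_eq_norm] at h2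
        have h3 := norm_sub_norm_le (H 0 w) y
        rw [norm_sub_rev] at h3
        linarith
      obtain ⟨x, hx, hwx⟩ := this
      exact ⟨x, hx, (hloc x hx).2.1 _ (hz1 x hx) _ hwx ((hz2 x hx).trans hw2.symm)⟩
    · intro x hx
      rw [(hloc x hx).2.2 _ (hz1 x hx)]
  rw [← Finset.add_sum_erase _ _ (Finset.mem_univ (∅ : Finset (Fin m)))] at hsplit
  have hd2 : (p : ℤ) ∣ ∑ x ∈ P, (SignType.sign (L x).det : ℤ) := by
    rw [← hmain]
    have : (p:ℤ) ∣ ∑ B ∈ Finset.univ.erase (∅ : Finset (Fin m)),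
        ∑ x ∈ F.filter (fun x => A x = B), (SignType.sign (fderiv ℝ Ψ x).det : ℤ) :=
      Finset.dvd_sum fun B hB => hrest B (Finset.ne_of_mem_erase hB)
    rw [← dvd_add_left this, hsplit]
    exact dvd_zero _
  rcases hsign with hs | hs
  · rw [Finset.sum_congr rfl (g := fun _ => (1:ℤ)) (fun x hx => by rw [sign_pos (hs x hx)]; rfl)] at hd2
    simp at hd2
    exact_mod_cast hd2
  · rw [Finset.sum_congr rfl (g := fun _ => (-1:ℤ)) (fun x hx => by rw [sign_neg (hs x hx)]; rfl)] at hd2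
    simp at hd2
    exact_mod_cast hd2

end PartG

end WrapG

section WrapI
set_option linter.unusedSectionVars false
section PartI
open Matrix

/-- letters words in a group -/
def Word {G : Type*} [Group G] (S : ℕ → Set G) : List ℕ → G → Prop
  | [], v => v = 1
  | k :: l, v => ∃ r ∈ S k, ∃ v', Word S l v' ∧ v = r * v'

section abs
variable {G : Type*} [Group G] {S : ℕ → Set G} {T : Subgroup G}

theorem Word.append {l₁ l₂ : List ℕ} {v₁ v₂ : G} (h₁ : Word S l₁ v₁) (h₂ : Word S l₂ v₂) :
    Word S (l₁ ++ l₂) (v₁ * v₂) := by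
  induction l₁ generalizing v₁ with
  | nil => rw [show v₁ = 1 from h₁, one_mul]; exact h₂
  | cons k l ih =>
    obtain ⟨r, hr, v', hv', rfl⟩ := h₁
    exact ⟨r, hr, v' * v₂, ih hv', mul_assoc _ _ _⟩

theorem Word.split {l₁ l₂ : List ℕ} {v : G} (h : Word S (l₁ ++ l₂) v) :
    ∃ v₁ v₂, Word S l₁ v₁ ∧ Word S l₂ v₂ ∧ v = v₁ * v₂ := by
  induction l₁ generalizing v with
  | nil => exact ⟨1, v, rfl, h, (one_mul _).symm⟩
  | cons k l ih =>
    obtain ⟨r, hr, v', hv', rfl⟩ := h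
    obtain ⟨a, b, ha, hb, rfl⟩ := ih hv'
    exact ⟨r * a, b, ⟨r, hr, a, ha, rfl⟩, hb, (mul_assoc _ _ _).symm⟩

theorem Word.conj (hT : ∀ k, ∀ r ∈ S k, ∀ t ∈ T, t * r * t⁻¹ ∈ S k) {l : List ℕ} {v : G}
    (h : Word S l v) {t : G} (ht : t ∈ T) : Word S l (t * v * t⁻¹) := by
  induction l generalizing v with
  | nil => rw [show v = 1 from h]; show _ = _; group
  | cons k l ih =>
    obtain ⟨r, hr, v', hv', rfl⟩ := h
    exact ⟨_, hT k r hr t ht, _, ih hv', by group⟩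

theorem Word.mem_closure {l : List ℕ} {v : G} (h : Word S l v) {K : ℕ} (hl : ∀ k ∈ l, K ≤ k) :
    v ∈ Subgroup.closure {g | ∃ k, K ≤ k ∧ g ∈ S k} := by
  induction l generalizing v with
  | nil => rw [show v = 1 from h]; exact one_mem _
  | cons k l ih =>
    obtain ⟨r, hr, v', hv', rfl⟩ := h
    refine mul_mem (Subgroup.subset_closure ⟨k, hl k (by simp), hr⟩) (ih hv' fun j hj => hl j (by simp [hj]))

theorem word_nf (hT : ∀ k, ∀ r ∈ S k, ∀ t ∈ T, t * r * t⁻¹ ∈ S k)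
    (hcomm : ∀ j k, j + 2 ≤ k → ∀ a ∈ S j, ∀ b ∈ S k, a * b = b * a) (len : ℕ) :
    ∀ (k : ℕ) (l : List ℕ), l.Perm (List.range' k len) → ∀ v t, Word S l v → t ∈ T →
    ∃ b ∈ Subgroup.closure {g | ∃ j, k + 1 ≤ j ∧ g ∈ S j}, ∃ w, Word S (List.range' k len) w ∧
      v * t = b * (w * t) * b⁻¹ := by
  induction len with
  | zero =>
    intro k l hl v t hv ht
    simp only [List.range'_zero, List.perm_nil] at hl
    subst hl
    exact ⟨1, one_mem _, 1, rfl, by rw [show v = 1 from hv]; group⟩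
  | succ len ih =>
    intro k l hl v t hv ht
    have hk : k ∈ l := hl.mem_iff.2 (by simp [List.range'_succ])
    obtain ⟨x, y, rfl⟩ := List.append_of_mem hk
    obtain ⟨vx, v', hx, ⟨r, hr, vy, hy, rfl⟩, rfl⟩ := hv.split
    have hperm : (y ++ x).Perm (List.range' (k + 1) len) := by
      rw [List.range'_succ] at hl
      have h1 : (k :: (x ++ y)).Perm (k :: List.range' (k + 1) len) := List.perm_middle.symm.trans hl
      exact List.perm_append_comm.trans h1.cons_inv
    have hxK : ∀ j ∈ x, k + 1 ≤ j := by
      intro j hj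
      have : j ∈ List.range' (k + 1) len := hperm.mem_iff.1 (by simp [hj])
      rw [List.mem_range'_1] at this
      exact this.1
    obtain ⟨c, hc, w, hw, he⟩ := ih (k + 1) (y ++ x) hperm _ t (hy.append (hx.conj hT ht)) ht
    have hrc : r * c = c * r := by
      have : c ∈ Subgroup.centralizer {r} := by
        refine (Subgroup.closure_le _).2 ?_ hc
        rintro g ⟨j, hj, hg⟩
        rw [SetLike.mem_coe, Subgroup.mem_centralizer_singleton_iff]
        exact (hcomm k j hj r hr g hg).symm
      exact (Subgroup.mem_centralizer_singleton_iff.1 this).symm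
    refine ⟨vx * c, mul_mem (hx.mem_closure hxK) (Subgroup.closure_mono ?_ hc), r * w, ?_, ?_⟩
    · rintro g ⟨j, hj, hg⟩
      exact ⟨j, by omega, hg⟩
    · rw [List.range'_succ]
      exact ⟨r, hr, w, hw, rfl⟩
    · calc vx * (r * vy) * t = vx * r * (vy * (t * vx * t⁻¹) * t) * vx⁻¹ := by group
        _ = vx * (r * c) * (w * t) * c⁻¹ * vx⁻¹ := by rw [he]; group
        _ = _ := by rw [hrc]; group

theorem word_collect (hT : ∀ k, ∀ r ∈ S k, ∀ t ∈ T, t * r * t⁻¹ ∈ S k) {ι : Type*} (ks : ι → ℕ) (rs ts : ι → G) 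
    (hts : ∀ i, ts i ∈ T) (hrs : ∀ i, rs i ∈ S (ks i)) (l : List ι) :
    ∃ v, Word S (l.map ks) v ∧ (l.map fun i => rs i * ts i).prod = v * (l.map ts).prod := by
  induction l with
  | nil => exact ⟨1, rfl, by simp⟩
  | cons i l ih =>
    obtain ⟨v, hv, he⟩ := ih
    refine ⟨rs i * (ts i * v * (ts i)⁻¹), ⟨rs i, hrs i, _, hv.conj hT (hts i), rfl⟩, ?_⟩
    simp only [List.map_cons, List.prod_cons, he]
    group

theorem Word.fn {k len : ℕ} {w : G} (h : Word S (List.range' k len) w) :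
    ∃ r : ℕ → G, (∀ j, k ≤ j → j < k + len → r j ∈ S j) ∧ w = ((List.range' k len).map r).prod := by
  induction len generalizing k w with
  | zero =>
    exact ⟨fun j => 1, fun j h1 h2 => by omega, by rw [show w = 1 from h]; simp⟩
  | succ len ih =>
    rw [List.range'_succ] at h
    obtain ⟨r, hr, v', hv', rfl⟩ := h
    obtain ⟨r', hr', rfl⟩ := ih hv'
    refine ⟨fun j => if j = k then r else r' j, ?_, ?_⟩
    · intro j h1 h2
      by_cases hj : j = k
      · subst hj; simpa using hr
      · simpa [hj] using hr' j (by omega) (by omega)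
    · rw [List.range'_succ]
      simp only [List.map_cons, List.prod_cons, if_true]
      congr 2
      refine List.map_congr_left fun j hj => ?_
      rw [List.mem_range'_1] at hj
      rw [if_neg (by omega)]
end abs

end PartI

end WrapI

section WrapJ
set_option linter.unusedSectionVars false
section PartJ
open Matrix

/-- unitary group -/
abbrev UU (m : ℕ) := Matrix.unitaryGroup (Fin (m + 1)) ℂ

/-- letters on link k with diagonal entry β k -/
def SS (m : ℕ) (β : ℕ → ℂ) (k : ℕ) : Set (UU m) :=
  {r | (∀ i j : Fin (m+1), (r : Matrix (Fin (m+1)) (Fin (m+1)) ℂ) i j ≠ (1 : Matrix (Fin (m+1)) (Fin (m+1)) ℂ) i j → (i.val = k ∨ i.val = k + 1) ∧ (j.val = k ∨ j.val = k + 1)) ∧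
    (∀ i, i.val = k → (r : Matrix (Fin (m+1)) (Fin (m+1)) ℂ) i i = β k) ∧
    ∀ i j, i.val = k → j.val = k + 1 → (r : Matrix (Fin (m+1)) (Fin (m+1)) ℂ) i j = - star ((r : Matrix (Fin (m+1)) (Fin (m+1)) ℂ) j i)}

/-- diagonal torus -/
def TT (m : ℕ) : Subgroup (UU m) where
  carrier := {t | ∃ d : Fin (m + 1) → ℂ, (t : Matrix (Fin (m+1)) (Fin (m+1)) ℂ) = Matrix.diagonal d}
  mul_mem' := by
    rintro a b ⟨d, hd⟩ ⟨e, he⟩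
    exact ⟨fun i => d i * e i, by rw [UnitaryGroup.mul_val, hd, he, diagonal_mul_diagonal]⟩
  one_mem' := ⟨1, by simp⟩
  inv_mem' := by
    rintro a ⟨d, hd⟩
    exact ⟨star d, by rw [UnitaryGroup.inv_val, hd, star_eq_conjTranspose, diagonal_conjTranspose]⟩

theorem TT_norm {m : ℕ} {t : UU m} {d : Fin (m + 1) → ℂ} (h : (t : Matrix (Fin (m+1)) (Fin (m+1)) ℂ) = Matrix.diagonal d) (i) :
    star (d i) * d i = 1 := by
  have h1 := UnitaryGroup.star_mul_self t
  rw [h, star_eq_conjTranspose, diagonal_conjTranspose, diagonal_mul_diagonal] at h1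
  have := congrFun (congrFun h1 i) i
  simpa using this

theorem SS_conj {m : ℕ} {β : ℕ → ℂ} (k : ℕ) (r : UU m) (hr : r ∈ SS m β k) (t : UU m) (ht : t ∈ TT m) :
    t * r * t⁻¹ ∈ SS m β k := by
  obtain ⟨d, hd⟩ := ht
  have hn := TT_norm hd
  have he : ((t * r * t⁻¹ : UU m) : Matrix (Fin (m+1)) (Fin (m+1)) ℂ) = Matrix.of fun i j => d i * (r : Matrix (Fin (m+1)) (Fin (m+1)) ℂ) i j * star (d j) := by
    rw [UnitaryGroup.mul_val, UnitaryGroup.mul_val, UnitaryGroup.inv_val, hd, star_eq_conjTranspose, diagonal_conjTranspose]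
    ext i j
    simp
  obtain ⟨h1, h2, h3⟩ := hr
  have hn' : ∀ i, d i * star (d i) = 1 := fun i => by rw [mul_comm]; exact hn i
  refine ⟨?_, ?_, ?_⟩
  · intro i j hij
    apply h1
    intro hc
    apply hij
    rw [he]
    simp only [of_apply]
    rw [hc]
    by_cases h : i = j
    · subst h; simpa using hn' i
    · simp [one_apply_ne h]
  · intro i hi
    rw [he]
    simp only [of_apply]
    rw [h2 i hi, mul_right_comm, hn', one_mul]
  · intro i j hi hj
    rw [he]
    simp only [of_apply]
    rw [h3 i j hi hj]
    simp only [star_mul', star_star]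
    ring

theorem SS_comm {m : ℕ} {β : ℕ → ℂ} (j k : ℕ) (hjk : j + 2 ≤ k) (a : UU m) (ha : a ∈ SS m β j)
    (b : UU m) (hb : b ∈ SS m β k) : a * b = b * a := by
  have h1 : ((a : Matrix (Fin (m+1)) (Fin (m+1)) ℂ) - 1) * ((b : Matrix (Fin (m+1)) (Fin (m+1)) ℂ) - 1) = 0 := by
    ext x y
    rw [mul_apply, Matrix.zero_apply]
    refine Finset.sum_eq_zero fun z _ => ?_
    by_contra hne
    obtain ⟨p, q⟩ := mul_ne_zero_iff.1 hne
    have p' := (ha.1 x z (fun h => p (by rw [Matrix.sub_apply, h, sub_self]))).2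
    have q' := (hb.1 z y (fun h => q (by rw [Matrix.sub_apply, h, sub_self]))).1
    omega
  have h2 : ((b : Matrix (Fin (m+1)) (Fin (m+1)) ℂ) - 1) * ((a : Matrix (Fin (m+1)) (Fin (m+1)) ℂ) - 1) = 0 := by
    ext x y
    rw [mul_apply, Matrix.zero_apply]
    refine Finset.sum_eq_zero fun z _ => ?_
    by_contra hne
    obtain ⟨p, q⟩ := mul_ne_zero_iff.1 hne
    have p' := (hb.1 x z (fun h => p (by rw [Matrix.sub_apply, h, sub_self]))).2
    have q' := (ha.1 z y (fun h => q (by rw [Matrix.sub_apply, h, sub_self]))).1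
    omega
  apply Subtype.ext
  rw [UnitaryGroup.mul_val, UnitaryGroup.mul_val]
  have h3 := h1.trans h2.symm
  simp only [sub_mul, mul_sub, one_mul, mul_one] at h3
  have h4 := congrArg (fun M => M + (a : Matrix (Fin (m+1)) (Fin (m+1)) ℂ) + b - 1) h3
  convert h4 using 1 <;> abel

/-- columns of letters -/
theorem SS_col_fix {m : ℕ} {β : ℕ → ℂ} {k : ℕ} {r : UU m} (hr : r ∈ SS m β k) (j : Fin (m + 1))
    (h1 : j.val ≠ k) (h2 : j.val ≠ k + 1) : (r : Matrix (Fin (m+1)) (Fin (m+1)) ℂ) *ᵥ Pi.single j 1 = Pi.single j (1:ℂ) := by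
  rw [mulVec_single_one]
  ext i
  have : (r : Matrix (Fin (m+1)) (Fin (m+1)) ℂ) i j = (1 : Matrix (Fin (m+1)) (Fin (m+1)) ℂ) i j := by
    by_contra h
    have := (hr.1 i j h).2
    omega
  rw [col_apply, this, one_apply, Pi.single_apply]

theorem SS_row {m : ℕ} {β : ℕ → ℂ} {k : ℕ} {r : UU m} (hr : r ∈ SS m β k) (i j : Fin (m + 1))
    (hi : i.val = k) (hj : j.val = k + 1) (hβ : β k = 0) :
    Pi.single i 1 ᵥ* (r : Matrix (Fin (m+1)) (Fin (m+1)) ℂ) = (r : Matrix (Fin (m+1)) (Fin (m+1)) ℂ) i j • Pi.single j (1:ℂ) := by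
  rw [single_one_vecMul]
  ext l
  rw [row_apply, Pi.smul_apply, smul_eq_mul]
  by_cases hl : l = j
  · subst hl; simp
  · rw [Pi.single_eq_of_ne hl, mul_zero]
    by_cases hli : l = i
    · subst hli; rw [hr.2.1 l hi, hβ]
    · by_contra hne
      have := (hr.1 i l (by rwa [one_apply_ne (Ne.symm hli)])).2
      rcases this with h | h
      · exact hli (Fin.ext (by omega))
      · exact hl (Fin.ext (by omega))

theorem SS_col {m : ℕ} {β : ℕ → ℂ} {k : ℕ} {r : UU m} (hr : r ∈ SS m β k) (i j : Fin (m + 1))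
    (hi : i.val = k) (hj : j.val = k + 1) :
    (r : Matrix (Fin (m+1)) (Fin (m+1)) ℂ) *ᵥ Pi.single i 1 = β k • Pi.single i 1 + (r : Matrix (Fin (m+1)) (Fin (m+1)) ℂ) j i • Pi.single j (1:ℂ) := by
  have hij : i ≠ j := fun h => by rw [h] at hi; omega
  rw [mulVec_single_one]
  ext l
  rw [col_apply, Pi.add_apply, Pi.smul_apply, Pi.smul_apply, smul_eq_mul, smul_eq_mul]
  by_cases hl : l = j
  · subst hl; simp [Pi.single_eq_of_ne (Ne.symm hij)]
  · rw [Pi.single_eq_of_ne hl, mul_zero, add_zero]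
    by_cases hli : l = i
    · subst hli; rw [hr.2.1 l hi]; simp
    · rw [Pi.single_eq_of_ne hli, mul_zero]
      by_contra hne
      have := (hr.1 l i (by rwa [one_apply_ne hli])).1
      rcases this with h | h
      · exact hli (Fin.ext (by omega))
      · exact hl (Fin.ext (by omega))

theorem SS_normsq {m : ℕ} {β : ℕ → ℂ} {k : ℕ} {r : UU m} (hr : r ∈ SS m β k) (i j : Fin (m + 1))
    (hi : i.val = k) (hj : j.val = k + 1) (hβ : β k = 0) :
    star ((r : Matrix (Fin (m+1)) (Fin (m+1)) ℂ) j i) * (r : Matrix (Fin (m+1)) (Fin (m+1)) ℂ) j i = 1 := by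
  have h1 := UnitaryGroup.star_mul_self r
  have h2 := congrFun (congrFun h1 i) i
  have h3 := SS_col hr i j hi hj
  rw [mulVec_single_one, hβ, zero_smul, zero_add] at h3
  rw [mul_apply, one_apply_eq, Finset.sum_eq_single j] at h2
  · simpa using h2
  · intro b _ hb
    have := congrFun h3 b
    rw [col_apply] at this
    rw [this]
    simp [Pi.single_eq_of_ne hb]
  · simp

end PartJ

end WrapJ

section WrapK
set_option linter.unusedSectionVars false
section PartK
open Matrix

/-- basis vectors indexed by naturals -/
def ee (m : ℕ) (j : ℕ) : Fin (m + 1) → ℂ := fun i => if i.val = j then 1 else 0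

theorem ee_eq (m j : ℕ) (hj : j < m + 1) : ee m j = Pi.single ⟨j, hj⟩ 1 := by
  ext i
  simp [ee, Pi.single_apply, Fin.ext_iff]

theorem ee_zero_entry (m : ℕ) (M : Matrix (Fin (m+1)) (Fin (m+1)) ℂ) : M 0 0 = ee m 0 ⬝ᵥ (M *ᵥ ee m 0) := by
  rw [ee_eq m 0 (by omega)]
  simp

theorem SS_ee_fix {m : ℕ} {β : ℕ → ℂ} {k : ℕ} {r : UU m} (hr : r ∈ SS m β k) (j : ℕ) (hj : j < m + 1)
    (h1 : j ≠ k) (h2 : j ≠ k + 1) : (r : Matrix (Fin (m+1)) (Fin (m+1)) ℂ) *ᵥ ee m j = ee m j := by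
  rw [ee_eq m j hj]
  exact SS_col_fix hr _ h1 h2

theorem SS_ee {m : ℕ} {β : ℕ → ℂ} {k : ℕ} {r : UU m} (hr : r ∈ SS m β k) (hk : k < m) :
    ∃ ρ : ℂ, (r : Matrix (Fin (m+1)) (Fin (m+1)) ℂ) *ᵥ ee m k = β k • ee m k + ρ • ee m (k + 1) ∧
      (β k = 0 → ee m k ᵥ* (r : Matrix (Fin (m+1)) (Fin (m+1)) ℂ) = (- star ρ) • ee m (k + 1)) ∧
      (β k = 0 → star ρ * ρ = 1) := by
  refine ⟨(r : Matrix (Fin (m+1)) (Fin (m+1)) ℂ) ⟨k + 1, by omega⟩ ⟨k, by omega⟩, ?_, ?_, ?_⟩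
  · rw [ee_eq m k (by omega), ee_eq m (k + 1) (by omega)]
    exact SS_col hr _ _ rfl rfl
  · intro h
    rw [ee_eq m k (by omega), ee_eq m (k + 1) (by omega), SS_row hr _ ⟨k + 1, by omega⟩ rfl rfl h]
    rw [hr.2.2 ⟨k, by omega⟩ ⟨k + 1, by omega⟩ rfl rfl]
  · exact SS_normsq hr _ _ rfl rfl

theorem prod_fix {m : ℕ} (r : ℕ → UU m) (x : Fin (m + 1) → ℂ) (l : List ℕ)
    (h : ∀ j ∈ l, (r j : Matrix (Fin (m+1)) (Fin (m+1)) ℂ) *ᵥ x = x) :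
    (((l.map r).prod : UU m) : Matrix (Fin (m+1)) (Fin (m+1)) ℂ) *ᵥ x = x := by
  induction l with
  | nil => simp
  | cons j l ih =>
    rw [List.map_cons, List.prod_cons, UnitaryGroup.mul_val, ← mulVec_mulVec, ih fun i hi => h i (by simp [hi]),
      h j (by simp)]

theorem closure_fix {m : ℕ} {β : ℕ → ℂ} {b : UU m}
    (hb : b ∈ Subgroup.closure {g | ∃ j, 0 + 1 ≤ j ∧ g ∈ SS m β j}) :
    (b : Matrix (Fin (m+1)) (Fin (m+1)) ℂ) *ᵥ ee m 0 = ee m 0 ∧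
    ((b⁻¹ : UU m) : Matrix (Fin (m+1)) (Fin (m+1)) ℂ) *ᵥ ee m 0 = ee m 0 := by
  have key : ∀ c : UU m, (c : Matrix (Fin (m+1)) (Fin (m+1)) ℂ) *ᵥ ee m 0 = ee m 0 →
      ((c⁻¹ : UU m) : Matrix (Fin (m+1)) (Fin (m+1)) ℂ) *ᵥ ee m 0 = ee m 0 := by
    intro c hc
    conv_lhs => rw [← hc]
    rw [mulVec_mulVec, ← UnitaryGroup.mul_val]
    simp
  have : (b : Matrix (Fin (m+1)) (Fin (m+1)) ℂ) *ᵥ ee m 0 = ee m 0 := by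
    induction hb using Subgroup.closure_induction with
    | mem x hx =>
      obtain ⟨j, hj, hx⟩ := hx
      exact SS_ee_fix hx 0 (by omega) (by omega) (by omega)
    | one => simp
    | mul x y _ _ hx hy => rw [UnitaryGroup.mul_val, ← mulVec_mulVec, hy, hx]
    | inv x _ hx => exact key x hx
  exact ⟨this, key b this⟩

theorem conj_entry {m : ℕ} (b x : UU m)
    (h1 : (b : Matrix (Fin (m+1)) (Fin (m+1)) ℂ) *ᵥ ee m 0 = ee m 0)
    (h2 : ((b⁻¹ : UU m) : Matrix (Fin (m+1)) (Fin (m+1)) ℂ) *ᵥ ee m 0 = ee m 0) :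
    ((b * x * b⁻¹ : UU m) : Matrix (Fin (m+1)) (Fin (m+1)) ℂ) 0 0 = (x : Matrix (Fin (m+1)) (Fin (m+1)) ℂ) 0 0 := by
  have h3 : ee m 0 ᵥ* (b : Matrix (Fin (m+1)) (Fin (m+1)) ℂ) = ee m 0 := by
    have h4 := congrArg star h2
    rw [star_mulVec, UnitaryGroup.inv_val, star_eq_conjTranspose, conjTranspose_conjTranspose] at h4
    have h5 : star (ee m 0) = ee m 0 := by ext i; simp [ee]
    rwa [h5] at h4
  rw [ee_zero_entry m ((b * x * b⁻¹ : UU m) : Matrix (Fin (m+1)) (Fin (m+1)) ℂ), ee_zero_entry m (x : Matrix (Fin (m+1)) (Fin (m+1)) ℂ), UnitaryGroup.mul_val, UnitaryGroup.mul_val, ← mulVec_mulVec, h2, ← mulVec_mulVec,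
    dotProduct_mulVec, h3]

theorem wt_entry {m : ℕ} {β : ℕ → ℂ} (r : ℕ → UU m) (hr : ∀ j, j < m → r j ∈ SS m β j) (t : UU m) (d : ℕ → ℂ)
    (ht : (t : Matrix (Fin (m+1)) (Fin (m+1)) ℂ) = diagonal fun j : Fin (m+1) => d j) (k : ℕ) (hk : k < m) (hβ : ∀ l < k, β l = 0) :
    (((((List.range' 0 m).map r).prod * t) ^ (k + 1) : UU m) : Matrix (Fin (m+1)) (Fin (m+1)) ℂ) 0 0
      = (-1) ^ k * (∏ j ∈ Finset.range (k + 1), d j) * β k := by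
  have hch : ∀ j, ∃ ρ : ℂ, j < m → ((r j : Matrix (Fin (m+1)) (Fin (m+1)) ℂ) *ᵥ ee m j = β j • ee m j + ρ • ee m (j + 1) ∧
      (β j = 0 → ee m j ᵥ* (r j : Matrix (Fin (m+1)) (Fin (m+1)) ℂ) = (- star ρ) • ee m (j + 1)) ∧
      (β j = 0 → star ρ * ρ = 1)) := by
    intro j
    by_cases hj : j < m
    · obtain ⟨ρ, h⟩ := SS_ee (hr j hj) hj
      exact ⟨ρ, fun _ => h⟩
    · exact ⟨0, fun h => absurd h hj⟩
  choose ρ hρ using hch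
  set w := ((List.range' 0 m).map r).prod with hw
  have hte : ∀ j, (t : Matrix (Fin (m+1)) (Fin (m+1)) ℂ) *ᵥ ee m j = d j • ee m j := by
    intro j
    rw [ht]
    ext i
    rw [mulVec_diagonal]
    simp only [ee, Pi.smul_apply, smul_eq_mul]
    split_ifs with h
    · rw [h]
    · simp
  have hsplit : ∀ j, j < m → w = ((List.range' 0 j).map r).prod * (r j * ((List.range' (j+1) (m - j - 1)).map r).prod) := by
    intro j hj
    have : List.range' 0 m = List.range' 0 j ++ (j :: List.range' (j+1) (m - j - 1)) := by
      rw [← List.range'_succ, show m - j - 1 + 1 = m - j by omega]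
      have := @List.range'_append 0 j (m - j) 1
      simp only [one_mul, zero_add] at this
      rw [this]
      congr 1; omega
    rw [hw, this]
    simp
  have hafix : ∀ j i, j < i → i ≤ m → j ≤ m → ((((List.range' 0 j).map r).prod : UU m) : Matrix (Fin (m+1)) (Fin (m+1)) ℂ) *ᵥ ee m i = ee m i := by
    intro j i hji him hjm
    refine prod_fix _ _ _ fun l hl => ?_
    rw [List.mem_range'_1] at hl
    exact SS_ee_fix (hr l (by omega)) i (by omega) (by omega) (by omega)
  have hwe : ∀ j, j < m → (w : Matrix (Fin (m+1)) (Fin (m+1)) ℂ) *ᵥ ee m j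
      = β j • ((((List.range' 0 j).map r).prod : UU m) : Matrix (Fin (m+1)) (Fin (m+1)) ℂ) *ᵥ ee m j + ρ j • ee m (j + 1) := by
    intro j hj
    have hfix : ((((List.range' (j+1) (m - j - 1)).map r).prod : UU m) : Matrix (Fin (m+1)) (Fin (m+1)) ℂ) *ᵥ ee m j = ee m j := by
      refine prod_fix _ _ _ fun l hl => ?_
      rw [List.mem_range'_1] at hl
      exact SS_ee_fix (hr l (by omega)) j (by omega) (by omega) (by omega)
    rw [hsplit j hj, UnitaryGroup.mul_val, UnitaryGroup.mul_val, ← mulVec_mulVec, ← mulVec_mulVec, hfix, (hρ j hj).1,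
      mulVec_add, mulVec_smul, mulVec_smul, hafix j (j+1) (by omega) (by omega) (by omega)]
  have hrow : ∀ j, j ≤ k → ee m 0 ᵥ* ((((List.range' 0 j).map r).prod : UU m) : Matrix (Fin (m+1)) (Fin (m+1)) ℂ)
      = (∏ l ∈ Finset.range j, (- star (ρ l))) • ee m j := by
    intro j
    induction j with
    | zero => intro; simp
    | succ j ih =>
      intro hj
      rw [List.range'_concat, List.map_append, List.prod_append, UnitaryGroup.mul_val, ← vecMul_vecMul, ih (by omega)]
      simp only [zero_add, one_mul, List.map_cons, List.map_nil, List.prod_cons, List.prod_nil, mul_one]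
      rw [smul_vecMul, (hρ j (by omega)).2.1 (hβ j (by omega)), Finset.prod_range_succ, smul_smul]
  have hpow : ∀ j, j ≤ k → (((w * t) ^ j : UU m) : Matrix (Fin (m+1)) (Fin (m+1)) ℂ) *ᵥ ee m 0
      = (∏ l ∈ Finset.range j, (d l * ρ l)) • ee m j := by
    intro j
    induction j with
    | zero => intro; simp
    | succ j ih =>
      intro hj
      rw [pow_succ', UnitaryGroup.mul_val, ← mulVec_mulVec, ih (by omega), mulVec_smul, UnitaryGroup.mul_val, ← mulVec_mulVec, hte,
        mulVec_smul, hwe j (by omega), hβ j (by omega), zero_smul, zero_add, Finset.prod_range_succ, smul_smul, smul_smul, mul_assoc]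
      
  rw [ee_zero_entry m (((w * t) ^ (k + 1) : UU m) : Matrix (Fin (m+1)) (Fin (m+1)) ℂ), pow_succ', UnitaryGroup.mul_val, ← mulVec_mulVec, hpow k le_rfl, mulVec_smul, UnitaryGroup.mul_val,
    ← mulVec_mulVec, hte, mulVec_smul, hwe k hk, dotProduct_smul, dotProduct_smul, dotProduct_add, dotProduct_smul,
    dotProduct_smul, dotProduct_mulVec, hrow k le_rfl, smul_dotProduct]
  have h1 : ee m k ⬝ᵥ ee m k = 1 := by
    rw [ee_eq m k (by omega)]; simp
  have h2 : ee m 0 ⬝ᵥ ee m (k + 1) = 0 := by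
    rw [ee_eq m 0 (by omega), single_dotProduct]; simp [ee]
  rw [h1, h2]
  have h3 : (∏ l ∈ Finset.range k, (d l * ρ l)) * (∏ l ∈ Finset.range k, (- star (ρ l))) = (-1) ^ k * ∏ l ∈ Finset.range k, d l := by
    rw [← Finset.prod_mul_distrib]
    have : ∀ l ∈ Finset.range k, d l * ρ l * (- star (ρ l)) = (-1) * d l := by
      intro l hl
      rw [Finset.mem_range] at hl
      have := (hρ l (by omega)).2.2 (hβ l hl)
      linear_combination (- d l) * this
    rw [Finset.prod_congr rfl this, Finset.prod_mul_distrib]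
    simp
  simp only [smul_eq_mul, mul_zero, add_zero, mul_one]
  rw [Finset.prod_range_succ]
  linear_combination d k * β k * h3

theorem lemE {m : ℕ} {β : ℕ → ℂ} (σ : Equiv.Perm (Fin m)) (rs ts : Fin m → UU m) (d : Fin m → ℕ → ℂ)
    (hts : ∀ i, (ts i : Matrix (Fin (m+1)) (Fin (m+1)) ℂ) = diagonal fun j : Fin (m+1) => d i j)
    (hrs : ∀ i, rs i ∈ SS m β (σ i)) (k : ℕ) (hk : k < m) (hβ : ∀ l < k, β l = 0) :
    (((List.ofFn fun i => rs i * ts i).prod ^ (k + 1) : UU m) : Matrix (Fin (m+1)) (Fin (m+1)) ℂ) 0 0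
      = (-1) ^ k * (∏ j ∈ Finset.range (k + 1), ∏ i, d i j) * β k := by
  obtain ⟨v, hv, he⟩ := word_collect (S := SS m β) (T := TT m) (fun k r hr t ht => SS_conj k r hr t ht) (fun i => ((σ i : Fin m) : ℕ)) rs ts
    (fun i => ⟨_, hts i⟩) hrs (List.finRange m)
  have hperm : ((List.finRange m).map fun i => ((σ i : Fin m) : ℕ)).Perm (List.range' 0 m) := by
    rw [List.perm_ext_iff_of_nodup]
    · intro a
      simp only [List.mem_map, List.mem_finRange, true_and, List.mem_range'_1]
      constructor
      · rintro ⟨i, rfl⟩; omega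
      · rintro ⟨_, h⟩; exact ⟨σ.symm ⟨a, by omega⟩, by simp⟩
    · refine List.Nodup.map ?_ (List.nodup_finRange m)
      exact Fin.val_injective.comp σ.injective
    · exact List.nodup_range'
  have htT : ((List.finRange m).map ts).prod ∈ TT m := by
    refine list_prod_mem ?_
    intro x hx
    obtain ⟨i, -, rfl⟩ := List.mem_map.1 hx
    exact ⟨_, hts i⟩
  obtain ⟨b, hb, w, hw, heq⟩ := word_nf (S := SS m β) (T := TT m) (fun k r hr t ht => SS_conj k r hr t ht)
    (fun j k hjk a ha b hb => SS_comm j k hjk a ha b hb) m 0 _ hperm v _ hv htT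
  obtain ⟨r, hr, rfl⟩ := hw.fn
  have h1 := closure_fix hb
  rw [List.ofFn_eq_map, he, heq, conj_pow, conj_entry _ _ h1.1 h1.2]
  refine wt_entry r (fun j hj => hr j (by omega) (by omega)) _ (fun j => ∏ i, d i j) ?_ k hk hβ
  have : ∀ l : List (Fin m), (((l.map ts).prod : UU m) : Matrix (Fin (m+1)) (Fin (m+1)) ℂ) = diagonal fun j : Fin (m+1) => (l.map fun i => d i j).prod := by
    intro l
    induction l with
    | nil => simp
    | cons i l ih => rw [List.map_cons, List.prod_cons, UnitaryGroup.mul_val, ih, hts, diagonal_mul_diagonal]; simp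
  rw [this]
  congr 1

end PartK

end WrapK

section WrapL
set_option linter.unusedSectionVars false

/-- square matrices of size m+1 -/
abbrev Mt (m : ℕ) := Matrix (Fin (m + 1)) (Fin (m + 1)) ℂ

section PartL
open Matrix

/-- cyclic vectors -/
def cc {m : ℕ} (v : Mt m) (j : ℕ) : Fin (m + 1) → ℂ := (v ^ j) *ᵥ ee m 0

theorem cc_zero {m : ℕ} (v : Mt m) : cc v 0 = ee m 0 := by simp [cc]

theorem cc_succ {m : ℕ} (v : Mt m) (j : ℕ) : v *ᵥ cc v j = cc v (j + 1) := by
  simp [cc, pow_succ']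

/-- matrix with columns the cyclic vectors -/
def GG {m : ℕ} (v : Mt m) : Mt m := Matrix.of fun i j => cc v j i

theorem cc_apply {m : ℕ} (v : Mt m) (j : ℕ) (i : Fin (m + 1)) : cc v j i = (v ^ j) i 0 := by
  rw [cc, ee_eq m 0 (by omega)]
  simp

theorem GG_mulVec {m : ℕ} (v : Mt m) (j : ℕ) (hj : j < m + 1) : GG v *ᵥ ee m j = cc v j := by
  rw [ee_eq m j hj]
  ext i
  simp [GG]

theorem pow_unit {m : ℕ} {v : Mt m} (hv : vᴴ * v = 1) (a : ℕ) : (v ^ a)ᴴ * v ^ a = 1 := by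
  induction a with
  | zero => simp
  | succ a ih => rw [pow_succ', conjTranspose_mul, Matrix.mul_assoc, ← Matrix.mul_assoc vᴴ, hv, Matrix.one_mul, ih]

theorem pow_unit_le {m : ℕ} {v : Mt m} (hv : vᴴ * v = 1) {a b : ℕ} (h : a ≤ b) : (v ^ a)ᴴ * v ^ b = v ^ (b - a) := by
  obtain ⟨c, rfl⟩ := Nat.exists_eq_add_of_le h
  rw [pow_add, ← Matrix.mul_assoc, pow_unit hv, Matrix.one_mul, Nat.add_sub_cancel_left]

theorem cc_inner {m : ℕ} (v : Mt m) (a b : ℕ) : star (cc v a) ⬝ᵥ cc v b = ((v ^ a)ᴴ * v ^ b) 0 0 := by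
  rw [mul_apply, dotProduct]
  refine Finset.sum_congr rfl fun i _ => ?_
  rw [Pi.star_apply, cc_apply, cc_apply, conjTranspose_apply]

/-- cyclic condition -/
def Cyc {m : ℕ} (v : Mt m) : Prop := ∀ n, 1 ≤ n → n ≤ m → (v ^ n) 0 0 = 0

theorem cc_orth {m : ℕ} {v : Mt m} (hv : vᴴ * v = 1) (hc : Cyc v) {a b : ℕ} (ha : a ≤ m) (hb : b ≤ m) (hab : a ≠ b) :
    star (cc v a) ⬝ᵥ cc v b = 0 := by
  rw [cc_inner]
  rcases lt_or_gt_of_ne hab with h | h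
  · rw [pow_unit_le hv h.le, hc _ (by omega) (by omega)]
  · have := pow_unit_le hv h.le
    have h2 := congrArg (fun M => Mᴴ 0 0) this
    simp only [conjTranspose_mul, conjTranspose_conjTranspose] at h2
    rw [h2, conjTranspose_apply, hc _ (by omega) (by omega), star_zero]

theorem cc_norm {m : ℕ} {v : Mt m} (hv : vᴴ * v = 1) (a : ℕ) : star (cc v a) ⬝ᵥ cc v a = 1 := by
  rw [cc_inner, pow_unit hv, one_apply_eq]

theorem GG_unit {m : ℕ} {v : Mt m} (hv : vᴴ * v = 1) (hc : Cyc v) : (GG v)ᴴ * GG v = 1 := by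
  ext a b
  have : ((GG v)ᴴ * GG v) a b = star (cc v a) ⬝ᵥ cc v b := by
    rw [mul_apply, dotProduct]
    rfl
  rw [this]
  by_cases h : a = b
  · subst h; rw [cc_norm hv, one_apply_eq]
  · rw [one_apply_ne h, cc_orth hv hc (by omega) (by omega) (fun h' => h (Fin.ext h'))]

theorem GG_unit' {m : ℕ} {v : Mt m} (hv : vᴴ * v = 1) (hc : Cyc v) : GG v * (GG v)ᴴ = 1 :=
  mul_eq_one_comm.1 (GG_unit hv hc)

theorem cyc_ext {m : ℕ} {v : Mt m} (hv : vᴴ * v = 1) (hc : Cyc v) {A B : Mt m}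
    (h : ∀ j ≤ m, A *ᵥ cc v j = B *ᵥ cc v j) : A = B := by
  have : A * GG v = B * GG v := by
    ext i j
    have := congrFun (h j (by omega)) i
    exact this
  have h2 := congrArg (· * (GG v)ᴴ) this
  simpa [Matrix.mul_assoc, GG_unit' hv hc] using h2

/-- missing link -/
theorem missing {m : ℕ} {v : Mt m} (hv : vᴴ * v = 1) (hc : Cyc v) (k : ℕ) (hk : k < m)
    (h : ∀ i j : Fin (m + 1), j.val ≤ k → k < i.val → v i j = 0) : False := by
  have hz : ∀ n, ∀ i : Fin (m + 1), k < i.val → cc v n i = 0 := by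
    intro n
    induction n with
    | zero => intro i hi; rw [cc_zero, ee, if_neg (by omega)]
    | succ n ih =>
      intro i hi
      rw [← cc_succ, mulVec, dotProduct]
      refine Finset.sum_eq_zero fun j _ => ?_
      by_cases hj : j.val ≤ k
      · rw [h i j hj hi, zero_mul]
      · rw [ih j (by omega), mul_zero]
  have h1 := congrFun (congrFun (GG_unit' hv hc) (Fin.last m)) (Fin.last m)
  rw [mul_apply, one_apply_eq, Finset.sum_eq_zero] at h1
  · exact zero_ne_one h1
  · intro j _
    rw [GG, of_apply, hz _ _ (by simpa using hk), zero_mul]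

theorem cc_top {m : ℕ} {v : Mt m} (hv : vᴴ * v = 1) (hc : Cyc v) : ∃ μ : ℂ, cc v (m + 1) = μ • ee m 0 := by
  have h1 : (GG v)ᴴ *ᵥ cc v (m + 1) = ((v ^ (m + 1)) 0 0) • ee m 0 := by
    ext j
    have : ((GG v)ᴴ *ᵥ cc v (m + 1)) j = star (cc v j) ⬝ᵥ cc v (m + 1) := rfl
    rw [this, cc_inner, pow_unit_le hv (by omega)]
    by_cases hj : j.val = 0
    · rw [hj]; simp [ee, hj]
    · rw [hc _ (by omega) (by omega)]; simp [ee, hj]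
  refine ⟨(v ^ (m + 1)) 0 0, ?_⟩
  have h2 := congrArg (GG v *ᵥ ·) h1
  simp only [mulVec_mulVec, GG_unit' hv hc, one_mulVec, mulVec_smul] at h2
  rw [h2, GG_mulVec v 0 (by omega), cc_zero]

/-- the operator -/
def XX {m : ℕ} (ζ : ℂ) (v : Mt m) : Mt m := GG v * (diagonal fun j : Fin (m + 1) => ζ ^ j.val) * (GG v)ᴴ

theorem XX_cc {m : ℕ} {ζ : ℂ} {v : Mt m} (hv : vᴴ * v = 1) (hc : Cyc v) (j : ℕ) (hj : j ≤ m) :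
    XX ζ v *ᵥ cc v j = ζ ^ j • cc v j := by
  rw [← GG_mulVec v j (by omega), mulVec_mulVec, XX, Matrix.mul_assoc, GG_unit hv hc, Matrix.mul_one, ← mulVec_mulVec]
  rw [← mulVec_smul]
  congr 1
  ext i
  rw [mulVec_diagonal]
  simp only [ee, Pi.smul_apply, smul_eq_mul]
  split_ifs with h
  · rw [h]
  · simp

theorem XX_comm {m : ℕ} {ζ : ℂ} {v : Mt m} (hv : vᴴ * v = 1) (hc : Cyc v) (hζ : ζ ^ (m + 1) = 1) :
    XX ζ v * v = ζ • (v * XX ζ v) := by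
  refine cyc_ext hv hc fun j hj => ?_
  rw [← mulVec_mulVec, smul_mulVec, ← mulVec_mulVec, XX_cc hv hc j hj, mulVec_smul, cc_succ, smul_smul, ← pow_succ']
  rcases Nat.lt_or_ge j m with h | h
  · rw [XX_cc hv hc (j + 1) (by omega)]
  · obtain rfl : j = m := by omega
    obtain ⟨μ, hμ⟩ := cc_top hv hc
    rw [hμ, hζ, one_smul, mulVec_smul]
    have := XX_cc (ζ := ζ) hv hc 0 (by omega)
    rw [cc_zero, pow_zero, one_smul] at this
    rw [this]

theorem XX_unit {m : ℕ} {ζ : ℂ} {v : Mt m} (hv : vᴴ * v = 1) (hc : Cyc v) (hζ : star ζ * ζ = 1) :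
    XX ζ v * (XX ζ v)ᴴ = 1 := by
  have hd : (diagonal fun j : Fin (m + 1) => ζ ^ j.val) * (diagonal fun j : Fin (m + 1) => ζ ^ j.val)ᴴ = 1 := by
    rw [diagonal_conjTranspose, diagonal_mul_diagonal, ← diagonal_one]
    congr 1; ext j
    simp only [Pi.star_apply, star_pow]
    rw [← mul_pow, mul_comm, hζ, one_pow]
  have h1 := GG_unit hv hc
  have h2 := GG_unit' hv hc
  rw [XX]
  simp only [conjTranspose_mul, conjTranspose_conjTranspose]
  rw [Matrix.mul_assoc, ← Matrix.mul_assoc (GG v)ᴴ, h1, Matrix.one_mul, Matrix.mul_assoc, ← Matrix.mul_assoc (diagonal _), hd,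
    Matrix.one_mul, h2]

theorem comm_cc {m : ℕ} {ζ : ℂ} {v X : Mt m} (h : X * v = ζ • (v * X)) (hX0 : X *ᵥ ee m 0 = ee m 0) (j : ℕ) :
    X *ᵥ cc v j = ζ ^ j • cc v j := by
  induction j with
  | zero => simp [cc_zero, hX0]
  | succ j ih =>
    rw [← cc_succ, mulVec_mulVec, h, smul_mulVec, ← mulVec_mulVec, ih, mulVec_smul, smul_smul, pow_succ']

theorem comm_uniq {m : ℕ} {ζ : ℂ} {v X : Mt m} (hv : vᴴ * v = 1) (hc : Cyc v)
    (h : X * v = ζ • (v * X)) (hX0 : X *ᵥ ee m 0 = ee m 0) : X = XX ζ v :=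
  cyc_ext hv hc fun j hj => by rw [comm_cc h hX0, XX_cc hv hc j hj]

theorem comm_cyc {m : ℕ} {ζ : ℂ} {v X : Mt m} (hζ : ∀ n, 1 ≤ n → n ≤ m → ζ ^ n ≠ 1)
    (h : X * v = ζ • (v * X)) (hX0 : X *ᵥ ee m 0 = ee m 0) (hX1 : ee m 0 ᵥ* X = ee m 0) : Cyc v := by
  intro n h1 h2
  have h3 := comm_cc h hX0 n
  have h4 := congrArg (ee m 0 ⬝ᵥ ·) h3
  simp only [dotProduct_mulVec, hX1, dotProduct_smul, smul_eq_mul] at h4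
  have h5 : ee m 0 ⬝ᵥ cc v n = (v ^ n) 0 0 := by rw [ee_zero_entry m (v ^ n)]; rfl
  rw [h5] at h4
  have h6 : (ζ ^ n - 1) * (v ^ n) 0 0 = 0 := by linear_combination -h4
  exact (mul_eq_zero.1 h6).resolve_left (sub_ne_zero.2 (hζ n h1 h2))

end PartL

end WrapL

section WrapM
set_option linter.unusedSectionVars false

/-- the ambient space -/
abbrev EE (m : ℕ) := (Fin m → Fin m → ℂ) × (Fin m → ℂ) × ℂ

section PartM
open Matrix

theorem det_complex_pos {V : Type*} [AddCommGroup V] [Module ℂ V] [Module ℝ V] [IsScalarTower ℝ ℂ V] [FiniteDimensional ℂ V] (T : V →ₗ[ℂ] V)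
    (hT : Function.Injective T) : 0 < LinearMap.det (T.restrictScalars ℝ) := by
  rw [LinearMap.det_restrictScalars, Algebra.norm_complex_apply]
  have : LinearMap.det T ≠ 0 := by
    intro h
    have := LinearMap.bot_lt_ker_of_det_eq_zero h
    rw [LinearMap.ker_eq_bot.2 hT] at this
    exact lt_irrefl _ this
  exact Complex.normSq_pos.2 this

/-- block matrices -/
def blk {m : ℕ} (c : ℂ) (X : Matrix (Fin m) (Fin m) ℂ) : Mt m :=
  Matrix.of fun i j => Fin.cases (Fin.cases c (fun _ => 0) j) (fun i' => Fin.cases 0 (fun j' => X i' j') j) i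

variable {m : ℕ}

@[simp] theorem blk_00 (c : ℂ) (X : Matrix (Fin m) (Fin m) ℂ) : blk c X 0 0 = c := rfl
@[simp] theorem blk_0s (c : ℂ) (X : Matrix (Fin m) (Fin m) ℂ) (j) : blk c X 0 (Fin.succ j) = 0 := rfl
@[simp] theorem blk_s0 (c : ℂ) (X : Matrix (Fin m) (Fin m) ℂ) (j) : blk c X (Fin.succ j) 0 = 0 := rfl
@[simp] theorem blk_ss (c : ℂ) (X : Matrix (Fin m) (Fin m) ℂ) (i j) : blk c X (Fin.succ i) (Fin.succ j) = X i j := rfl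

theorem blk_ext {A B : Mt m} (h00 : A 0 0 = B 0 0) (h0s : ∀ j : Fin m, A 0 j.succ = B 0 j.succ) (hs0 : ∀ j : Fin m, A j.succ 0 = B j.succ 0)
    (hss : ∀ i j : Fin m, A i.succ j.succ = B i.succ j.succ) : A = B := by
  ext i j
  refine Fin.cases ?_ (fun i' => ?_) i <;> refine Fin.cases ?_ (fun j' => ?_) j
  · exact h00
  · exact h0s j'
  · exact hs0 i'
  · exact hss i' j'

theorem blk_mul (c d : ℂ) (X Y : Matrix (Fin m) (Fin m) ℂ) : blk c X * blk d Y = blk (c * d) (X * Y) := by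
  apply blk_ext <;> intros <;> simp [mul_apply, Fin.sum_univ_succ]

theorem blk_star (c : ℂ) (X : Matrix (Fin m) (Fin m) ℂ) : (blk c X)ᴴ = blk (star c) Xᴴ := by
  apply blk_ext <;> intros <;> simp [conjTranspose_apply]

theorem blk_one : blk (m := m) 1 1 = 1 := by
  apply blk_ext <;> intros <;> simp [one_apply, Fin.ext_iff]

theorem blk_sub (c d : ℂ) (X Y : Matrix (Fin m) (Fin m) ℂ) : blk (c - d) (X - Y) = blk c X - blk d Y := by
  apply blk_ext <;> intros <;> simp

theorem blk_inj {c d : ℂ} {X Y : Matrix (Fin m) (Fin m) ℂ} (h : blk c X = blk d Y) : X = Y := by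
  ext i j
  exact congrFun (congrFun h i.succ) j.succ

theorem blk_ee (c : ℂ) (X : Matrix (Fin m) (Fin m) ℂ) : blk c X *ᵥ ee m 0 = c • ee m 0 := by
  rw [ee_eq m 0 (by omega)]
  ext i
  refine Fin.cases ?_ (fun i' => ?_) i <;> simp [Pi.single_apply]

theorem ee_blk (c : ℂ) (X : Matrix (Fin m) (Fin m) ℂ) : ee m 0 ᵥ* blk c X = c • ee m 0 := by
  rw [ee_eq m 0 (by omega)]
  ext i
  refine Fin.cases ?_ (fun i' => ?_) i <;> simp [Pi.single_apply]

/-- row-column matrix -/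
def KK (x : Fin m → ℂ) : Mt m :=
  vecMulVec (ee m 0) (Fin.cons 0 x) - vecMulVec (star (Fin.cons 0 x : Fin (m + 1) → ℂ)) (ee m 0)

/-- linearised matrix -/
def nn (v : Mt m) (ξ : Matrix (Fin m) (Fin m) ℂ) (Θ : Mt m) : Mt m :=
  blk 0 (ξ - ξᴴ) - v * blk 0 (ξ - ξᴴ) * vᴴ + Θ

/-- output -/
def out (ξ : Matrix (Fin m) (Fin m) ℂ) (N : Mt m) (y : ℂ) : EE m :=
  (fun i j => (ξ + ξᴴ) i j + N i.succ j.succ - N 0 0 * (1 : Matrix (Fin m) (Fin m) ℂ) i j, fun k => N k.succ 0, - y)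

theorem out_add (ξ ξ' : Matrix (Fin m) (Fin m) ℂ) (N N' : Mt m) (y y' : ℂ) :
    out (ξ + ξ') (N + N') (y + y') = out ξ N y + out ξ' N' y' := by
  refine Prod.ext ?_ (Prod.ext ?_ ?_)
  · ext i j; simp [out]; ring
  · ext i; simp [out]
  · simp [out]; ring

theorem out_smul (r : ℝ) (ξ : Matrix (Fin m) (Fin m) ℂ) (N : Mt m) (y : ℂ) :
    out (r • ξ) (r • N) (r • y) = r • out ξ N y := by
  refine Prod.ext ?_ (Prod.ext ?_ ?_)
  · ext i j; simp [out]; ring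
  · ext i; simp [out]
  · simp [out]

theorem nn_add (v : Mt m) (ξ ξ' : Matrix (Fin m) (Fin m) ℂ) (Θ Θ' : Mt m) :
    nn v (ξ + ξ') (Θ + Θ') = nn v ξ Θ + nn v ξ' Θ' := by
  have : blk 0 (ξ + ξ' - (ξ + ξ')ᴴ) = blk 0 (ξ - ξᴴ) + blk 0 (ξ' - ξ'ᴴ) := by
    apply blk_ext <;> intros <;> simp
    ring
  simp only [nn, this, Matrix.mul_add, Matrix.add_mul]
  abel

theorem nn_smul (v : Mt m) (r : ℝ) (ξ : Matrix (Fin m) (Fin m) ℂ) (Θ : Mt m) :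
    nn v (r • ξ) (r • Θ) = r • nn v ξ Θ := by
  have : blk 0 (r • ξ - (r • ξ)ᴴ) = r • blk 0 (ξ - ξᴴ) := by
    apply blk_ext <;> intros <;> simp
    ring
  simp only [nn, this, Matrix.mul_smul, Matrix.smul_mul, smul_sub, smul_add]

theorem KK_add (x y : Fin m → ℂ) : KK (x + y) = KK x + KK y := by
  apply blk_ext <;> intros <;> simp [KK, vecMulVec_apply, ee]
  ring

theorem KK_smul (r : ℝ) (y : Fin m → ℂ) : KK (r • y) = r • KK y := by
  apply blk_ext <;> intros <;> simp [KK, vecMulVec_apply, ee]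

theorem KK_star (x : Fin m → ℂ) : (KK x)ᴴ = - KK x := by
  apply blk_ext <;> intros <;> simp [KK, vecMulVec_apply, ee]

theorem nn_star {v : Mt m} {ξ : Matrix (Fin m) (Fin m) ℂ} {Θ : Mt m} (hΘ : Θᴴ = -Θ) : (nn v ξ Θ)ᴴ = - nn v ξ Θ := by
  have : (blk 0 (ξ - ξᴴ))ᴴ = - blk 0 (ξ - ξᴴ) := by
    apply blk_ext <;> intros <;> simp
  simp only [nn, conjTranspose_add, conjTranspose_sub, conjTranspose_mul, this, hΘ, conjTranspose_conjTranspose, Matrix.mul_neg, Matrix.neg_mul, ← Matrix.mul_assoc]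
  abel

/-- reference map -/
noncomputable def MM (v : Mt m) : EE m →ₗ[ℝ] EE m where
  toFun δ := out (Matrix.of δ.1) (nn v (Matrix.of δ.1) (KK δ.2.1)) δ.2.2
  map_add' a b := by
    rw [← out_add, ← nn_add, ← KK_add]; rfl
  map_smul' r a := by
    rw [RingHom.id_apply, ← out_smul, ← nn_smul, ← KK_smul]; rfl

theorem out_zero {ξ : Matrix (Fin m) (Fin m) ℂ} {N : Mt m} {y : ℂ} (hN : Nᴴ = -N) (h : out ξ N y = 0) :
    ξ + ξᴴ = 0 ∧ N = N 0 0 • 1 ∧ y = 0 := by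
  have hs : ∀ i j, star (N i j) = - N j i := by
    intro i j
    have := congrFun (congrFun hN j) i
    rwa [conjTranspose_apply] at this
  have h1 : ∀ i j : Fin m, (ξ + ξᴴ) i j + N i.succ j.succ - N 0 0 * (1 : Matrix (Fin m) (Fin m) ℂ) i j = 0 := by
    intro i j
    exact congrFun (congrFun (congrArg Prod.fst h) i) j
  have h2 : ∀ k : Fin m, N k.succ 0 = 0 := fun k => congrFun (congrArg (fun z => z.2.1) h) k
  have h3 : - y = 0 := congrArg (fun z => z.2.2) h
  have h4 : ∀ i j : Fin m, (ξ + ξᴴ) i j - N i.succ j.succ + N 0 0 * (1 : Matrix (Fin m) (Fin m) ℂ) i j = 0 := by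
    intro i j
    have := congrArg star (h1 j i)
    simp only [star_add, star_sub, star_mul', hs, star_zero] at this
    have h5 : star ((ξ + ξᴴ) j i) = (ξ + ξᴴ) i j := by simp [add_comm]
    have h6 : star ((1 : Matrix (Fin m) (Fin m) ℂ) j i) = (1 : Matrix (Fin m) (Fin m) ℂ) i j := by
      simp [one_apply, eq_comm]
    rw [h6, h5] at this
    linear_combination this
  refine ⟨?_, ?_, neg_eq_zero.1 h3⟩
  · ext i j
    have := h1 i j
    have := h4 i j
    rw [Matrix.zero_apply]
    linear_combination (1/2) * h1 i j + (1/2) * h4 i j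
  · apply blk_ext
    · simp
    · intro j
      have := hs j.succ 0
      rw [h2, star_zero] at this
      rw [neg_eq_zero.1 this.symm]
      simp [one_apply, Fin.ext_iff]
    · intro j
      rw [h2]
      simp [one_apply, Fin.ext_iff]
    · intro i j
      have : (N 0 0 • (1 : Mt m)) i.succ j.succ = N 0 0 * (1 : Matrix (Fin m) (Fin m) ℂ) i j := by
        simp [one_apply, Fin.ext_iff]
      rw [this]
      linear_combination (1/2) * h1 i j - (1/2) * h4 i j

/-- trace-like functional -/
noncomputable def tau (v : Mt m) (n : ℕ) (N : Mt m) : ℂ := ∑ i ∈ Finset.range n, (v ^ (n - 1 - i) * N * v ^ (i + 1)) 0 0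

theorem tau_add (v : Mt m) (n : ℕ) (N N' : Mt m) : tau v n (N + N') = tau v n N + tau v n N' := by
  simp only [tau, Matrix.mul_add, Matrix.add_mul, Matrix.add_apply, Finset.sum_add_distrib]

theorem tau_smul (v : Mt m) (n : ℕ) (r : ℝ) (N : Mt m) : tau v n (r • N) = r * tau v n N := by
  simp only [tau, Matrix.mul_smul, Matrix.smul_mul, Matrix.smul_apply, Finset.mul_sum, Complex.real_smul]

theorem tau_scalar {v : Mt m} (hc : Cyc v) (n : ℕ) (h1 : 1 ≤ n) (h2 : n ≤ m) (c : ℂ) : tau v n (c • 1) = 0 := by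
  refine Finset.sum_eq_zero fun i hi => ?_
  rw [Finset.mem_range] at hi
  rw [Matrix.mul_smul, Matrix.mul_one, Matrix.smul_mul, ← pow_add, show n - 1 - i + (i + 1) = n by omega, Matrix.smul_apply, hc n h1 h2, smul_zero]

theorem tau_comm {v : Mt m} (hv : vᴴ * v = 1) (n : ℕ) (Y : Matrix (Fin m) (Fin m) ℂ) :
    tau v n (blk 0 Y - v * blk 0 Y * vᴴ) = 0 := by
  obtain ⟨f, hf⟩ : ∃ f : ℕ → ℂ, f = fun i => (v ^ (n - i) * blk 0 Y * v ^ i) 0 0 := ⟨_, rfl⟩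
  have : ∀ i ∈ Finset.range n, (v ^ (n - 1 - i) * (blk 0 Y - v * blk 0 Y * vᴴ) * v ^ (i + 1)) 0 0
      = f (i + 1) - f i := by
    intro i hi
    rw [Finset.mem_range] at hi
    have h1 : v ^ (n - 1 - i) * (blk 0 Y - v * blk 0 Y * vᴴ) * v ^ (i + 1)
        = v ^ (n - (i + 1)) * blk 0 Y * v ^ (i + 1) - v ^ (n - i) * blk 0 Y * v ^ i := by
      rw [Matrix.mul_sub, Matrix.sub_mul, show n - 1 - i = n - (i + 1) by omega]
      congr 1
      rw [show n - i = n - (i + 1) + 1 by omega, pow_succ v (n - (i + 1)), pow_succ' v i]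
      simp only [Matrix.mul_assoc]
      rw [← Matrix.mul_assoc vᴴ, hv, Matrix.one_mul]
    rw [h1, hf]
    rfl
  rw [tau, Finset.sum_congr rfl this, Finset.sum_range_sub, hf]
  simp only [Nat.sub_self, pow_zero, Matrix.one_mul, Matrix.mul_one, Nat.sub_zero]
  rw [ee_zero_entry m (blk 0 Y * v ^ n), ee_zero_entry m (v ^ n * blk 0 Y), ← mulVec_mulVec, ← mulVec_mulVec, blk_ee, dotProduct_mulVec, ee_blk]
  simp

theorem tau_KK {v : Mt m} (hc : Cyc v) (n : ℕ) (h1 : 1 ≤ n) (h2 : n ≤ m) (x : Fin m → ℂ) :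
    tau v n (KK x) = ∑ k, x k * cc v n k.succ := by
  have key : ∀ a b : ℕ, (v ^ a * KK x * v ^ b) 0 0 = (v ^ a) 0 0 * ∑ k, x k * cc v b k.succ
      - ((v ^ a) *ᵥ star (Fin.cons 0 x : Fin (m + 1) → ℂ)) 0 * (v ^ b) 0 0 := by
    intro a b
    rw [KK, Matrix.mul_sub, Matrix.sub_mul, mul_vecMulVec, mul_vecMulVec, vecMulVec_mul, vecMulVec_mul, Matrix.sub_apply, vecMulVec_apply, vecMulVec_apply]
    congr 2
    · exact cc_apply v a 0
    · simp only [vecMul, dotProduct, Fin.sum_univ_succ, Fin.cons_zero, Fin.cons_succ, zero_mul, zero_add, cc_apply]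
    · rw [ee_eq m 0 (by omega), single_one_vecMul]; rfl
  rw [tau, Finset.sum_eq_single (n - 1)]
  · rw [key, Nat.sub_self, pow_zero, show n - 1 + 1 = n by omega, hc n h1 h2]
    simp
  · intro i hi hne
    rw [Finset.mem_range] at hi
    rw [key, hc (n - 1 - i) (by omega) (by omega), hc (i + 1) (by omega) (by omega)]
    simp
  · intro h; simp at h; omega

end PartM

end WrapM

section WrapN
set_option linter.unusedSectionVars false

section PartN
open Matrix
variable {m : ℕ}

theorem det_path {V : Type*} [NormedAddCommGroup V] [NormedSpace ℝ V] [FiniteDimensional ℝ V] (A B : V →L[ℝ] V)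
    (h : ∀ t ∈ Set.Icc (0:ℝ) 1, Function.Injective ((1 - t) • A + t • B)) : 0 < A.det * B.det := by
  have hc : Continuous fun t : ℝ => ((1 - t) • A + t • B).det :=
    ContinuousLinearMap.continuous_det.comp (by fun_prop)
  have hne : ∀ t ∈ Set.Icc (0:ℝ) 1, ((1 - t) • A + t • B).det ≠ 0 := by
    intro t ht h0
    have := LinearMap.bot_lt_ker_of_det_eq_zero (f := (((1 - t) • A + t • B : V →L[ℝ] V) : V →ₗ[ℝ] V)) h0
    rw [LinearMap.ker_eq_bot.2 (h t ht)] at this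
    exact lt_irrefl _ this
  have h0 := hne 0 (by simp)
  have h1 := hne 1 (by simp)
  simp only [sub_zero, one_smul, zero_smul, add_zero, sub_self, zero_add] at h0 h1
  by_contra hcon
  have hneg : A.det * B.det < 0 := lt_of_le_of_ne (not_lt.1 hcon) (mul_ne_zero h0 h1)
  have hpre : IsPreconnected (Set.Icc (0:ℝ) 1) := isPreconnected_Icc
  have e0 : ((1 - (0:ℝ)) • A + (0:ℝ) • B).det = A.det := by simp
  have e1 : ((1 - (1:ℝ)) • A + (1:ℝ) • B).det = B.det := by simp
  have hz : ∃ t ∈ Set.Icc (0:ℝ) 1, ((1 - t) • A + t • B).det = 0 := by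
    rcases mul_neg_iff.1 hneg with ⟨ha, hb⟩ | ⟨ha, hb⟩
    · have := hpre.intermediate_value (a := 1) (b := 0) (by simp) (by simp) hc.continuousOn
      obtain ⟨t, ht, e⟩ := this (show (0:ℝ) ∈ Set.Icc _ _ from ⟨by simp only [e1]; exact hb.le, by simp only [e0]; exact ha.le⟩)
      exact ⟨t, ht, e⟩
    · have := hpre.intermediate_value (a := 0) (b := 1) (by simp) (by simp) hc.continuousOn
      obtain ⟨t, ht, e⟩ := this (show (0:ℝ) ∈ Set.Icc _ _ from ⟨by simp only [e0]; exact ha.le, by simp only [e1]; exact hb.le⟩)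
      exact ⟨t, ht, e⟩
  obtain ⟨t, ht, e⟩ := hz
  exact hne t ht e

theorem injL {v : Mt m} (hv : vᴴ * v = 1) (hc : Cyc v) {X0 : Matrix (Fin m) (Fin m) ℂ} (hX : X0ᴴ * X0 = 1)
    (σ : Equiv.Perm (Fin m)) (c : Fin m → ℂ) (hc0 : ∀ k, c k ≠ 0) (X : Matrix (Fin m) (Fin m) ℂ) (z : Fin m → ℂ) (y : ℂ) (Θ : Mt m)
    (hΘ : Θᴴ = -Θ) (hΘt : ∀ k : Fin m, (∀ j < k, z (σ.symm j) = 0) → tau v (k + 1) Θ = c k * z (σ.symm k))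
    (hΘ0 : z = 0 → Θ = 0) (h : out (X * X0ᴴ) (nn v (X * X0ᴴ) Θ) y = 0) : X = 0 ∧ z = 0 ∧ y = 0 := by
  obtain ⟨h1, h2, h3⟩ := out_zero (nn_star hΘ) h
  have hz : ∀ n, ∀ k : Fin m, k.val = n → z (σ.symm k) = 0 := by
    intro n
    induction n using Nat.strong_induction_on with
    | _ n ih =>
      intro k hk
      have h4 := hΘt k fun j hj => ih j.val (by rw [← hk]; exact hj) j rfl
      have h5 := tau_scalar hc (k + 1) (by omega) (by omega) ((nn v (X * X0ᴴ) Θ) 0 0)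
      rw [← h2, nn, tau_add, tau_comm hv, zero_add, h4] at h5
      exact (mul_eq_zero.1 h5).resolve_left (hc0 k)
  have hz0 : z = 0 := by
    ext i
    have := hz _ (σ i) rfl
    simpa using this
  refine ⟨?_, hz0, h3⟩
  have hΘ00 := hΘ0 hz0
  set ξ := X * X0ᴴ with hξ
  have hη : blk 0 (ξ - ξᴴ) = v * blk 0 (ξ - ξᴴ) * vᴴ + (nn v ξ Θ) 0 0 • 1 := by
    rw [← h2, nn, hΘ00]; abel
  have hc00 : (nn v ξ Θ) 0 0 = 0 := by
    have h6 := congrArg trace hη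
    rw [trace_add, trace_mul_comm (v * _), ← Matrix.mul_assoc, hv, Matrix.one_mul, left_eq_add, trace_smul, trace_one, smul_eq_mul] at h6
    refine (mul_eq_zero.1 h6).resolve_right ?_
    simp only [Fintype.card_fin]
    exact_mod_cast Nat.succ_ne_zero m
  rw [hc00, zero_smul, add_zero] at hη
  have hcomm : blk 0 (ξ - ξᴴ) * v = v * blk 0 (ξ - ξᴴ) := by
    conv_lhs => rw [hη, Matrix.mul_assoc, hv, Matrix.mul_one]
  have hzero : blk 0 (ξ - ξᴴ) = 0 := by
    refine cyc_ext hv hc fun j _ => ?_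
    rw [zero_mulVec]
    induction j with
    | zero => rw [cc_zero, blk_ee, zero_smul]
    | succ j ih => rw [← cc_succ, mulVec_mulVec, hcomm, ← mulVec_mulVec, ih (by omega), mulVec_zero]
  have h7 : ξ - ξᴴ = 0 := by
    ext i j
    exact congrFun (congrFun hzero i.succ) j.succ
  have h8 : ξ = 0 := by
    ext i j
    have a := congrFun (congrFun h1 i) j
    have b := congrFun (congrFun h7 i) j
    simp only [Matrix.add_apply, Matrix.sub_apply, Matrix.zero_apply] at a b ⊢
    linear_combination (1/2) * a + (1/2) * b
  have h9 := congrArg (· * X0) h8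
  simpa [hξ, Matrix.mul_assoc, hX] using h9

/-- complex linear comparison map -/
noncomputable def CC (v : Mt m) (X0 : Matrix (Fin m) (Fin m) ℂ) (σ : Equiv.Perm (Fin m)) (c : Fin m → ℂ) : EE m →ₗ[ℂ] EE m where
  toFun δ := (fun i j => (Matrix.of δ.1 * X0ᴴ) i j, fun k => ∑ n, c n * δ.2.1 (σ.symm n) * star (cc v (n + 1) k.succ), δ.2.2)
  map_add' a b := by
    refine Prod.ext ?_ (Prod.ext ?_ rfl)
    · ext i j; simp [mul_apply, Finset.sum_add_distrib, add_mul]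
    · ext i; simp [Finset.sum_add_distrib, add_mul, mul_add]
  map_smul' r a := by
    refine Prod.ext ?_ (Prod.ext ?_ rfl)
    · ext i j; simp [mul_apply, Finset.mul_sum, mul_assoc]
    · ext i; simp [Finset.mul_sum]
      refine Finset.sum_congr rfl fun j _ => by ring

theorem CC_tau {v : Mt m} (hv : vᴴ * v = 1) (hc : Cyc v) (X0 : Matrix (Fin m) (Fin m) ℂ) (σ : Equiv.Perm (Fin m)) (c : Fin m → ℂ)
    (δ : EE m) (k : Fin m) : tau v (k + 1) (KK (CC v X0 σ c δ).2.1) = c k * δ.2.1 (σ.symm k) := by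
  rw [tau_KK hc _ (by omega) (by omega)]
  have h1 : ∀ n : Fin m, ∑ l : Fin m, star (cc v (n + 1) l.succ) * cc v (k + 1) l.succ = if n = k then 1 else 0 := by
    intro n
    have h2 : star (cc v (n + 1)) ⬝ᵥ cc v (k + 1) = ∑ l : Fin m, star (cc v (n + 1) l.succ) * cc v (k + 1) l.succ := by
      rw [dotProduct, Fin.sum_univ_succ, cc_apply v (k + 1) 0, hc (k + 1) (by omega) (by omega), mul_zero, zero_add]
      rfl
    rw [← h2]
    split_ifs with h
    · subst h; exact cc_norm hv _
    · exact cc_orth hv hc (by omega) (by omega) (fun h' => h (Fin.ext (by omega)))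
  calc ∑ l, (CC v X0 σ c δ).2.1 l * cc v (k + 1) l.succ
      = ∑ l : Fin m, ∑ n : Fin m, c n * δ.2.1 (σ.symm n) * (star (cc v (n + 1) l.succ) * cc v (k + 1) l.succ) := by
        refine Finset.sum_congr rfl fun l _ => ?_
        change (∑ n : Fin m, c n * δ.2.1 (σ.symm n) * star (cc v (n + 1) l.succ)) * _ = _
        rw [Finset.sum_mul]
        exact Finset.sum_congr rfl fun n _ => by ring
    _ = ∑ n, c n * δ.2.1 (σ.symm n) * ∑ l : Fin m, (star (cc v (n + 1) l.succ) * cc v (k + 1) l.succ) := by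
        rw [Finset.sum_comm]
        exact Finset.sum_congr rfl fun n _ => by rw [Finset.mul_sum]
    _ = _ := by
        simp only [h1]; simp

theorem CC_inj {v : Mt m} (hv : vᴴ * v = 1) (hc : Cyc v) {X0 : Matrix (Fin m) (Fin m) ℂ} (hX : X0ᴴ * X0 = 1) (σ : Equiv.Perm (Fin m))
    (c : Fin m → ℂ) (hc0 : ∀ k, c k ≠ 0) : Function.Injective (CC v X0 σ c) := by
  rw [injective_iff_map_eq_zero]
  intro δ h
  have hz : δ.2.1 = 0 := by
    ext i
    have h1 := CC_tau hv hc X0 σ c δ (σ i)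
    rw [h] at h1
    have : tau v (σ i + 1) (KK (0 : Fin m → ℂ)) = 0 := by
      rw [tau_KK hc _ (by omega) (by omega)]; simp
    rw [show (0 : EE m).2.1 = 0 from rfl, this] at h1
    have := (mul_eq_zero.1 h1.symm).resolve_left (hc0 _)
    simpa using this
  have hy : δ.2.2 = 0 := congrArg (fun q => q.2.2) h
  have hx : Matrix.of δ.1 * X0ᴴ = 0 := by
    ext i j
    exact congrFun (congrFun (congrArg Prod.fst h) i) j
  have h9 := congrArg (· * X0) hx
  simp only [Matrix.mul_assoc, hX, Matrix.mul_one, Matrix.zero_mul] at h9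
  exact Prod.ext (by ext i j; exact congrFun (congrFun h9 i) j) (Prod.ext hz hy)

theorem sign1 {v : Mt m} (hv : vᴴ * v = 1) (hc : Cyc v) {X0 : Matrix (Fin m) (Fin m) ℂ} (hX : X0ᴴ * X0 = 1)
    (σ : Equiv.Perm (Fin m)) (c : Fin m → ℂ) (hc0 : ∀ k, c k ≠ 0) (L : EE m →L[ℝ] EE m) (Θ : (Fin m → ℂ) → Mt m)
    (hΘ : ∀ z, (Θ z)ᴴ = - Θ z) (hΘt : ∀ z, ∀ k : Fin m, (∀ j < k, z (σ.symm j) = 0) → tau v (k + 1) (Θ z) = c k * z (σ.symm k))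
    (hΘ0 : Θ 0 = 0) (hL : ∀ δ, L δ = out (Matrix.of δ.1 * X0ᴴ) (nn v (Matrix.of δ.1 * X0ᴴ) (Θ δ.2.1)) δ.2.2) :
    0 < LinearMap.det (MM v) * L.det := by
  have hC := det_complex_pos _ (CC_inj hv hc hX σ c hc0)
  have h1 := det_path (LinearMap.toContinuousLinearMap (MM v ∘ₗ (CC v X0 σ c).restrictScalars ℝ)) L ?_
  · have h2 : (LinearMap.toContinuousLinearMap (MM v ∘ₗ (CC v X0 σ c).restrictScalars ℝ)).det
        = LinearMap.det (MM v) * LinearMap.det ((CC v X0 σ c).restrictScalars ℝ) := by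
      rw [LinearMap.det_toContinuousLinearMap, LinearMap.det_comp]
    rw [h2, mul_right_comm] at h1
    exact pos_of_mul_pos_left h1 hC.le
  · intro t ht
    rw [injective_iff_map_eq_zero]
    intro δ hδ
    have h3 : out (Matrix.of δ.1 * X0ᴴ) (nn v (Matrix.of δ.1 * X0ᴴ) ((1 - t) • KK (CC v X0 σ c δ).2.1 + t • Θ δ.2.1)) δ.2.2 = 0 := by
      have e1 : MM v (CC v X0 σ c δ) = out (Matrix.of δ.1 * X0ᴴ) (nn v (Matrix.of δ.1 * X0ᴴ) (KK (CC v X0 σ c δ).2.1)) δ.2.2 := rfl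
      have e2 : ((1 - t) • LinearMap.toContinuousLinearMap (MM v ∘ₗ (CC v X0 σ c).restrictScalars ℝ) + t • L) δ
        = (1 - t) • MM v (CC v X0 σ c δ) + t • L δ := rfl
      rw [e2, e1, hL, ← out_smul, ← out_smul, ← nn_smul, ← nn_smul, ← out_add, ← nn_add, ← add_smul, ← add_smul] at hδ
      simpa using hδ
    have h4 := injL hv hc hX σ c hc0 (Matrix.of δ.1) δ.2.1 δ.2.2 _ ?_ ?_ ?_ h3
    · obtain ⟨a, b, c⟩ := h4
      exact Prod.ext (by ext i j; exact congrFun (congrFun a i) j) (Prod.ext b c)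
    · rw [conjTranspose_add, conjTranspose_smul, conjTranspose_smul, KK_star, hΘ]
      simp; abel
    · intro k hk
      rw [tau_add, tau_smul, tau_smul, CC_tau hv hc, hΘt _ k hk]
      push_cast; ring
    · intro h0
      rw [h0, hΘ0]
      have : (CC v X0 σ c δ).2.1 = 0 := by
        ext k
        change ∑ n : Fin m, c n * δ.2.1 (σ.symm n) * star (cc v (n + 1) k.succ) = _
        rw [h0]; simp
      rw [this]
      have : KK (0 : Fin m → ℂ) = 0 := by simpa using KK_smul 0 (0 : Fin m → ℂ)
      rw [this]; simp

end PartN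

end WrapN

section WrapO
set_option linter.unusedSectionVars false

section PartO
open Matrix
variable {m : ℕ}

theorem conj_blk_ss (g : Matrix (Fin m) (Fin m) ℂ) (N : Mt m) (i j : Fin m) :
    (blk 1 g * N * (blk 1 g)ᴴ) i.succ j.succ = (g * N.submatrix Fin.succ Fin.succ * gᴴ) i j := by
  simp [mul_apply, Fin.sum_univ_succ, conjTranspose_apply]

theorem conj_blk_00 (g : Matrix (Fin m) (Fin m) ℂ) (N : Mt m) :
    (blk 1 g * N * (blk 1 g)ᴴ) 0 0 = N 0 0 := by
  simp [mul_apply, Fin.sum_univ_succ, conjTranspose_apply]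

theorem conj_blk_s0 (g : Matrix (Fin m) (Fin m) ℂ) (N : Mt m) (k : Fin m) :
    (blk 1 g * N * (blk 1 g)ᴴ) k.succ 0 = (g *ᵥ fun l => N l.succ 0) k := by
  simp [mul_apply, Fin.sum_univ_succ, conjTranspose_apply, mulVec, dotProduct]

/-- target conjugation -/
noncomputable def AAg (g : Matrix (Fin m) (Fin m) ℂ) : EE m →ₗ[ℂ] EE m where
  toFun δ := (fun i j => (g * Matrix.of δ.1 * gᴴ) i j, g *ᵥ δ.2.1, δ.2.2)
  map_add' a b := by
    refine Prod.ext ?_ (Prod.ext ?_ rfl)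
    · have : Matrix.of (a + b).1 = Matrix.of a.1 + Matrix.of b.1 := rfl
      simp only [this, Matrix.mul_add, Matrix.add_mul]; rfl
    · exact mulVec_add g a.2.1 b.2.1
  map_smul' r a := by
    refine Prod.ext ?_ (Prod.ext ?_ rfl)
    · have : Matrix.of (r • a).1 = r • Matrix.of a.1 := rfl
      simp only [this, Matrix.mul_smul, Matrix.smul_mul]; rfl
    · exact mulVec_smul g r a.2.1

/-- source conjugation -/
noncomputable def BBg (g : Matrix (Fin m) (Fin m) ℂ) : EE m →ₗ[ℂ] EE m where
  toFun δ := (fun i j => (g * Matrix.of δ.1 * gᴴ) i j, δ.2.1 ᵥ* gᴴ, δ.2.2)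
  map_add' a b := by
    refine Prod.ext ?_ (Prod.ext ?_ rfl)
    · have : Matrix.of (a + b).1 = Matrix.of a.1 + Matrix.of b.1 := rfl
      simp only [this, Matrix.mul_add, Matrix.add_mul]; rfl
    · exact add_vecMul gᴴ a.2.1 b.2.1
  map_smul' r a := by
    refine Prod.ext ?_ (Prod.ext ?_ rfl)
    · have : Matrix.of (r • a).1 = r • Matrix.of a.1 := rfl
      simp only [this, Matrix.mul_smul, Matrix.smul_mul]; rfl
    · exact smul_vecMul r a.2.1 gᴴ

theorem conj_inj {g : Matrix (Fin m) (Fin m) ℂ} (hg : gᴴ * g = 1) {Y : Matrix (Fin m) (Fin m) ℂ} (h : g * Y * gᴴ = 0) : Y = 0 := by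
  have h2 := congrArg (fun M => gᴴ * M * g) h
  simp only [Matrix.mul_zero, Matrix.zero_mul] at h2
  rw [Matrix.mul_assoc, Matrix.mul_assoc, Matrix.mul_assoc, hg, Matrix.mul_one, ← Matrix.mul_assoc, hg, Matrix.one_mul] at h2
  exact h2

theorem AAg_inj {g : Matrix (Fin m) (Fin m) ℂ} (hg : gᴴ * g = 1) : Function.Injective (AAg g) := by
  rw [injective_iff_map_eq_zero]
  intro δ h
  have h1 : Matrix.of δ.1 = 0 := conj_inj hg (by ext i j; exact congrFun (congrFun (congrArg Prod.fst h) i) j)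
  have h2 : g *ᵥ δ.2.1 = 0 := congrArg (fun q => q.2.1) h
  have h3 : δ.2.2 = 0 := congrArg (fun q => q.2.2) h
  refine Prod.ext (by ext i j; exact congrFun (congrFun h1 i) j) (Prod.ext ?_ h3)
  have := congrArg (gᴴ *ᵥ ·) h2
  simpa [mulVec_mulVec, hg] using this

theorem BBg_inj {g : Matrix (Fin m) (Fin m) ℂ} (hg : gᴴ * g = 1) : Function.Injective (BBg g) := by
  rw [injective_iff_map_eq_zero]
  intro δ h
  have h1 : Matrix.of δ.1 = 0 := conj_inj hg (by ext i j; exact congrFun (congrFun (congrArg Prod.fst h) i) j)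
  have h2 : δ.2.1 ᵥ* gᴴ = 0 := congrArg (fun q => q.2.1) h
  have h3 : δ.2.2 = 0 := congrArg (fun q => q.2.2) h
  refine Prod.ext (by ext i j; exact congrFun (congrFun h1 i) j) (Prod.ext ?_ h3)
  have := congrArg (· ᵥ* g) h2
  simpa [vecMul_vecMul, hg] using this

theorem out_conj {g : Matrix (Fin m) (Fin m) ℂ} (hg : g * gᴴ = 1) (ξ : Matrix (Fin m) (Fin m) ℂ) (N : Mt m) (y : ℂ) :
    out (g * ξ * gᴴ) (blk 1 g * N * (blk 1 g)ᴴ) y = AAg g (out ξ N y) := by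
  refine Prod.ext ?_ (Prod.ext ?_ rfl)
  · have e : Matrix.of (out ξ N y).1 = ξ + ξᴴ + N.submatrix Fin.succ Fin.succ - N 0 0 • 1 := by
      ext i j; simp [out]
    have e2 : (g * (ξ + ξᴴ + N.submatrix Fin.succ Fin.succ - N 0 0 • 1) * gᴴ)
        = g * ξ * gᴴ + (g * ξ * gᴴ)ᴴ + g * N.submatrix Fin.succ Fin.succ * gᴴ - N 0 0 • 1 := by
      simp only [Matrix.mul_add, Matrix.mul_sub, Matrix.add_mul, Matrix.sub_mul, conjTranspose_mul, conjTranspose_conjTranspose,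
        Matrix.mul_smul, Matrix.smul_mul, Matrix.mul_one, hg, Matrix.mul_assoc]
    ext i j
    change _ = (g * Matrix.of (out ξ N y).1 * gᴴ) i j
    rw [e, e2]
    change (g * ξ * gᴴ + (g * ξ * gᴴ)ᴴ) i j + (blk 1 g * N * (blk 1 g)ᴴ) i.succ j.succ - (blk 1 g * N * (blk 1 g)ᴴ) 0 0 * (1 : Matrix (Fin m) (Fin m) ℂ) i j = _
    rw [conj_blk_ss, conj_blk_00]
    simp
  · ext k
    exact conj_blk_s0 g N k

theorem KK_conj (g : Matrix (Fin m) (Fin m) ℂ) (x : Fin m → ℂ) : KK (x ᵥ* gᴴ) = blk 1 g * KK x * (blk 1 g)ᴴ := by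
  have e : (Fin.cons 0 (x ᵥ* gᴴ) : Fin (m + 1) → ℂ) = (Fin.cons 0 x : Fin (m + 1) → ℂ) ᵥ* (blk 1 g)ᴴ := by
    ext i
    refine Fin.cases ?_ (fun i => ?_) i <;> simp [vecMul, dotProduct, Fin.sum_univ_succ, conjTranspose_apply]
  rw [KK, KK, e, Matrix.mul_sub, Matrix.sub_mul, mul_vecMulVec, vecMulVec_mul, mul_vecMulVec, vecMulVec_mul, blk_ee, one_smul,
    blk_star, ee_blk, star_one, one_smul, star_vecMul, blk_star, star_one, conjTranspose_conjTranspose]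

theorem nn_conj {g : Matrix (Fin m) (Fin m) ℂ} (hg : gᴴ * g = 1) (S : Mt m) (ξ : Matrix (Fin m) (Fin m) ℂ) (Θ : Mt m) :
    nn (blk 1 g * S * (blk 1 g)ᴴ) (g * ξ * gᴴ) (blk 1 g * Θ * (blk 1 g)ᴴ) = blk 1 g * nn S ξ Θ * (blk 1 g)ᴴ := by
  have e : blk 0 (g * ξ * gᴴ - (g * ξ * gᴴ)ᴴ) = blk 1 g * blk 0 (ξ - ξᴴ) * (blk 1 g)ᴴ := by
    rw [blk_star, blk_mul, blk_mul]
    congr 1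
    · simp
    · simp only [Matrix.mul_sub, Matrix.sub_mul, conjTranspose_mul, conjTranspose_conjTranspose, Matrix.mul_assoc]
  have e2 : (blk 1 g)ᴴ * blk 1 g = 1 := by rw [blk_star, blk_mul, hg, star_one, one_mul, blk_one]
  have e3 : (blk 1 g * S * (blk 1 g)ᴴ) * (blk 1 g * blk 0 (ξ - ξᴴ) * (blk 1 g)ᴴ) * (blk 1 g * S * (blk 1 g)ᴴ)ᴴ
      = blk 1 g * (S * blk 0 (ξ - ξᴴ) * Sᴴ) * (blk 1 g)ᴴ := by
    rw [conjTranspose_mul, conjTranspose_mul, conjTranspose_conjTranspose]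
    simp only [Matrix.mul_assoc]
    rw [← Matrix.mul_assoc (blk 1 g)ᴴ (blk 1 g), e2, Matrix.one_mul, ← Matrix.mul_assoc (blk 1 g)ᴴ (blk 1 g), e2, Matrix.one_mul]
  rw [nn, nn, e, e3]
  simp only [Matrix.mul_add, Matrix.mul_sub, Matrix.add_mul, Matrix.sub_mul]

/-- cyclic shift -/
def SH (m : ℕ) : Mt m := Matrix.of fun i j => if i = j + 1 then 1 else 0

theorem sign_aux {v : Mt m} (hv : vᴴ * v = 1) (hc : Cyc v) (h1 : cc v (m + 1) = ee m 0) :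
    0 < LinearMap.det (MM v) * LinearMap.det (MM (SH m)) ∨ (LinearMap.det (MM (SH m)) = 0 ∧ LinearMap.det (MM v) = 0) := by
  set g : Matrix (Fin m) (Fin m) ℂ := (GG v).submatrix Fin.succ Fin.succ with hgdef
  have hG : GG v = blk 1 g := by
    apply blk_ext
    · simp [GG, cc_zero, ee]
    · intro j
      simp only [GG, of_apply, blk_0s]
      rw [cc_apply]
      exact hc _ (by simp) (by simp)
    · intro j
      simp [GG, cc_zero, ee]
    · intro i j; rfl
  have hgg : blk 1 (gᴴ * g) = blk 1 1 := by
    have := GG_unit hv hc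
    rwa [hG, blk_star, blk_mul, star_one, one_mul, ← blk_one] at this
  have hg : gᴴ * g = 1 := blk_inj hgg
  have hg' : g * gᴴ = 1 := mul_eq_one_comm.1 hg
  have hvG : v * GG v = GG v * SH m := by
    ext i j
    have e1 : (v * GG v) i j = cc v (j + 1) i := by
      rw [← cc_succ]; rfl
    have e2 : (GG v * SH m) i j = GG v i (j + 1) := by
      simp [mul_apply, SH]
    rw [e1, e2, GG, of_apply]
    by_cases hj : j = Fin.last m
    · subst hj
      rw [Fin.last_add_one, Fin.val_last, h1]
      simp [cc_zero]
    · rw [Fin.val_add_one, if_neg hj]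
  have hvS : v = blk 1 g * SH m * (blk 1 g)ᴴ := by
    rw [← hG, ← hvG, Matrix.mul_assoc, GG_unit' hv hc, Matrix.mul_one]
  have key : MM v ∘ₗ (BBg g).restrictScalars ℝ = (AAg g).restrictScalars ℝ ∘ₗ MM (SH m) := by
    refine LinearMap.ext fun δ => ?_
    change out (g * Matrix.of δ.1 * gᴴ) (nn v (g * Matrix.of δ.1 * gᴴ) (KK (δ.2.1 ᵥ* gᴴ))) δ.2.2 = AAg g (out _ _ _)
    rw [← out_conj hg', KK_conj]
    conv_lhs => rw [hvS]
    rw [nn_conj hg]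
    
  have hd := congrArg LinearMap.det key
  rw [LinearMap.det_comp, LinearMap.det_comp] at hd
  have hB := det_complex_pos _ (BBg_inj hg)
  have hA := det_complex_pos _ (AAg_inj hg)
  by_cases h0 : LinearMap.det (MM (SH m)) = 0
  · refine Or.inr ⟨h0, ?_⟩
    rw [h0, mul_zero] at hd
    exact (mul_eq_zero.1 hd).resolve_right hB.ne'
  · left
    have h2 : 0 < LinearMap.det (MM v) * LinearMap.det (MM (SH m)) * LinearMap.det ((BBg g).restrictScalars ℝ) := by
      rw [mul_right_comm, hd, mul_assoc]
      exact mul_pos hA (mul_self_pos.2 h0)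
    exact pos_of_mul_pos_left h2 hB.le

theorem sign2 {v : Mt m} (hv : vᴴ * v = 1) (hc : Cyc v) :
    0 < LinearMap.det (MM v) * LinearMap.det (MM (SH m)) ∨ (LinearMap.det (MM (SH m)) = 0 ∧ LinearMap.det (MM v) = 0) := by
  obtain ⟨μ, hμ⟩ := cc_top hv hc
  have hμ1 : ‖μ‖ = 1 := by
    have h1 := cc_norm hv (m + 1)
    rw [hμ, star_smul, smul_dotProduct, dotProduct_smul] at h1
    have h2 : star (ee m 0) ⬝ᵥ ee m 0 = 1 := by
      have := cc_norm hv 0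
      rwa [cc_zero] at this
    rw [h2, smul_eq_mul, smul_eq_mul, mul_one] at h1
    have h3 := congrArg norm h1
    rw [norm_mul, norm_star, norm_one] at h3
    nlinarith [norm_nonneg μ]
  obtain ⟨l, hl⟩ := IsAlgClosed.exists_pow_nat_eq μ (n := m + 1) (by omega)
  have hl1 : ‖l‖ = 1 := by
    have : ‖l‖ ^ (m + 1) = 1 := by rw [← norm_pow, hl, hμ1]
    exact (pow_eq_one_iff_of_nonneg (norm_nonneg _) (by omega)).1 this
  have hl0 : l ≠ 0 := by intro h; rw [h] at hl1; simp at hl1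
  have hll : star l * l = 1 := by
    have := Complex.conj_mul' l
    rw [hl1] at this
    simpa using this
  have hli : star l⁻¹ * l⁻¹ = 1 := by
    rw [star_inv₀, ← mul_inv, hll, inv_one]
  have hpow : ∀ n, (l⁻¹ • v) ^ n = (l⁻¹) ^ n • v ^ n := fun n => smul_pow _ _ _
  have h1 : (l⁻¹ • v)ᴴ * (l⁻¹ • v) = 1 := by
    rw [conjTranspose_smul, Matrix.smul_mul, Matrix.mul_smul, smul_smul, hv, hli, one_smul]
  have h2 : Cyc (l⁻¹ • v) := by
    intro n hn hm
    rw [hpow, Matrix.smul_apply, hc n hn hm, smul_zero]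
  have h3 : cc (l⁻¹ • v) (m + 1) = ee m 0 := by
    have : cc (l⁻¹ • v) (m + 1) = (l⁻¹) ^ (m + 1) • cc v (m + 1) := by
      rw [cc, hpow, smul_mulVec]; rfl
    rw [this, hμ, smul_smul, inv_pow, hl, inv_mul_cancel₀, one_smul]
    intro h; rw [h] at hμ1; simp at hμ1
  have h4 : MM (l⁻¹ • v) = MM v := by
    refine LinearMap.ext fun δ => ?_
    change out _ (nn _ _ _) _ = out _ (nn _ _ _) _
    congr 1
    simp only [nn, conjTranspose_smul, Matrix.smul_mul, Matrix.mul_smul, smul_smul, hli, one_smul]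
  rw [← h4]
  exact sign_aux h1 h2 h3

end PartO

end WrapO

section WrapP
set_option linter.unusedSectionVars false

section PartP
open Matrix
variable {m : ℕ}

theorem sign3 {v : Mt m} {X0 : Matrix (Fin m) (Fin m) ℂ} (hv : vᴴ * v = 1) (hc : Cyc v) (hX : X0ᴴ * X0 = 1) (σ : Equiv.Perm (Fin m)) (c : Fin m → ℂ) (hc0 : ∀ k, c k ≠ 0)
    (L : EE m →L[ℝ] EE m) (Θ : (Fin m → ℂ) → Mt m)
    (hΘ : ∀ z, (Θ z)ᴴ = -Θ z) (hΘt : ∀ z, ∀ k : Fin m, (∀ j < k, z (σ.symm j) = 0) → tau v (k+1) (Θ z) = c k * z (σ.symm k))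
    (hΘ0 : Θ 0 = 0) (hL : ∀ δ, L δ = out (Matrix.of δ.1 * X0ᴴ) (nn v (Matrix.of δ.1 * X0ᴴ) (Θ δ.2.1)) δ.2.2) :
    0 < LinearMap.det (MM (SH m)) * L.det := by
  have h1 := sign1 hv hc hX σ c hc0 L Θ hΘ hΘt hΘ0 hL
  rcases sign2 hv hc with h2 | h2
  · have h3 := mul_pos h1 h2
    have h4 : LinearMap.det (MM v) ≠ 0 := fun h => by rw [h] at h1; simp at h1
    have h5 : 0 < LinearMap.det (MM v) ^ 2 := by positivity
    have h6 : LinearMap.det (MM v) * L.det * (LinearMap.det (MM v) * LinearMap.det (MM (SH m)))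
      = LinearMap.det (MM v) ^ 2 * (LinearMap.det (MM (SH m)) * L.det) := by ring
    rw [h6] at h3
    exact pos_of_mul_pos_right h3 h5.le
  · rw [h2.2] at h1; simp at h1

/-- matrix derivative -/
def MD (M : ℝ → Mt m) (M' : Mt m) : Prop := ∀ i j, HasDerivAt (fun s => M s i j) (M' i j) 0

theorem MD.mul {A B : ℝ → Mt m} {A' B' : Mt m} (hA : MD A A') (hB : MD B B') :
    MD (fun s => A s * B s) (A' * B 0 + A 0 * B') := by
  intro i j
  have := HasDerivAt.fun_sum (u := Finset.univ) fun (l : Fin (m+1)) _ => (hA i l).mul (hB l j)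
  simp only [Matrix.add_apply, mul_apply, ← Finset.sum_add_distrib]
  exact this

theorem MD.star {A : ℝ → Mt m} {A' : Mt m} (hA : MD A A') : MD (fun s => (A s)ᴴ) A'ᴴ := by
  intro i j
  exact (hA j i).star

theorem MD.sub {A B : ℝ → Mt m} {A' B' : Mt m} (hA : MD A A') (hB : MD B B') :
    MD (fun s => A s - B s) (A' - B') := fun i j => (hA i j).sub (hB i j)

theorem MD.smul {A : ℝ → Mt m} {A' : Mt m} (c : ℂ) (hA : MD A A') : MD (fun s => c • A s) (c • A') :=
  fun i j => (hA i j).const_mul c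

theorem MD.const (A : Mt m) : MD (fun _ => A) 0 := fun i j => hasDerivAt_const _ _

theorem MD.uniq {A : ℝ → Mt m} {A' A'' : Mt m} (h : MD A A') (h' : MD A A'') : A' = A'' := by
  ext i j
  exact (h i j).unique (h' i j)

theorem MD.congr {A : ℝ → Mt m} {A' A'' : Mt m} (h : MD A A') (h' : A' = A'') : MD A A'' := h' ▸ h

theorem MD.pow {A : ℝ → Mt m} {A' : Mt m} (h : MD A A') (n : ℕ) :
    MD (fun s => A s ^ n) (∑ i ∈ Finset.range n, A 0 ^ (n - 1 - i) * A' * A 0 ^ i) := by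
  induction n with
  | zero => simpa using MD.const (m := m) 1
  | succ n ih =>
    have := h.mul ih
    simp only [← pow_succ'] at this
    refine this.congr ?_
    rw [Finset.sum_range_succ, add_comm, Finset.mul_sum]
    congr 1
    · refine Finset.sum_congr rfl fun i hi => ?_
      have := Finset.mem_range.1 hi
      rw [show n + 1 - 1 - i = (n - 1 - i) + 1 by omega, pow_succ']
      simp only [Matrix.mul_assoc]
    · simp

/-- linear block curve -/
theorem MD.blk (X D : Matrix (Fin m) (Fin m) ℂ) : MD (fun s : ℝ => blk 1 (X + s • D)) (blk 0 D) := by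
  intro i j
  refine Fin.cases ?_ (fun i' => ?_) i <;> refine Fin.cases ?_ (fun j' => ?_) j
  · simpa using hasDerivAt_const (0:ℝ) (1:ℂ)
  · simpa using hasDerivAt_const (0:ℝ) (0:ℂ)
  · simpa using hasDerivAt_const (0:ℝ) (0:ℂ)
  · simp only [blk_ss, Matrix.add_apply, Matrix.smul_apply]
    have := ((hasDerivAt_id (0:ℝ)).smul_const (D i' j')).const_add (X i' j')
    simpa using this

theorem om_star {v : ℝ → Mt m} {w : Mt m} (hv : ∀ s, v s * (v s)ᴴ = 1) (hw : MD v w) : (w * (v 0)ᴴ)ᴴ = - (w * (v 0)ᴴ) := by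
  have h1 := hw.mul hw.star
  simp only [hv] at h1
  have h2 := h1.uniq (MD.const 1)
  rw [conjTranspose_mul, conjTranspose_conjTranspose]
  exact eq_neg_of_add_eq_zero_right h2

/-- the Theta term -/
noncomputable def TH (X : Mt m) (Ω : Mt m) : Mt m := (2:ℝ) • (X * Ω * Xᴴ - Ω)

theorem TH_star (X Ω : Mt m) (h : Ωᴴ = -Ω) : (TH X Ω)ᴴ = - TH X Ω := by
  simp only [TH, conjTranspose_smul, conjTranspose_sub, conjTranspose_mul, conjTranspose_conjTranspose, h, star_trivial, Matrix.mul_neg, Matrix.neg_mul, ← Matrix.mul_assoc, smul_sub, smul_neg, neg_sub]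
  abel

theorem comm_rel {ζ : ℂ} {X v : Mt m} (hζ : ζ ≠ 0) (hX : Xᴴ * X = 1) (hv : vᴴ * v = 1) (h : ζ⁻¹ • (X * v * Xᴴ * vᴴ) = 1) :
    X * v = ζ • (v * X) ∧ v * Xᴴ = ζ • (Xᴴ * v) := by
  have h1 : X * v * Xᴴ * vᴴ = ζ • 1 := by
    rw [← h, smul_smul, mul_inv_cancel₀ hζ, one_smul]
  have h2 : X * v * Xᴴ = ζ • v := by
    have := congrArg (· * v) h1
    simpa [Matrix.mul_assoc, hv] using this
  constructor
  · have := congrArg (· * X) h2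
    simpa [Matrix.mul_assoc, hX] using this
  · have := congrArg (Xᴴ * ·) h2
    simpa [← Matrix.mul_assoc, hX] using this

theorem dQ {ζ : ℂ} (hζ : ζ ≠ 0) {X0 D : Matrix (Fin m) (Fin m) ℂ} (hX : X0ᴴ * X0 = 1) {v : ℝ → Mt m} {w : Mt m} (hv : ∀ s, v s * (v s)ᴴ = 1)
    (hw : MD v w) (h : ζ⁻¹ • (blk 1 X0 * v 0 * (blk 1 X0)ᴴ * (v 0)ᴴ) = 1) :
    MD (fun s => ζ⁻¹ • (blk 1 (X0 + s • D) * v s * (blk 1 (X0 + s • D))ᴴ * (v s)ᴴ))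
      (blk 0 (D * X0ᴴ) + blk 1 X0 * (w * (v 0)ᴴ) * (blk 1 X0)ᴴ + v 0 * blk 0 (X0 * Dᴴ) * (v 0)ᴴ - w * (v 0)ᴴ) := by
  have hv0 : (v 0)ᴴ * v 0 = 1 := mul_eq_one_comm.1 (hv 0)
  have hXX : X0 * X0ᴴ = 1 := mul_eq_one_comm.1 hX
  have hb : (blk 1 X0)ᴴ * blk 1 X0 = 1 := by rw [blk_star, blk_mul, hX, star_one, one_mul, blk_one]
  obtain ⟨c1, c2⟩ := comm_rel hζ hb hv0 h
  have om := om_star hv hw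
  rw [conjTranspose_mul, conjTranspose_conjTranspose] at om
  have hB := MD.blk X0 D
  have hd := (((hB.mul hw).mul hB.star).mul hw.star).smul ζ⁻¹
  simp only [zero_smul, add_zero] at hd
  refine hd.congr ?_
  have e1 : blk 0 D * v 0 * (blk 1 X0)ᴴ * (v 0)ᴴ = ζ • blk 0 (D * X0ᴴ) := by
    rw [Matrix.mul_assoc (blk 0 D), c2, Matrix.mul_smul, Matrix.smul_mul, ← Matrix.mul_assoc, Matrix.mul_assoc, hv, Matrix.mul_one, blk_star, blk_mul, star_one, zero_mul]
  have e2 : blk 1 X0 * w * (blk 1 X0)ᴴ * (v 0)ᴴ = ζ • (blk 1 X0 * (w * (v 0)ᴴ) * (blk 1 X0)ᴴ) := by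
    have : (blk 1 X0)ᴴ * (v 0)ᴴ = ζ • ((v 0)ᴴ * (blk 1 X0)ᴴ) := by
      have := congrArg (fun M => (v 0)ᴴ * M * (v 0)ᴴ) c2
      simp only [Matrix.mul_smul, Matrix.smul_mul] at this
      rw [← Matrix.mul_assoc, hv0, Matrix.one_mul, Matrix.mul_assoc, Matrix.mul_assoc, hv, Matrix.mul_one] at this
      exact this
    rw [Matrix.mul_assoc, this, Matrix.mul_smul]
    simp only [Matrix.mul_assoc]
  have e3 : blk 1 X0 * v 0 * (blk 0 D)ᴴ * (v 0)ᴴ = ζ • (v 0 * blk 0 (X0 * Dᴴ) * (v 0)ᴴ) := by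
    rw [c1, Matrix.smul_mul, Matrix.smul_mul, Matrix.mul_assoc (v 0), blk_star, blk_mul, star_zero, mul_zero]
  have e4 : blk 1 X0 * v 0 * (blk 1 X0)ᴴ * wᴴ = ζ • (- (w * (v 0)ᴴ)) := by
    rw [← om, c1, Matrix.smul_mul, Matrix.smul_mul, Matrix.mul_assoc (v 0), mul_eq_one_comm.1 hb, Matrix.mul_one]
  simp only [Matrix.add_mul]
  rw [e1, e2, e3, e4]
  simp only [← smul_add, smul_smul, inv_mul_cancel₀ hζ, one_smul]
  abel

theorem dA {ζ : ℂ} (hζ : ζ ≠ 0) {X0 D : Matrix (Fin m) (Fin m) ℂ} (hX : X0ᴴ * X0 = 1) {v : ℝ → Mt m} {w : Mt m} (hv : ∀ s, v s * (v s)ᴴ = 1)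
    (hw : MD v w) (h : ζ⁻¹ • (blk 1 X0 * v 0 * (blk 1 X0)ᴴ * (v 0)ᴴ) = 1) :
    MD (fun s => ζ⁻¹ • (blk 1 (X0 + s • D) * v s * (blk 1 (X0 + s • D))ᴴ * (v s)ᴴ)
        - (ζ⁻¹ • (blk 1 (X0 + s • D) * v s * (blk 1 (X0 + s • D))ᴴ * (v s)ᴴ))ᴴ)
      (nn (v 0) (D * X0ᴴ) (TH (blk 1 X0) (w * (v 0)ᴴ))) := by
  have hd := dQ (D := D) hζ hX hv hw h
  have om := om_star hv hw
  refine (hd.sub hd.star).congr ?_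
  have e : blk 0 (D * X0ᴴ - (D * X0ᴴ)ᴴ) = blk 0 (D * X0ᴴ) - blk 0 (X0 * Dᴴ) := by
    rw [← blk_sub, sub_zero, conjTranspose_mul, conjTranspose_conjTranspose]
  have e2 : (blk 0 (D * X0ᴴ))ᴴ = blk 0 (X0 * Dᴴ) := by rw [blk_star, conjTranspose_mul, conjTranspose_conjTranspose, star_zero]
  have e3 : (blk 0 (X0 * Dᴴ))ᴴ = blk 0 (D * X0ᴴ) := by rw [blk_star, conjTranspose_mul, conjTranspose_conjTranspose, star_zero]
  rw [nn, e, TH]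
  generalize w * (v 0)ᴴ = Ω at *
  simp only [conjTranspose_sub, conjTranspose_add, conjTranspose_mul, conjTranspose_conjTranspose, om, e2, e3, Matrix.mul_neg, Matrix.neg_mul,
    Matrix.mul_sub, Matrix.sub_mul, two_smul, ← Matrix.mul_assoc]
  abel

theorem tau_TH {ζ : ℂ} (hζ : ζ ≠ 0) {X0 : Matrix (Fin m) (Fin m) ℂ} {v0 w : Mt m} (hX : X0ᴴ * X0 = 1) (hv0 : v0ᴴ * v0 = 1)
    (h : ζ⁻¹ • (blk 1 X0 * v0 * (blk 1 X0)ᴴ * v0ᴴ) = 1) (n : ℕ) :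
    tau v0 n (TH (blk 1 X0) (w * v0ᴴ)) = 2 * ((ζ⁻¹) ^ n - 1) * (∑ i ∈ Finset.range n, v0 ^ (n - 1 - i) * w * v0 ^ i) 0 0 := by
  have hb : (blk 1 X0)ᴴ * blk 1 X0 = 1 := by rw [blk_star, blk_mul, hX, star_one, one_mul, blk_one]
  obtain ⟨c1, c2⟩ := comm_rel hζ hb hv0 h
  have p1 : ∀ a : ℕ, v0 ^ a * blk 1 X0 = (ζ⁻¹) ^ a • (blk 1 X0 * v0 ^ a) := by
    intro a
    induction a with
    | zero => simp
    | succ a ih =>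
      have : v0 * blk 1 X0 = ζ⁻¹ • (blk 1 X0 * v0) := by rw [c1, smul_smul, inv_mul_cancel₀ hζ, one_smul]
      rw [pow_succ, Matrix.mul_assoc, this, Matrix.mul_smul, ← Matrix.mul_assoc, ih, Matrix.smul_mul, smul_smul, Matrix.mul_assoc, pow_succ ζ⁻¹, mul_comm]
  have p2 : ∀ a : ℕ, (blk 1 X0)ᴴ * v0 ^ a = (ζ⁻¹) ^ a • (v0 ^ a * (blk 1 X0)ᴴ) := by
    intro a
    induction a with
    | zero => simp
    | succ a ih =>
      have : (blk 1 X0)ᴴ * v0 = ζ⁻¹ • (v0 * (blk 1 X0)ᴴ) := by rw [c2, smul_smul, inv_mul_cancel₀ hζ, one_smul]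
      rw [pow_succ, ← Matrix.mul_assoc, ih, Matrix.smul_mul, Matrix.mul_assoc, this, Matrix.mul_smul, ← Matrix.mul_assoc, smul_smul, pow_succ ζ⁻¹]
  rw [tau, Matrix.sum_apply, Finset.mul_sum]
  refine Finset.sum_congr rfl fun i hi => ?_
  have hi := Finset.mem_range.1 hi
  have q1 : v0 ^ (n - 1 - i) * (blk 1 X0 * (w * v0ᴴ) * (blk 1 X0)ᴴ) * v0 ^ (i + 1)
      = (ζ⁻¹) ^ n • (blk 1 X0 * (v0 ^ (n - 1 - i) * (w * v0ᴴ) * v0 ^ (i + 1)) * (blk 1 X0)ᴴ) := by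
    calc _ = (v0 ^ (n - 1 - i) * blk 1 X0) * (w * v0ᴴ) * ((blk 1 X0)ᴴ * v0 ^ (i + 1)) := by simp only [Matrix.mul_assoc]
      _ = _ := by
        rw [p1, p2, Matrix.smul_mul, Matrix.smul_mul, Matrix.mul_smul, smul_smul, ← pow_add, show n - 1 - i + (i + 1) = n by omega]
        simp only [Matrix.mul_assoc]
  have q2 : (blk 1 X0 * (v0 ^ (n - 1 - i) * (w * v0ᴴ) * v0 ^ (i + 1)) * (blk 1 X0)ᴴ) 0 0 = (v0 ^ (n - 1 - i) * (w * v0ᴴ) * v0 ^ (i + 1)) 0 0 := conj_blk_00 _ _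
  have q3 : v0 ^ (n - 1 - i) * (w * v0ᴴ) * v0 ^ (i + 1) = v0 ^ (n - 1 - i) * w * v0 ^ i := by
    rw [pow_succ', Matrix.mul_assoc, ← Matrix.mul_assoc (w * v0ᴴ), Matrix.mul_assoc w, hv0, Matrix.mul_one, Matrix.mul_assoc]
  have q4 : v0 ^ (n - 1 - i) * TH (blk 1 X0) (w * v0ᴴ) * v0 ^ (i + 1)
     = (2:ℝ) • ((ζ⁻¹) ^ n • (blk 1 X0 * (v0 ^ (n - 1 - i) * (w * v0ᴴ) * v0 ^ (i + 1)) * (blk 1 X0)ᴴ) - v0 ^ (n - 1 - i) * w * v0 ^ i) := by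
    rw [TH, Matrix.mul_smul, Matrix.smul_mul, Matrix.mul_sub, Matrix.sub_mul, q1, q3]
  rw [q4, Matrix.smul_apply, Matrix.sub_apply, Matrix.smul_apply, q2, q3, Complex.real_smul, smul_eq_mul]
  push_cast
  ring

end PartP

end WrapP

section WrapQ
set_option linter.unusedSectionVars false

section PartQ
open Matrix
variable {m : ℕ}

/-- inclusion of a coordinate plane -/
def U2 (m k : ℕ) : Matrix (Fin (m + 1)) (Fin 2) ℂ := Matrix.of fun i a => if i.val = k + a.val then 1 else 0

theorem U2_unit {k : ℕ} (hk : k < m) : (U2 m k)ᵀ * U2 m k = 1 := by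
  ext a b
  rw [mul_apply]
  simp only [transpose_apply, U2, of_apply]
  have ha : k + a.val < m + 1 := by have := a.2; omega
  rw [Finset.sum_eq_single ⟨k + a.val, ha⟩]
  · simp [one_apply, Fin.ext_iff]
  · intro i _ hi
    rw [if_neg, zero_mul]
    intro h; exact hi (Fin.ext h)
  · simp

/-- embedding of a two by two matrix -/
noncomputable def emb (m k : ℕ) (B : Matrix (Fin 2) (Fin 2) ℂ) : Mt m := 1 + U2 m k * (B - 1) * (U2 m k)ᵀ

theorem emb_mul {k : ℕ} (hk : k < m) (B C : Matrix (Fin 2) (Fin 2) ℂ) : emb m k B * emb m k C = emb m k (B * C) := by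
  have h : U2 m k * (B - 1) * (U2 m k)ᵀ * (U2 m k * (C - 1) * (U2 m k)ᵀ) = U2 m k * ((B - 1) * (C - 1)) * (U2 m k)ᵀ := by
    calc _ = U2 m k * (B - 1) * ((U2 m k)ᵀ * U2 m k) * (C - 1) * (U2 m k)ᵀ := by simp only [Matrix.mul_assoc]
      _ = _ := by rw [U2_unit hk, Matrix.mul_one]; simp only [Matrix.mul_assoc]
  have h2 : B * C - 1 = (B - 1) + (C - 1) + (B - 1) * (C - 1) := by noncomm_ring
  rw [emb, emb, emb, Matrix.mul_add, Matrix.add_mul, Matrix.add_mul, h, h2, Matrix.mul_add, Matrix.mul_add, Matrix.add_mul, Matrix.add_mul]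
  simp only [Matrix.one_mul, Matrix.mul_one]
  abel

theorem emb_one {k : ℕ} : emb m k 1 = 1 := by simp [emb]

theorem emb_star {k : ℕ} (B : Matrix (Fin 2) (Fin 2) ℂ) : (emb m k B)ᴴ = emb m k Bᴴ := by
  have h : (U2 m k)ᴴ = (U2 m k)ᵀ := by
    ext i j; simp [U2, conjTranspose_apply, apply_ite]
  have h2 : ((U2 m k)ᵀ)ᴴ = U2 m k := by rw [← h, conjTranspose_conjTranspose]
  simp only [emb, conjTranspose_add, conjTranspose_one, conjTranspose_mul, h, h2, conjTranspose_sub, Matrix.mul_assoc]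

theorem emb_det {k : ℕ} (hk : k < m) (B : Matrix (Fin 2) (Fin 2) ℂ) : (emb m k B).det = B.det := by
  rw [emb, Matrix.mul_assoc, det_one_add_mul_comm, Matrix.mul_assoc, U2_unit hk, Matrix.mul_one, add_sub_cancel]

theorem emb_apply {k : ℕ} (B : Matrix (Fin 2) (Fin 2) ℂ) (i j : Fin (m + 1)) : emb m k B i j = (1 : Mt m) i j
    + ((if i.val = k then 1 else 0) * (B 0 0 - 1) + (if i.val = k + 1 then 1 else 0) * B 1 0) * (if j.val = k then 1 else 0)
    + ((if i.val = k then 1 else 0) * B 0 1 + (if i.val = k + 1 then 1 else 0) * (B 1 1 - 1)) * (if j.val = k + 1 then 1 else 0) := by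
  simp [emb, mul_apply, Fin.sum_univ_two, U2, add_assoc]

/-- the two by two matrix -/
noncomputable def Bm (b : ℂ) : Matrix (Fin 2) (Fin 2) ℂ := !![b, -(Real.sqrt (1 - ‖b‖ ^ 2) : ℂ); (Real.sqrt (1 - ‖b‖ ^ 2) : ℂ), star b]

theorem Bm_00 (b : ℂ) : Bm b 0 0 = b := rfl
theorem Bm_01 (b : ℂ) : Bm b 0 1 = -(Real.sqrt (1 - ‖b‖ ^ 2) : ℂ) := rfl
theorem Bm_10 (b : ℂ) : Bm b 1 0 = (Real.sqrt (1 - ‖b‖ ^ 2) : ℂ) := rfl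
theorem Bm_11 (b : ℂ) : Bm b 1 1 = star b := rfl

theorem Bm_aux {b : ℂ} (hb : ‖b‖ ≤ 1) : b * star b + (Real.sqrt (1 - ‖b‖ ^ 2) : ℂ) * (Real.sqrt (1 - ‖b‖ ^ 2) : ℂ) = 1 := by
  have h1 : b * star b = ((‖b‖ ^ 2 : ℝ) : ℂ) := by
    have := Complex.mul_conj' b; simpa using this
  rw [h1, ← Complex.ofReal_mul, Real.mul_self_sqrt (by nlinarith [norm_nonneg b])]
  push_cast; ring

theorem Bm_det {b : ℂ} (hb : ‖b‖ ≤ 1) : (Bm b).det = 1 := by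
  rw [Bm, det_fin_two_of, ← Bm_aux hb]; ring

theorem Bm_unit {b : ℂ} (hb : ‖b‖ ≤ 1) : (Bm b)ᴴ * Bm b = 1 := by
  have h := Bm_aux hb
  have h' : star b * b + (Real.sqrt (1 - ‖b‖ ^ 2) : ℂ) * (Real.sqrt (1 - ‖b‖ ^ 2) : ℂ) = 1 := by rw [← h]; ring
  ext i j
  fin_cases i <;> fin_cases j <;> simp [Bm, mul_apply, Fin.sum_univ_two, conjTranspose_apply] <;> simp at h h'
  · exact h'
  · ring
  · ring
  · rw [← h]; ring

/-- clamp to the unit disc -/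
noncomputable def clp (w : ℂ) : ℂ := ((max 1 ‖w‖)⁻¹ : ℝ) • w

theorem clp_norm (w : ℂ) : ‖clp w‖ ≤ 1 := by
  rw [clp, norm_smul, Real.norm_of_nonneg (by positivity)]
  rw [inv_mul_le_one₀ (by positivity)]
  exact le_max_right _ _

theorem clp_zero {w : ℂ} : clp w = 0 ↔ w = 0 := by
  rw [clp, smul_eq_zero]
  have : (max 1 ‖w‖)⁻¹ ≠ 0 := by positivity
  tauto

theorem clp_one {w : ℂ} (h : 1 ≤ ‖w‖) : ‖clp w‖ = 1 := by
  rw [clp, norm_smul, Real.norm_of_nonneg (by positivity), max_eq_right h]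
  exact inv_mul_cancel₀ (by positivity)

theorem clp_cont : Continuous clp := by
  unfold clp
  refine Continuous.smul (Continuous.inv₀ (continuous_const.max continuous_norm) ?_) continuous_id
  intro w; positivity

theorem clp_rot (w u : ℂ) (hu : ‖u‖ = 1) : clp (u * w) = u * clp w := by
  rw [clp, clp, norm_mul, hu, one_mul, mul_smul_comm]

/-- radius -/
noncomputable def xk (k : ℕ) : ℝ := 1 / (k + 3)

theorem xk_pos (k : ℕ) : 0 < xk k := by unfold xk; positivity
theorem xk_lt (k : ℕ) : xk k < 1 / 2 := by
  unfold xk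
  apply one_div_lt_one_div_of_lt (by norm_num)
  have : (0:ℝ) ≤ k := by positivity
  linarith
theorem xk_inj {j k : ℕ} (h : xk j = xk k) : j = k := by
  unfold xk at h
  have h1 := (div_eq_div_iff (by positivity : (j:ℝ) + 3 ≠ 0) (by positivity : (k:ℝ) + 3 ≠ 0)).1 h
  have : (j:ℝ) = k := by linarith
  exact_mod_cast this

/-- cutoff -/
noncomputable def chi (z : ℂ) : ℝ := max 0 (min 1 (2 - 2 * ‖z‖))

theorem chi_cont : Continuous chi := by unfold chi; fun_prop
theorem chi_nonneg (z : ℂ) : 0 ≤ chi z := le_max_left _ _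
theorem chi_le (z : ℂ) : chi z ≤ 1 := max_le zero_le_one (min_le_left _ _)
theorem chi_one {z : ℂ} (h : ‖z‖ ≤ 1 / 2) : chi z = 1 := by
  unfold chi; rw [min_eq_left (by linarith)]; simp
theorem chi_zero {z : ℂ} (h : 1 ≤ ‖z‖) : chi z = 0 := by
  unfold chi; rw [max_eq_left]; exact (min_le_right _ _).trans (by linarith)

/-- the functions phi -/
noncomputable def phi (k : ℕ) (z : ℂ) : ℂ := z ^ (k + 1) - ((xk k ^ (k + 1) * chi z : ℝ) : ℂ)

theorem phi_cont (k : ℕ) : Continuous (phi k) := by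
  unfold phi
  have := chi_cont
  fun_prop

theorem phi_zero_iff {k : ℕ} {z : ℂ} : phi k z = 0 ↔ z ^ (k + 1) = ((xk k : ℝ) : ℂ) ^ (k + 1) := by
  constructor
  · intro h
    have h1 : z ^ (k + 1) = ((xk k ^ (k + 1) * chi z : ℝ) : ℂ) := sub_eq_zero.1 h
    have hx := xk_pos k
    have hn : ‖z‖ ^ (k + 1) ≤ xk k ^ (k + 1) := by
      rw [← norm_pow, h1, Complex.norm_real, Real.norm_of_nonneg (mul_nonneg (by positivity) (chi_nonneg z))]
      exact mul_le_of_le_one_right (by positivity) (chi_le z)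
    have hz : ‖z‖ ≤ xk k := le_of_pow_le_pow_left₀ (by omega) hx.le hn
    rw [h1, chi_one (hz.trans (xk_lt k).le), mul_one]; push_cast; rfl
  · intro h
    have hx := xk_pos k
    have hn : ‖z‖ ^ (k + 1) = xk k ^ (k + 1) := by
      rw [← norm_pow, h, norm_pow, Complex.norm_real, Real.norm_of_nonneg hx.le]
    have hz : ‖z‖ ≤ xk k := le_of_pow_le_pow_left₀ (by omega) hx.le hn.le
    rw [phi, chi_one (hz.trans (xk_lt k).le), mul_one, h]; push_cast; ring

theorem phi_zero_norm {k : ℕ} {z : ℂ} (h : phi k z = 0) : ‖z‖ = xk k := by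
  rw [phi_zero_iff] at h
  have hx := xk_pos k
  have hn : ‖z‖ ^ (k + 1) = xk k ^ (k + 1) := by
    rw [← norm_pow, h, norm_pow, Complex.norm_real, Real.norm_of_nonneg hx.le]
  exact (pow_left_inj₀ (norm_nonneg _) hx.le (by omega)).1 hn

theorem phi_far {k : ℕ} {z : ℂ} (h : 1 ≤ ‖z‖) : phi k z = z ^ (k + 1) := by
  rw [phi, chi_zero h]; simp

/-- good scale -/
def LP (m : ℕ) (L : ℝ) : Prop := 1 < L ∧ ∀ z : ℂ, ∀ j k : Fin m, j ≠ k → 1 < ‖L * phi j z‖ ∨ 1 < ‖L * phi k z‖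

theorem exists_LP (m : ℕ) : ∃ L, LP m L := by
  have key : ∀ q : Fin m × Fin m, ∀ᶠ L : ℝ in Filter.atTop, 1 < L ∧ (q.1 ≠ q.2 → ∀ z : ℂ, 1 < ‖L * phi q.1 z‖ ∨ 1 < ‖L * phi q.2 z‖) := by
    rintro ⟨j, k⟩
    by_cases hjk : j = k
    · filter_upwards [Filter.eventually_gt_atTop 1] with L hL
      exact ⟨hL, fun h => absurd hjk h⟩
    have hne : ∀ z ∈ Metric.closedBall (0:ℂ) 1, ((phi j z, phi k z) : ℂ × ℂ) ≠ 0 := by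
      intro z _ h
      have h1 := phi_zero_norm (congrArg Prod.fst h)
      have h2 := phi_zero_norm (congrArg Prod.snd h)
      exact hjk (Fin.ext (xk_inj (h1.symm.trans h2)))
    obtain ⟨η, hη, hb⟩ := exists_lower (isCompact_closedBall (0:ℂ) 1) _ (((phi_cont j).prodMk (phi_cont k)).continuousOn) hne
    filter_upwards [Filter.eventually_gt_atTop 1, Filter.eventually_gt_atTop η⁻¹] with L hL1 hL
    refine ⟨hL1, fun _ z => ?_⟩
    have hL0 : 0 < L := by linarith
    have hn : ∀ w : ℂ, ‖(L:ℂ) * w‖ = L * ‖w‖ := fun w => by rw [norm_mul, Complex.norm_real, Real.norm_of_nonneg hL0.le]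
    simp only [hn]
    by_cases hz : ‖z‖ ≤ 1
    · have h1 := hb z (by simpa using hz)
      have h2 : 1 < L * η := by
        rw [inv_lt_iff_one_lt_mul₀ hη] at hL; linarith
      rw [Prod.norm_def, le_max_iff] at h1
      rcases h1 with h1 | h1
      · left; exact h2.trans_le (mul_le_mul_of_nonneg_left h1 hL0.le)
      · right; exact h2.trans_le (mul_le_mul_of_nonneg_left h1 hL0.le)
    · left
      have hz : 1 ≤ ‖z‖ := (not_le.1 hz).le
      rw [phi_far hz, norm_pow]
      have := one_le_pow₀ hz (n := j + 1)
      nlinarith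
  obtain ⟨L, hL⟩ := (((Filter.eventually_all.2 key)).and (Filter.eventually_gt_atTop 1)).exists
  exact ⟨L, hL.2, fun z j k hjk => (hL.1 (j, k)).2 hjk z⟩

/-- beta -/
noncomputable def bb (L : ℝ) (k : ℕ) (z : ℂ) : ℂ := clp (L * phi k z)

theorem bb_cont (L : ℝ) (k : ℕ) : Continuous (bb L k) := clp_cont.comp (continuous_const.mul (phi_cont k))

theorem emb_mem {k : ℕ} (hk : k < m) {b : ℂ} (hb : ‖b‖ ≤ 1) : emb m k (Bm b) ∈ Matrix.unitaryGroup (Fin (m + 1)) ℂ := by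
  rw [mem_unitaryGroup_iff', star_eq_conjTranspose, emb_star, emb_mul hk, Bm_unit hb, emb_one]

/-- the letters -/
noncomputable def RR (m : ℕ) (L : ℝ) (k : ℕ) (z : ℂ) : UU m :=
  if hk : k < m then ⟨emb m k (Bm (bb L k z)), emb_mem hk (clp_norm _)⟩ else 1

theorem RR_val {L : ℝ} {k : ℕ} {z : ℂ} (hk : k < m) : (RR m L k z : Mt m) = emb m k (Bm (bb L k z)) := by
  rw [RR, dif_pos hk]

theorem RR_det {L : ℝ} {k : ℕ} {z : ℂ} : (RR m L k z : Mt m).det = 1 := by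
  by_cases hk : k < m
  · rw [RR_val hk, emb_det hk]; exact Bm_det (clp_norm _)
  · rw [RR, dif_neg hk]; simp

theorem RR_cont {L : ℝ} {k : ℕ} : Continuous (RR m L k) := by
  by_cases hk : k < m
  · refine continuous_induced_rng.2 ?_
    have : (Subtype.val ∘ RR m L k) = fun z => emb m k (Bm (bb L k z)) := by
      ext1 z; exact RR_val hk
    rw [this]
    refine continuous_matrix fun i j => ?_
    simp only [emb_apply, Bm_00, Bm_01, Bm_10, Bm_11]
    have h1 := bb_cont L k
    have h2 : Continuous fun z => ((Real.sqrt (1 - ‖bb L k z‖ ^ 2) : ℝ) : ℂ) := by fun_prop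
    fun_prop
  · have : RR m L k = fun _ => 1 := by ext1 z; rw [RR, dif_neg hk]
    rw [this]; exact continuous_const

theorem RR_SS {L : ℝ} {k : ℕ} {z : ℂ} (hk : k < m) : RR m L k z ∈ SS m (fun n => bb L n z) k := by
  refine ⟨?_, ?_, ?_⟩
  · intro i j h
    rw [RR_val hk, emb_apply] at h
    by_contra hc
    apply h
    by_cases h1 : i.val = k <;> by_cases h2 : i.val = k + 1 <;> by_cases h3 : j.val = k <;> by_cases h4 : j.val = k + 1 <;> first | (exfalso; omega) | simp [h1, h2, h3, h4]
  · intro i hi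
    rw [RR_val hk, emb_apply, hi]
    simp [Bm]
  · intro i j hi hj
    rw [RR_val hk, emb_apply, emb_apply, hi, hj]
    have : i ≠ j := fun h => by rw [h] at hi; omega
    simp [Bm, one_apply_ne this, one_apply_ne this.symm]

/-- diagonal entries -/
noncomputable def ed (b : ℂ) (k i : ℕ) : ℂ := (if i = k then b else 1) * (if i = k + 1 then star b else 1)

theorem RR_diag {L : ℝ} {k : ℕ} {z : ℂ} (hk : k < m) (h : 1 ≤ ‖L * phi k z‖) : (RR m L k z : Mt m) = diagonal fun i : Fin (m + 1) => ed (bb L k z) k i := by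
  rw [RR_val hk]
  have hb : ‖bb L k z‖ = 1 := clp_one h
  ext i j
  rw [emb_apply, diagonal_apply, ed]
  by_cases hij : i = j
  · subst hij
    by_cases h1 : i.val = k
    · simp [h1, Bm]
    · by_cases h2 : i.val = k + 1 <;> simp [h1, h2, Bm]
  · have : i.val ≠ j.val := fun h => hij (Fin.ext h)
    rw [if_neg hij, one_apply_ne hij]
    by_cases h1 : i.val = k <;> by_cases h2 : i.val = k + 1 <;> by_cases h3 : j.val = k <;> by_cases h4 : j.val = k + 1 <;> first | (exfalso; omega) | simp [h1, h2, h3, h4, Bm, hb]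

theorem RR_TT {L : ℝ} {k : ℕ} {z : ℂ} (hk : k < m) (h : 1 ≤ ‖L * phi k z‖) : RR m L k z ∈ TT m := ⟨_, RR_diag hk h⟩

/-- the disc -/
noncomputable def v1 (m : ℕ) (L : ℝ) (z : ℂ) : UU m := ((List.range m).map fun k => RR m L k z).prod

/-- the complementary torus part -/
noncomputable def tk (m : ℕ) (L : ℝ) (k : ℕ) (z : ℂ) : UU m := (((List.range m).filter (· ≠ k)).map fun k => RR m L k z).prod

theorem v1_cont {L : ℝ} : Continuous (v1 m L) := continuous_list_prod _ fun _ _ => RR_cont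
theorem tk_cont {L : ℝ} {k : ℕ} : Continuous (tk m L k) := continuous_list_prod _ fun _ _ => RR_cont

theorem v1_det {L : ℝ} {z : ℂ} : (v1 m L z : Mt m).det = 1 := by
  rw [v1]
  induction List.range m with
  | nil => simp
  | cons a l ih => rw [List.map_cons, List.prod_cons, UnitaryGroup.mul_val, det_mul, RR_det, ih, one_mul]

/-- region -/
def Reg (m : ℕ) (L : ℝ) (k : ℕ) (z : ℂ) : Prop := k < m ∧ ∀ j < m, j ≠ k → 1 < ‖L * phi j z‖

theorem exists_reg {L : ℝ} (hL : LP m L) (hm : 0 < m) (z : ℂ) : ∃ k, Reg m L k z := by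
  by_cases h : ∃ k < m, ‖L * phi k z‖ ≤ 1
  · obtain ⟨k, hk, h⟩ := h
    refine ⟨k, hk, fun j hj hjk => ?_⟩
    exact (hL.2 z ⟨j, hj⟩ ⟨k, hk⟩ (fun h => hjk (Fin.ext_iff.1 h))).resolve_right (not_lt.2 h)
  · push Not at h
    exact ⟨0, hm, fun j hj _ => h j hj⟩

theorem reg_of_zero {L : ℝ} (hL : LP m L) {k : ℕ} (hk : k < m) {z : ℂ} (h : phi k z = 0) : Reg m L k z := by
  refine ⟨hk, fun j hj hjk => ?_⟩
  exact (hL.2 z ⟨j, hj⟩ ⟨k, hk⟩ (fun h => hjk (Fin.ext_iff.1 h))).resolve_right (by simp [h])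

theorem tk_TT {L : ℝ} {k : ℕ} {z : ℂ} (h : Reg m L k z) : tk m L k z ∈ TT m := by
  apply Subgroup.list_prod_mem
  intro x hx
  simp only [List.mem_map, List.mem_filter, List.mem_range, decide_eq_true_eq] at hx
  obtain ⟨j, ⟨hj, hjk⟩, rfl⟩ := hx
  exact RR_TT hj (h.2 j hj hjk).le

theorem v1_reg {L : ℝ} {k : ℕ} {z : ℂ} (h : Reg m L k z) : ∃ r ∈ SS m (fun n => bb L n z) k, v1 m L z = r * tk m L k z := by
  have hk := h.1
  obtain ⟨l1, l2, hl⟩ := List.append_of_mem (List.mem_range.2 hk)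
  have hnd : (l1 ++ k :: l2).Nodup := hl ▸ List.nodup_range
  have h1 : ∀ j ∈ l1, j ≠ k := by
    rintro j hj rfl
    exact (List.nodup_append.1 hnd).2.2 j hj j (by simp) rfl
  have h2 : ∀ j ∈ l2, j ≠ k := by
    rintro j hj rfl
    have := (List.nodup_append.1 hnd).2.1
    rw [List.nodup_cons] at this
    exact this.1 hj
  have f1 : (l1.filter (· ≠ k)) = l1 := List.filter_eq_self.2 fun a ha => by simpa using h1 a ha
  have f2 : (l2.filter (· ≠ k)) = l2 := List.filter_eq_self.2 fun a ha => by simpa using h2 a ha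
  have ft : tk m L k z = (l1.map fun k => RR m L k z).prod * (l2.map fun k => RR m L k z).prod := by
    rw [tk, hl, List.filter_append, List.filter_cons_of_neg (by simp), f1, f2, List.map_append, List.prod_append]
  have hT : (l1.map fun k => RR m L k z).prod ∈ TT m := by
    apply Subgroup.list_prod_mem
    intro x hx
    obtain ⟨j, hj, rfl⟩ := List.mem_map.1 hx
    have hjm : j < m := List.mem_range.1 (by rw [hl]; simp [hj])
    exact RR_TT hjm (h.2 j hjm (h1 j hj)).le
  refine ⟨_, SS_conj k _ (RR_SS (L := L) (z := z) hk) _ hT, ?_⟩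
  rw [v1, hl, List.map_append, List.prod_append, List.map_cons, List.prod_cons, ft]
  group

theorem v1_far {L : ℝ} (hL : LP m L) {z : ℂ} (hz : 1 ≤ ‖z‖) : (v1 m L z : Mt m) = diagonal fun i : Fin (m + 1) => ∏ k ∈ Finset.range m, ed (bb L k z) k i := by
  have hr : ∀ k, 1 ≤ ‖L * phi k z‖ := fun k => by
    rw [phi_far hz, norm_mul, norm_pow, Complex.norm_real, Real.norm_of_nonneg (by linarith [hL.1])]
    exact one_le_mul_of_one_le_of_one_le hL.1.le (one_le_pow₀ hz)
  have key : ∀ n ≤ m, ((((List.range n).map fun k => RR m L k z).prod : UU m) : Mt m) = diagonal fun i : Fin (m + 1) => ∏ k ∈ Finset.range n, ed (bb L k z) k i := by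
    intro n hn
    induction n with
    | zero => simp
    | succ n ih =>
      rw [List.range_succ, List.map_append, List.prod_append, UnitaryGroup.mul_val, ih (by omega), List.map_singleton, List.prod_singleton, RR_diag (by omega) (hr n), diagonal_mul_diagonal]
      simp only [Finset.prod_range_succ]
  exact key m le_rfl

theorem prod_ed (b : ℕ → ℂ) (i : ℕ) : ∏ k ∈ Finset.range m, ed (b k) k i = (if i < m then b i else 1) * (if 0 < i ∧ i ≤ m then star (b (i - 1)) else 1) := by
  simp only [ed, Finset.prod_mul_distrib]
  congr 1
  · rw [Finset.prod_ite_eq]; simp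
  · rcases i with _ | i
    · simp
    · simp only [add_left_inj]
      rw [Finset.prod_ite_eq]; simp [Nat.succ_le_iff]

theorem v1_rot {L : ℝ} (hL : LP m L) (hm : 0 < m) {z ζ : ℂ} (hz : 1 ≤ ‖z‖) (hζ : ζ ^ (m + 1) = 1) : (v1 m L (ζ * z) : Mt m) = ζ • (v1 m L z : Mt m) := by
  have hn : ‖ζ‖ = 1 := by
    have : ‖ζ‖ ^ (m + 1) = 1 := by rw [← norm_pow, hζ, norm_one]
    exact (pow_eq_one_iff_of_nonneg (norm_nonneg _) (by omega)).1 this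
  have hs : ζ * star ζ = 1 := by
    have := Complex.mul_conj' ζ; rw [hn] at this; simpa using this
  have hz' : 1 ≤ ‖ζ * z‖ := by rwa [norm_mul, hn, one_mul]
  have hb : ∀ k, bb L k (ζ * z) = ζ ^ (k + 1) * bb L k z := by
    intro k
    rw [bb, bb, phi_far hz, phi_far hz', mul_pow, ← clp_rot _ _ (by rw [norm_pow, hn, one_pow])]
    congr 1; ring
  rw [v1_far hL hz, v1_far hL hz', ← diagonal_smul]
  congr 1
  ext i
  have hi := i.2
  rw [Pi.smul_apply, prod_ed (fun k => bb L k (ζ * z)), prod_ed (fun k => bb L k z), smul_eq_mul]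
  simp only [hb]
  by_cases h1 : i.val < m <;> by_cases h2 : 0 < i.val
  · rw [if_pos h1, if_pos h1, if_pos ⟨h2, h1.le⟩, if_pos ⟨h2, h1.le⟩]
    obtain ⟨j, hj⟩ : ∃ j, i.val = j + 1 := ⟨i.val - 1, by omega⟩
    rw [hj, add_tsub_cancel_right, star_mul', star_pow]
    have : ζ ^ (j + 1 + 1) * star ζ ^ (j + 1) = ζ := by
      rw [pow_succ, mul_right_comm, ← mul_pow, hs, one_pow, one_mul]
    linear_combination (bb L (j + 1) z * star (bb L j z)) * this
  · rw [if_pos h1, if_pos h1, if_neg (by tauto), if_neg (by tauto)]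
    have : i.val = 0 := by omega
    rw [this]; ring
  · have him : i.val = m := by omega
    rw [if_neg h1, if_neg h1, if_pos ⟨h2, by omega⟩, if_pos ⟨h2, by omega⟩, him, Nat.sub_add_cancel hm, star_mul', star_pow]
    have : star ζ ^ m = ζ := by
      calc star ζ ^ m = star ζ ^ m * ζ ^ (m + 1) := by rw [hζ, mul_one]
        _ = ζ := by rw [pow_succ, ← mul_assoc, ← mul_pow, mul_comm (star ζ), hs, one_pow, one_mul]
    rw [this]; ring
  · omega

end PartQ

end WrapQ

section WrapR
set_option linter.unusedSectionVars false

section PartR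
open Matrix
variable {m : ℕ}

/-- the family of matrices -/
noncomputable def vv (m : ℕ) (L : ℝ) (z : Fin m → ℂ) : UU m := (List.ofFn fun i => v1 m L (z i)).prod

theorem vv_eq (L : ℝ) (z : Fin m → ℂ) : vv m L z = ((List.finRange m).map fun i => v1 m L (z i)).prod := by
  rw [vv, List.ofFn_eq_map]

theorem vv_cont {L : ℝ} : Continuous (vv m L) := by
  have : vv m L = fun z => ((List.finRange m).map fun i => v1 m L (z i)).prod := funext (vv_eq L)
  rw [this]
  exact continuous_list_prod _ fun i _ => v1_cont.comp (continuous_apply i)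

theorem vv_det {L : ℝ} {z : Fin m → ℂ} : (vv m L z : Mt m).det = 1 := by
  rw [vv_eq]
  induction List.finRange m with
  | nil => simp
  | cons a l ih => rw [List.map_cons, List.prod_cons, UnitaryGroup.mul_val, det_mul, v1_det, ih, one_mul]

theorem vv_rot {L : ℝ} (hL : LP m L) (hm : 0 < m) {z : Fin m → ℂ} {i : Fin m} {ζ : ℂ} (hz : 1 ≤ ‖z i‖) (hζ : ζ ^ (m + 1) = 1) :
    (vv m L (Function.update z i (ζ * z i)) : Mt m) = ζ • (vv m L z : Mt m) := by
  have key : ∀ l : List (Fin m), l.Nodup → (((l.map fun j => v1 m L (Function.update z i (ζ * z i) j)).prod : UU m) : Mt m)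
      = (if i ∈ l then ζ else 1) • ((l.map fun j => v1 m L (z j)).prod : Mt m) := by
    intro l hl
    induction l with
    | nil => simp
    | cons a l ih =>
      rw [List.nodup_cons] at hl
      simp only [List.map_cons, List.prod_cons, UnitaryGroup.mul_val]
      rw [ih hl.2]
      by_cases ha : a = i
      · subst ha
        rw [Function.update_self, v1_rot hL hm hz hζ, if_neg hl.1, if_pos (by simp), one_smul, Matrix.smul_mul]
      · rw [Function.update_of_ne ha, Matrix.mul_smul]
        congr 1
        have : i ∈ a :: l ↔ i ∈ l := by simp [Ne.symm ha]
        simp only [this]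
  rw [vv_eq, vv_eq, key _ (List.nodup_finRange m), if_pos (by simp)]

/-- torus entries -/
noncomputable def dte (m : ℕ) (L : ℝ) (k : ℕ) (z : ℂ) (n : ℕ) : ℂ := if h : n < m + 1 then (tk m L k z : Mt m) ⟨n, h⟩ ⟨n, h⟩ else 1

theorem dte_cont {L : ℝ} {k n : ℕ} : Continuous fun z => dte m L k z n := by
  unfold dte
  split_ifs with h
  · have h1 : Continuous fun z => (tk m L k z : Mt m) := continuous_subtype_val.comp tk_cont
    exact h1.matrix_elem _ _
  · exact continuous_const

theorem tk_dte {L : ℝ} {k : ℕ} {z : ℂ} (h : Reg m L k z) : (tk m L k z : Mt m) = diagonal fun j : Fin (m + 1) => dte m L k z j := by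
  obtain ⟨d, hd⟩ := tk_TT h
  have : ∀ j : Fin (m + 1), dte m L k z j = d j := by
    intro j
    rw [dte, dif_pos j.2, hd]; simp
  rw [hd]; simp only [this]

theorem dte_ne {L : ℝ} {k n : ℕ} {z : ℂ} (h : Reg m L k z) : dte m L k z n ≠ 0 := by
  by_cases hn : n < m + 1
  · have := TT_norm (tk_dte h) ⟨n, hn⟩
    intro h0
    simp only [h0, mul_zero] at this
    exact zero_ne_one this
  · rw [dte, dif_neg hn]; exact one_ne_zero

theorem vv_entry {L : ℝ} {z : Fin m → ℂ} (σ : Equiv.Perm (Fin m)) (hz : ∀ i, Reg m L (σ i) (z i)) (k : Fin m)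
    (h0 : ∀ l < k, bb L l (z (σ.symm l)) = 0) :
    ((vv m L z : Mt m) ^ (k.val + 1)) 0 0 = (-1) ^ k.val * (∏ j ∈ Finset.range (k.val + 1), ∏ i, dte m L (σ i) (z i) j) * bb L k (z (σ.symm k)) := by
  choose rs hrs hv using fun i => v1_reg (hz i)
  set β : ℕ → ℂ := fun n => if h : n < m then bb L n (z (σ.symm ⟨n, h⟩)) else 0 with hβ
  have hβk : ∀ k : Fin m, β k = bb L k (z (σ.symm k)) := fun k => by simp [hβ]
  have hrs' : ∀ i, rs i ∈ SS m β (σ i) := by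
    intro i
    obtain ⟨a, b, c⟩ := hrs i
    refine ⟨a, fun j hj => ?_, c⟩
    rw [b j hj, hβk, Equiv.symm_apply_apply]
  have := lemE σ rs (fun i => tk m L (σ i) (z i)) (fun i j => dte m L (σ i) (z i) j) (fun i => tk_dte (hz i)) hrs' k k.2
    (fun l hl => by
      have hlm : l < m := by omega
      rw [hβk ⟨l, hlm⟩]; exact h0 ⟨l, hlm⟩ hl)
  rw [hβk] at this
  rw [← this, SubmonoidClass.coe_pow]
  have e : vv m L z = (List.ofFn fun i => rs i * tk m L (σ i) (z i)).prod := by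
    rw [vv]; congr 2
    ext1 i; exact hv i
  rw [e]

theorem vv_unit (L : ℝ) (z : Fin m → ℂ) : (vv m L z : Mt m)ᴴ * (vv m L z : Mt m) = 1 := UnitaryGroup.star_mul_self _
theorem vv_unit' (L : ℝ) (z : Fin m → ℂ) : (vv m L z : Mt m) * (vv m L z : Mt m)ᴴ = 1 := mul_eq_one_comm.1 (vv_unit L z)

theorem block_prod {k : ℕ} {ι : Type*} (l : List ι) (f : ι → UU m) (h : ∀ x, ∀ i j : Fin (m + 1), j.val ≤ k → k < i.val → (f x : Mt m) i j = 0)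
    (i j : Fin (m + 1)) (hj : j.val ≤ k) (hi : k < i.val) : ((l.map f).prod : Mt m) i j = 0 := by
  induction l generalizing i j with
  | nil => 
    have : i ≠ j := fun h => by rw [h] at hi; omega
    simp [one_apply_ne this]
  | cons a l ih =>
    rw [List.map_cons, List.prod_cons, UnitaryGroup.mul_val, mul_apply]
    refine Finset.sum_eq_zero fun c _ => ?_
    by_cases hc : c.val ≤ k
    · rw [h a i c hc hi, zero_mul]
    · rw [ih c j hj (not_le.1 hc), mul_zero]

theorem cyc_iff {L : ℝ} (hL : LP m L) (hm : 0 < m) (z : Fin m → ℂ) :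
    Cyc (vv m L z : Mt m) ↔ ∃ σ : Equiv.Perm (Fin m), ∀ i, phi (σ i) (z i) = 0 := by
  constructor
  · intro hc
    choose ks hks using fun i => exists_reg hL hm (z i)
    have hsurj : Function.Surjective (fun i => (⟨ks i, (hks i).1⟩ : Fin m)) := by
      intro k
      by_contra hk
      push Not at hk
      refine missing (vv_unit L z) hc k k.2 ?_
      intro i j hj hi
      rw [vv_eq]
      refine block_prod _ _ ?_ i j hj hi
      intro x i j hj hi
      obtain ⟨r, hr, hv⟩ := v1_reg (hks x)
      rw [hv, UnitaryGroup.mul_val, tk_dte (hks x), mul_diagonal]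
      have hij : i ≠ j := fun h => by rw [h] at hi; omega
      have : (r : Mt m) i j = 0 := by
        by_contra h
        have h1 := hr.1 i j (by rwa [one_apply_ne hij])
        have h2 : ks x ≠ k := fun h => hk x (Fin.ext h)
        omega
      rw [this, zero_mul]
    have hbij := (Finite.injective_iff_surjective.2 hsurj)
    let σ : Equiv.Perm (Fin m) := Equiv.ofBijective _ ⟨hbij, hsurj⟩
    have hσ : ∀ i, ((σ i : Fin m) : ℕ) = ks i := fun i => rfl
    have hz : ∀ i, Reg m L (σ i) (z i) := fun i => by rw [hσ]; exact hks i
    have key : ∀ n, ∀ k : Fin m, k.val = n → bb L k (z (σ.symm k)) = 0 := by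
      intro n
      induction n using Nat.strong_induction_on with
      | _ n ih =>
        intro k hk
        have h1 := vv_entry σ hz k (fun l hl => ih l.val (by rw [← hk]; exact hl) l rfl)
        rw [hc _ (by omega) (by have := k.2; omega)] at h1
        rcases mul_eq_zero.1 h1.symm with h2 | h2
        · exfalso
          rcases mul_eq_zero.1 h2 with h3 | h3
          · exact pow_ne_zero _ (by norm_num) h3
          · refine Finset.prod_ne_zero_iff.2 (fun j _ => Finset.prod_ne_zero_iff.2 fun i _ => ?_) h3
            exact dte_ne (hz i)
        · exact h2
    refine ⟨σ, fun i => ?_⟩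
    have := key _ (σ i) rfl
    rw [Equiv.symm_apply_apply, bb, clp_zero] at this
    have hL0 : (L : ℂ) ≠ 0 := by
      have := hL.1
      exact_mod_cast (by linarith : L ≠ 0)
    exact (mul_eq_zero.1 this).resolve_left hL0
  · rintro ⟨σ, hσ⟩
    have hz : ∀ i, Reg m L (σ i) (z i) := fun i => reg_of_zero hL (σ i).2 (hσ i)
    have hb : ∀ k : Fin m, bb L k (z (σ.symm k)) = 0 := by
      intro k
      have := hσ (σ.symm k)
      rw [Equiv.apply_symm_apply] at this
      rw [bb, this, mul_zero, clp_zero]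
    intro n h1 h2
    have := vv_entry σ hz ⟨n - 1, by omega⟩ (fun l _ => hb l)
    rw [hb] at this
    simp only [Nat.sub_add_cancel h1] at this
    rw [this, mul_zero]

/-- smoothness -/
def MC {E : Type*} [NormedAddCommGroup E] [NormedSpace ℝ E] (M : E → Mt m) (x : E) : Prop := ∀ i j, ContDiffAt ℝ 1 (fun y => M y i j) x

section
variable {E : Type*} [NormedAddCommGroup E] [NormedSpace ℝ E]

theorem MC.mul {A B : E → Mt m} {x : E} (hA : MC A x) (hB : MC B x) : MC (fun y => A y * B y) x := by
  intro i j
  simp only [mul_apply]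
  exact ContDiffAt.sum fun l _ => (hA i l).mul (hB l j)

theorem contDiffAt_star {f : E → ℂ} {x : E} (hf : ContDiffAt ℝ 1 f x) : ContDiffAt ℝ 1 (fun y => star (f y)) x :=
  (Complex.conjCLE.contDiff.contDiffAt (x := f x)).comp x hf

theorem MC.star {A : E → Mt m} {x : E} (hA : MC A x) : MC (fun y => (A y)ᴴ) x :=
  fun i j => contDiffAt_star (hA j i)

theorem MC.prod {ι : Type*} (l : List ι) (f : ι → E → UU m) {x : E} (h : ∀ i ∈ l, MC (fun y => (f i y : Mt m)) x) :
    MC (fun y => (((l.map fun i => f i y).prod : UU m) : Mt m)) x := by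
  induction l with
  | nil => intro i j; simp only [List.map_nil, List.prod_nil]; exact contDiffAt_const
  | cons a l ih =>
    simp only [List.map_cons, List.prod_cons, UnitaryGroup.mul_val]
    exact (h a (by simp)).mul (ih fun i hi => h i (by simp [hi]))
end

theorem phi_eventually {k n : ℕ} {z : ℂ} (h : phi k z = 0) : ∀ᶠ y in nhds z, phi n y = y ^ (n + 1) - (xk n : ℂ) ^ (n + 1) := by
  have hz : ‖z‖ < 1 / 2 := by rw [phi_zero_norm h]; exact xk_lt k
  filter_upwards [(continuous_norm.continuousAt (x := z)).eventually_lt continuousAt_const hz] with y hy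
  rw [phi, chi_one hy.le, mul_one]; push_cast; rfl

theorem bb_zero_eventually {L : ℝ} {k : ℕ} {z : ℂ} (h : phi k z = 0) : ∀ᶠ y in nhds z, bb L k y = L * (y ^ (k + 1) - (xk k : ℂ) ^ (k + 1)) := by
  have hc : ContinuousAt (fun y => ‖(L:ℂ) * phi k y‖) z := (continuous_norm.comp (continuous_const.mul (phi_cont k))).continuousAt
  filter_upwards [phi_eventually h (n := k), hc.eventually_lt continuousAt_const (by simp [h] : ‖(L:ℂ) * phi k z‖ < 1)] with y h1 h2
  rw [bb, clp, max_eq_left h2.le, inv_one, one_smul, h1]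

theorem RR_smooth {L : ℝ} (hL : LP m L) {k : ℕ} (hk : k < m) {z : ℂ} (h : phi k z = 0) (j : ℕ) : MC (fun y => (RR m L j y : Mt m)) z := by
  by_cases hj : j < m
  swap
  · simp only [RR, dif_neg hj]
    intro a b; exact contDiffAt_const
  have hpoly : ContDiffAt ℝ 1 (fun y : ℂ => (L:ℂ) * (y ^ (j + 1) - (xk j : ℂ) ^ (j + 1))) z := by fun_prop
  have hb : ContDiffAt ℝ 1 (bb L j) z ∧ ContDiffAt ℝ 1 (fun y => ((Real.sqrt (1 - ‖bb L j y‖ ^ 2) : ℝ) : ℂ)) z := by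
    by_cases hjk : j = k
    · subst hjk
      have h1 : ContDiffAt ℝ 1 (bb L j) z := hpoly.congr_of_eventuallyEq (bb_zero_eventually h)
      have h0 : bb L j z = 0 := by rw [bb, h, mul_zero, clp_zero]
      refine ⟨h1, ?_⟩
      have h2 : ContDiffAt ℝ 1 (fun y => Real.sqrt (1 - ‖bb L j y‖ ^ 2)) z := by
        refine ContDiffAt.sqrt (contDiffAt_const.sub (h1.norm_sq ℝ)) ?_
        rw [h0]; simp
      exact (Complex.ofRealCLM.contDiff.contDiffAt).comp z h2
    · have hr := (reg_of_zero hL hk h).2 j hj hjk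
      have hc : ContinuousAt (fun y => ‖(L:ℂ) * phi j y‖) z := (continuous_norm.comp (continuous_const.mul (phi_cont j))).continuousAt
      have hev := continuousAt_const.eventually_lt hc hr
      have hph := phi_eventually h (n := j)
      have hz : (L:ℂ) * (z ^ (j + 1) - (xk j : ℂ) ^ (j + 1)) ≠ 0 := by
        rw [← hph.self_of_nhds]
        intro h0; rw [h0] at hr; simp at hr; linarith
      constructor
      · have h1 : ContDiffAt ℝ 1 (fun y : ℂ => (‖(L:ℂ) * (y ^ (j + 1) - (xk j : ℂ) ^ (j + 1))‖)⁻¹ • ((L:ℂ) * (y ^ (j + 1) - (xk j : ℂ) ^ (j + 1)))) z :=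
          ((hpoly.norm ℝ hz).inv (norm_ne_zero_iff.2 hz)).smul hpoly
        refine h1.congr_of_eventuallyEq ?_
        filter_upwards [hev, hph] with y h2 h3
        rw [bb, clp, max_eq_right h2.le, h3]
      · refine (contDiffAt_const (c := (0:ℂ))).congr_of_eventuallyEq ?_
        filter_upwards [hev] with y h2
        have : ‖bb L j y‖ = 1 := clp_one h2.le
        simp [this]
  intro a b
  simp only [RR_val hj, emb_apply, Bm_00, Bm_01, Bm_10, Bm_11]
  have h1 := hb.1
  have h2 := hb.2
  have h3 := contDiffAt_star h1
  have hh : ∀ c : ℂ, ContDiffAt ℝ 1 (fun _ : ℂ => c) z := fun c => contDiffAt_const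
  exact ((hh _).add ((((hh _).mul (h1.sub (hh _))).add ((hh _).mul h2)).mul (hh _))).add ((((hh _).mul h2.neg).add ((hh _).mul (h3.sub (hh _)))).mul (hh _))

theorem vv_smooth {L : ℝ} (hL : LP m L) {z : Fin m → ℂ} (σ : Equiv.Perm (Fin m)) (hσ : ∀ i, phi (σ i) (z i) = 0) :
    MC (fun y => (vv m L y : Mt m)) z := by
  simp only [vv_eq]
  refine MC.prod _ (fun i (y : Fin m → ℂ) => v1 m L (y i)) fun i _ => ?_
  have h1 : MC (fun y => (v1 m L y : Mt m)) (z i) := MC.prod _ (fun j y => RR m L j y) fun j _ => RR_smooth hL (σ i).2 (hσ i) j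
  intro a b
  exact (h1 a b).comp z (contDiff_apply ℝ ℂ i).contDiffAt

theorem hasDerivAt_mul_zero {U b : ℝ → ℂ} {b' : ℂ} (hU : ContinuousAt U 0) (hb : HasDerivAt b b' 0) (hb0 : b 0 = 0) :
    HasDerivAt (fun s => U s * b s) (U 0 * b') 0 := by
  rw [hasDerivAt_iff_tendsto_slope] at hb ⊢
  have h1 : Filter.Tendsto U (nhdsWithin 0 {0}ᶜ) (nhds (U 0)) := hU.tendsto.mono_left nhdsWithin_le_nhds
  refine (h1.mul hb).congr fun s => ?_
  simp [slope, hb0]; ring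

theorem vv_deriv {L : ℝ} (hL : LP m L) {z : Fin m → ℂ} (σ : Equiv.Perm (Fin m)) (hσ : ∀ i, phi (σ i) (z i) = 0) :
    ∃ c : Fin m → ℂ, (∀ k, c k ≠ 0) ∧ ∀ δ : Fin m → ℂ, ∀ k : Fin m, (∀ j < k, δ (σ.symm j) = 0) → ∀ w : Mt m,
      MD (fun s : ℝ => (vv m L (z + s • δ) : Mt m)) w →
      (∑ i ∈ Finset.range (k.val + 1), (vv m L z : Mt m) ^ (k.val + 1 - 1 - i) * w * (vv m L z : Mt m) ^ i) 0 0 = c k * δ (σ.symm k) := by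
  have hL0 : (L : ℂ) ≠ 0 := by
    have := hL.1
    exact_mod_cast (by linarith : L ≠ 0)
  have hreg : ∀ i, Reg m L (σ i) (z i) := fun i => reg_of_zero hL (σ i).2 (hσ i)
  have hphi0 : ∀ k : Fin m, phi k (z (σ.symm k)) = 0 := fun k => by
    have := hσ (σ.symm k); rwa [Equiv.apply_symm_apply] at this
  have hz0 : ∀ k : Fin m, z (σ.symm k) ≠ 0 := by
    intro k h
    have := phi_zero_norm (hphi0 k)
    rw [h, norm_zero] at this
    exact (xk_pos k).ne this
  refine ⟨fun k => ((-1) ^ k.val * (∏ j ∈ Finset.range (k.val + 1), ∏ i, dte m L (σ i) (z i) j)) * (L * ((k.val + 1 : ℕ) * z (σ.symm k) ^ k.val)), ?_, ?_⟩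
  · intro k
    refine mul_ne_zero (mul_ne_zero (pow_ne_zero _ (by norm_num)) ?_) (mul_ne_zero hL0 (mul_ne_zero (Nat.cast_ne_zero.2 (Nat.succ_ne_zero _)) (pow_ne_zero _ (hz0 k))))
    exact Finset.prod_ne_zero_iff.2 fun j _ => Finset.prod_ne_zero_iff.2 fun i _ => dte_ne (hreg i)
  · intro δ k hδ w hw
    have hpow := hw.pow (k.val + 1) 0 0
    simp only [zero_smul, add_zero] at hpow
    have hcur : ∀ i, Continuous fun s : ℝ => (z + s • δ) i := fun i => by
      simp only [Pi.add_apply, Pi.smul_apply]; fun_prop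
    have hcur0 : ∀ i, (z + (0:ℝ) • δ) i = z i := fun i => by simp
    have hregev : ∀ᶠ s : ℝ in nhds 0, ∀ i, Reg m L (σ i) ((z + s • δ) i) := by
      refine Filter.eventually_all.2 fun i => ?_
      have : ∀ᶠ s : ℝ in nhds 0, ∀ j : Fin m, j ≠ σ i → 1 < ‖L * phi j ((z + s • δ) i)‖ := by
        refine Filter.eventually_all.2 fun j => ?_
        by_cases hj : j = σ i
        · exact Filter.Eventually.of_forall fun _ h => absurd hj h
        have hc : ContinuousAt (fun s : ℝ => ‖(L:ℂ) * phi j ((z + s • δ) i)‖) 0 := 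
          (continuous_norm.comp (continuous_const.mul ((phi_cont j).comp (hcur i)))).continuousAt
        have h1 := (hreg i).2 j j.2 (fun h => hj (Fin.ext h))
        rw [← hcur0 i] at h1
        filter_upwards [continuousAt_const.eventually_lt hc h1] with s hs _ using hs
      filter_upwards [this] with s hs
      exact ⟨(σ i).2, fun j hj hji => hs ⟨j, hj⟩ (fun h => hji (Fin.ext_iff.1 h))⟩
    have hbe : ∀ᶠ s : ℝ in nhds 0, bb L k ((z + s • δ) (σ.symm k)) = L * ((z + s • δ) (σ.symm k) ^ (k.val + 1) - (xk k : ℂ) ^ (k.val + 1)) := by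
      have h1 := bb_zero_eventually (L := L) (hphi0 k)
      rw [← hcur0 (σ.symm k)] at h1
      exact (hcur (σ.symm k)).continuousAt.eventually h1
    have hlin : HasDerivAt (fun s : ℝ => (z + s • δ) (σ.symm k)) (δ (σ.symm k)) 0 := by
      have := ((hasDerivAt_id (0:ℝ)).smul_const (δ (σ.symm k))).const_add (z (σ.symm k))
      simpa using this
    have hb : HasDerivAt (fun s : ℝ => bb L k ((z + s • δ) (σ.symm k))) (L * ((k.val + 1 : ℕ) * z (σ.symm k) ^ k.val * δ (σ.symm k))) 0 := by
      have h1 := ((hlin.pow (k.val + 1)).sub_const ((xk k : ℂ) ^ (k.val + 1))).const_mul (L : ℂ)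
      simp only [hcur0, add_tsub_cancel_right] at h1
      exact h1.congr_of_eventuallyEq hbe
    have hU : ContinuousAt (fun s : ℝ => (-1) ^ k.val * (∏ j ∈ Finset.range (k.val + 1), ∏ i, dte m L (σ i) ((z + s • δ) i) j)) 0 := by
      refine Continuous.continuousAt (continuous_const.mul (continuous_finsetProd _ fun j _ => continuous_finsetProd _ fun i _ => ?_))
      exact dte_cont.comp (hcur i)
    have hb0 : bb L k ((z + (0:ℝ) • δ) (σ.symm k)) = 0 := by
      rw [hcur0, bb, hphi0, mul_zero, clp_zero]
    have hfin := hasDerivAt_mul_zero hU hb hb0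
    simp only [hcur0] at hfin
    have hF : HasDerivAt (fun s : ℝ => ((vv m L (z + s • δ) : Mt m) ^ (k.val + 1)) 0 0) _ 0 := hfin.congr_of_eventuallyEq (by
      filter_upwards [hregev] with s hs
      refine vv_entry σ hs k fun l hl => ?_
      rw [Pi.add_apply, Pi.smul_apply, hδ l hl, smul_zero, add_zero, bb, hphi0, mul_zero, clp_zero])
    rw [hpow.unique hF]
    ring

end PartR

end WrapR

section WrapS
set_option linter.unusedSectionVars false

section PartS
open Matrix
variable {m : ℕ}

/-- distance to the identity -/
noncomputable def nrm (Q : Mt m) : ℝ := ∑ i, ∑ j, ‖Q i j - (1 : Mt m) i j‖ ^ 2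

theorem nrm_nonneg (Q : Mt m) : 0 ≤ nrm Q := Finset.sum_nonneg fun _ _ => Finset.sum_nonneg fun _ _ => by positivity

theorem nrm_one : nrm (1 : Mt m) = 0 := by simp [nrm]

theorem nrm_entry (Q : Mt m) (i j : Fin (m + 1)) : ‖Q i j - (1 : Mt m) i j‖ ^ 2 ≤ nrm Q := by
  refine le_trans ?_ (Finset.single_le_sum (f := fun i => ∑ j, ‖Q i j - (1 : Mt m) i j‖ ^ 2) (fun _ _ => Finset.sum_nonneg fun _ _ => by positivity) (Finset.mem_univ i))
  exact Finset.single_le_sum (f := fun j => ‖Q i j - (1 : Mt m) i j‖ ^ 2) (fun _ _ => by positivity) (Finset.mem_univ j)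

theorem nrm_cont : Continuous (nrm : Mt m → ℝ) := by
  unfold nrm
  refine continuous_finsetSum _ fun i _ => continuous_finsetSum _ fun j _ => ?_
  have : Continuous fun Q : Mt m => Q i j := continuous_id.matrix_elem i j
  fun_prop

theorem dom_inv {Q : Mt m} {a : ℂ} {e : ℝ} (he : (m + 1) * e < 1 / 2) (hQ : ∀ i j, ‖Q i j - (1 : Mt m) i j‖ ≤ e) (ha : 1 / 2 ≤ ‖a - 1‖) :
    (Q - a • 1).det ≠ 0 := by
  apply det_ne_zero_of_sum_row_lt_diag
  intro k
  have h1 : ∑ j ∈ Finset.univ.erase k, ‖(Q - a • 1) k j‖ ≤ m * e := by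
    have : ∀ j ∈ Finset.univ.erase k, ‖(Q - a • 1) k j‖ ≤ e := by
      intro j hj
      have hj := Finset.ne_of_mem_erase hj
      have := hQ k j
      rw [one_apply_ne hj.symm] at this
      simpa [one_apply_ne hj.symm] using this
    refine (Finset.sum_le_card_nsmul _ _ _ this).trans ?_
    simp
  have h2 : ‖a - 1‖ ≤ ‖(Q - a • 1) k k‖ + e := by
    have := hQ k k
    rw [one_apply_eq] at this
    have h3 : a - 1 = -((Q - a • 1) k k) + (Q k k - 1) := by simp
    rw [h3]
    refine (norm_add_le _ _).trans ?_
    rw [norm_neg]; linarith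
  linarith

theorem scalar_of {Q : Mt m} {c : ℂ} {e : ℝ} (he : (m + 1) * e < 1 / 2) (hQ : ∀ i j, ‖Q i j - (1 : Mt m) i j‖ ≤ e) (hU : Qᴴ * Q = 1)
    (hc : Q - Qᴴ = c • 1) : ∃ b : ℂ, Q = b • 1 := by
  obtain ⟨s, hs⟩ := IsAlgClosed.exists_pow_nat_eq (c ^ 2 + 4) (n := 2) (by norm_num)
  obtain ⟨a, b, hab, hab'⟩ : ∃ a b : ℂ, a + b = c ∧ a * b = -1 := ⟨(c + s) / 2, (c - s) / 2, by ring, by linear_combination (-1/4) * hs⟩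
  have hq : Q * Q = c • Q + 1 := by
    have : Qᴴ = Q - c • 1 := by rw [← hc]; abel
    rw [this, Matrix.sub_mul, Matrix.smul_mul, Matrix.one_mul] at hU
    rw [← hU]; abel
  have key : ∀ a b : ℂ, a + b = c → a * b = -1 → (Q - a • 1) * (Q - b • 1) = 0 := by
    intro a b h1 h2
    simp only [Matrix.mul_sub, Matrix.sub_mul, Matrix.mul_smul, Matrix.smul_mul, Matrix.one_mul, Matrix.mul_one, smul_smul]
    rw [hq, smul_sub, smul_smul, mul_comm b a, h2, ← h1]
    module
  have fin : ∀ a b : ℂ, a + b = c → a * b = -1 → 1 / 2 ≤ ‖a - 1‖ → ∃ b : ℂ, Q = b • 1 := by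
    intro a b h1 h2 h3
    refine ⟨b, ?_⟩
    have h4 := key a b h1 h2
    have h5 : IsUnit (Q - a • 1).det := isUnit_iff_ne_zero.2 (dom_inv he hQ h3)
    have h6 := congrArg ((Q - a • 1)⁻¹ * ·) h4
    simp only [Matrix.mul_zero] at h6
    rw [← Matrix.mul_assoc, nonsing_inv_mul _ h5, Matrix.one_mul] at h6
    exact sub_eq_zero.1 h6
  by_cases h : 1 / 2 ≤ ‖a - 1‖
  · exact fin a b hab hab' h
  · refine fin b a (by rw [add_comm]; exact hab) (by rw [mul_comm]; exact hab') ?_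
    push Not at h
    have h1 : ‖a‖ ≤ 3 / 2 := by
      have := norm_add_le (a - 1) 1
      rw [sub_add_cancel, norm_one] at this; linarith
    have h2 : 3 / 2 ≤ ‖a + 1‖ := by
      have h3 : (2:ℂ) = (a + 1) - (a - 1) := by ring
      have := norm_sub_le (a + 1) (a - 1)
      rw [← h3] at this
      norm_num at this; linarith
    have h3 : ‖a‖ * ‖b - 1‖ = ‖a + 1‖ := by
      rw [← norm_mul, mul_sub, hab', ← norm_neg]; congr 1; ring
    by_contra h4
    push Not at h4
    have := mul_le_mul h1 h4.le (norm_nonneg _) (by norm_num)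
    linarith

theorem isolation (m : ℕ) : ∃ ε : ℝ, 0 < ε ∧ ε ≤ 1 ∧ ∀ (Q : Mt m) (c : ℂ), Qᴴ * Q = 1 → Q.det = 1 → Q - Qᴴ = c • 1 → nrm Q ≤ ε → Q = 1 := by
  have h1 : ∀ᶠ b : ℂ in nhds 1, ∑ i ∈ Finset.range (m + 1), b ^ i ≠ 0 := by
    have hc : Continuous fun b : ℂ => ∑ i ∈ Finset.range (m + 1), b ^ i := by fun_prop
    refine hc.continuousAt.eventually_ne ?_
    simp; exact_mod_cast Nat.succ_ne_zero m
  obtain ⟨r, hr, hb⟩ := Metric.eventually_nhds_iff.1 h1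
  set e : ℝ := min (min (r / 2) (1 / (4 * (m + 1)))) 1 with he
  have he0 : 0 < e := by positivity
  have her : e < r := (min_le_left _ _).trans_lt ((min_le_left _ _).trans_lt (by linarith))
  have hem : (m + 1) * e < 1 / 2 := by
    have : e ≤ 1 / (4 * (m + 1)) := (min_le_left _ _).trans (min_le_right _ _)
    have h2 := mul_le_mul_of_nonneg_left this (by positivity : (0:ℝ) ≤ m + 1)
    have h3 : ((m:ℝ) + 1) * (1 / (4 * (m + 1))) = 1 / 4 := by field_simp
    linarith
  refine ⟨e ^ 2, by positivity, pow_le_one₀ he0.le (min_le_right _ _), ?_⟩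
  intro Q c hU hdet hc hn
  have hQ : ∀ i j, ‖Q i j - (1 : Mt m) i j‖ ≤ e := fun i j =>
    le_of_sq_le_sq ((nrm_entry Q i j).trans hn) he0.le
  obtain ⟨b, rfl⟩ := scalar_of hem hQ hU hc
  have hb1 : b ^ (m + 1) = 1 := by simpa using hdet
  have hbn : ‖b - 1‖ ≤ e := by simpa using hQ 0 0
  have h2 := hb (y := b) (by rw [dist_eq_norm]; linarith)
  have h3 := geom_sum_mul b (m + 1)
  rw [hb1, sub_self] at h3
  rw [sub_eq_zero.1 ((mul_eq_zero.1 h3).resolve_left h2), one_smul]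

end PartS

end WrapS

section WrapT
set_option linter.unusedSectionVars false
section PartT
open Matrix

noncomputable def tt {m : ℕ} (z : Fin m → ℂ) : ℝ := min 1 (max 0 (2 * ‖z‖ - 3))

/-- deformed commutator -/
noncomputable def QQ {m : ℕ} (ζ : ℂ) (K : ℝ → Matrix (Fin m) (Fin m) ℂ → Mt m → Mt m) (τ : ℝ) (X : Matrix (Fin m) (Fin m) ℂ) (v : Mt m) : Mt m :=
  ζ⁻¹ • (blk 1 X * v * (blk 1 X)ᴴ * vᴴ + (K τ X v - K 0 X v))

/-- the output with the quadratic part -/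
noncomputable def OO {m : ℕ} (ε : ℝ) (X : Matrix (Fin m) (Fin m) ℂ) (Q : Mt m) (y : ℂ) : EE m :=
  (fun i j => (X * Xᴴ - 1) i j + (Q - Qᴴ) i.succ j.succ - (Q - Qᴴ) 0 0 * (1 : Matrix (Fin m) (Fin m) ℂ) i j,
    fun k => (Q - Qᴴ) k.succ 0, ((ε - nrm Q - max y.re 0 : ℝ) : ℂ) - (y.im : ℂ) * Complex.I)

noncomputable def HH {m : ℕ} (ζ : ℂ) (L ε : ℝ) (K : ℝ → Matrix (Fin m) (Fin m) ℂ → Mt m → Mt m) (s : ℝ) (x : EE m) : EE m :=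
  OO ε (Matrix.of x.1) (QQ ζ K (max (tt x.2.1) s) (Matrix.of x.1) (vv m L x.2.1 : Mt m)) x.2.2

variable {m : ℕ}

theorem OO_zero {ε : ℝ} {X : Matrix (Fin m) (Fin m) ℂ} {Q : Mt m} {y : ℂ} (h : OO ε X Q y = 0) :
    X * Xᴴ = 1 ∧ Q - Qᴴ = (Q - Qᴴ) 0 0 • 1 ∧ nrm Q + max y.re 0 = ε ∧ y.im = 0 := by
  have h1 := congrArg Prod.fst h
  have h2 := congrArg (fun x => x.2.1) h
  have h3 := congrArg (fun x => x.2.2) h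
  simp only [OO, Prod.fst_zero, Prod.snd_zero] at h1 h2 h3
  have hH : (X * Xᴴ - 1)ᴴ = X * Xᴴ - 1 := by simp
  have h4 : out ((1/2 : ℂ) • (X * Xᴴ - 1)) (Q - Qᴴ) 0 = 0 := by
    refine Prod.ext ?_ (Prod.ext ?_ ?_)
    · refine Eq.trans ?_ h1
      ext i j
      simp only [out, conjTranspose_smul, hH]
      simp
      ring
    · exact h2
    · simp [out]
  obtain ⟨h5, h6, -⟩ := out_zero (by simp) h4
  refine ⟨?_, h6, ?_, ?_⟩
  · rw [conjTranspose_smul, hH, ← add_smul] at h5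
    have : (1/2 + star (1/2) : ℂ) = 1 := by simp; norm_num
    rw [this, one_smul] at h5
    exact sub_eq_zero.1 h5
  · have := congrArg Complex.re h3
    simp at this
    linarith
  · have := congrArg Complex.im h3
    simpa using this

theorem OO_one {ε : ℝ} (hε : 0 < ε) {X : Matrix (Fin m) (Fin m) ℂ} (hX : X * Xᴴ = 1) : OO ε X 1 (ε : ℂ) = 0 := by
  refine Prod.ext ?_ (Prod.ext ?_ ?_)
  · ext i j; simp [OO, hX]
  · ext i; simp [OO]
  · simp only [OO, nrm_one, Complex.ofReal_re, Complex.ofReal_im, max_eq_left hε.le]; simp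

theorem blk_det (X : Matrix (Fin m) (Fin m) ℂ) : (blk 1 X).det = X.det := by
  rw [det_succ_row_zero, Fin.sum_univ_succ]
  have : (blk 1 X).submatrix Fin.succ (Fin.succAbove 0) = X := by ext i j; simp
  simp at this
  simp [this]

/-- hypotheses on the family -/
structure HK (ζ : ℂ) (K : ℝ → Matrix (Fin m) (Fin m) ℂ → Mt m → Mt m) : Prop where
  cont : Continuous fun q : ℝ × Matrix (Fin m) (Fin m) ℂ × Mt m => K q.1 q.2.1 q.2.2
  unit : ∀ τ ∈ Set.Icc (0:ℝ) 1, ∀ X : Matrix (Fin m) (Fin m) ℂ, Xᴴ * X = 1 → ∀ V : Mt m, Vᴴ * V = 1 → V.det = 1 →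
    (K τ X V)ᴴ * K τ X V = 1 ∧ (K τ X V).det = 1
  zero : ∀ X : Matrix (Fin m) (Fin m) ℂ, Xᴴ * X = 1 → ∀ V : Mt m, Vᴴ * V = 1 → V.det = 1 →
    K 0 X V = blk 1 X * V * (blk 1 X)ᴴ * Vᴴ
  one : ∀ X : Matrix (Fin m) (Fin m) ℂ, Xᴴ * X = 1 → ∀ V : Mt m, Vᴴ * V = 1 → V.det = 1 → K 1 X V ≠ ζ • 1
  inv : ∀ τ X V, K τ X (ζ • V) = K τ X V

variable {ζ : ℂ} {K : ℝ → Matrix (Fin m) (Fin m) ℂ → Mt m → Mt m} {L ε : ℝ}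

theorem tt_mem (z : Fin m → ℂ) : tt z ∈ Set.Icc (0:ℝ) 1 := ⟨le_min zero_le_one (le_max_left _ _), min_le_left _ _⟩

theorem tt_max_mem (z : Fin m → ℂ) {s : ℝ} (hs : s ∈ Set.Icc (0:ℝ) 1) : max (tt z) s ∈ Set.Icc (0:ℝ) 1 :=
  ⟨le_max_of_le_right hs.1, max_le (tt_mem z).2 hs.2⟩

theorem tt_cont : Continuous (tt : (Fin m → ℂ) → ℝ) := by unfold tt; fun_prop

theorem tt_zero {z : Fin m → ℂ} (h : ‖z‖ ≤ 3/2) : tt z = 0 := by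
  unfold tt; rw [max_eq_left (by linarith)]; simp

theorem tt_one {z : Fin m → ℂ} (h : 2 ≤ ‖z‖) : tt z = 1 := by
  unfold tt; rw [min_eq_left]; exact le_max_of_le_right (by linarith)

theorem QQ_unit (hζ0 : ζ ≠ 0) (hK : HK ζ K) {τ : ℝ} {X : Matrix (Fin m) (Fin m) ℂ} (hX : Xᴴ * X = 1) {V : Mt m} (hV : Vᴴ * V = 1) (hd : V.det = 1) :
    QQ ζ K τ X V = ζ⁻¹ • K τ X V := by
  rw [QQ, hK.zero X hX V hV hd]; congr 1; abel

theorem HH_zero (hζ1 : ζ ^ (m + 1) = 1) (hζs : star ζ * ζ = 1) (hK : HK ζ K) (hε : 0 < ε)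
    (hiso : ∀ (Q : Mt m) (c : ℂ), Qᴴ * Q = 1 → Q.det = 1 → Q - Qᴴ = c • 1 → nrm Q ≤ ε → Q = 1)
    {s : ℝ} (hs : s ∈ Set.Icc (0:ℝ) 1) {x : EE m} (h : HH ζ L ε K s x = 0) :
    (Matrix.of x.1)ᴴ * Matrix.of x.1 = 1 ∧ QQ ζ K (max (tt x.2.1) s) (Matrix.of x.1) (vv m L x.2.1 : Mt m) = 1 ∧ x.2.2 = ε ∧
      max (tt x.2.1) s ≠ 1 := by
  have hζ0 : ζ ≠ 0 := by rintro rfl; simp at hζs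
  obtain ⟨h1, h2, h3, h4⟩ := OO_zero h
  have hX : (Matrix.of x.1)ᴴ * Matrix.of x.1 = 1 := mul_eq_one_comm.1 h1
  set Q := QQ ζ K (max (tt x.2.1) s) (Matrix.of x.1) (vv m L x.2.1 : Mt m) with hQ
  have hQ' := QQ_unit (τ := max (tt x.2.1) s) hζ0 hK hX (vv_unit L x.2.1) vv_det
  rw [← hQ] at hQ'
  obtain ⟨k1, k2⟩ := hK.unit _ (tt_max_mem x.2.1 hs) _ hX _ (vv_unit L x.2.1) vv_det
  have hQ1 : Q = 1 := by
    refine hiso Q _ ?_ ?_ h2 (by linarith [le_max_right x.2.2.re 0])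
    · rw [hQ', conjTranspose_smul, Matrix.smul_mul, Matrix.mul_smul, k1, smul_smul]
      have : star ζ⁻¹ * ζ⁻¹ = 1 := by
        rw [star_inv₀, ← mul_inv, hζs, inv_one]
      rw [this, one_smul]
    · rw [hQ', det_smul, k2]; simp [hζ1]
  refine ⟨hX, hQ1, ?_, ?_⟩
  · rw [hQ1, nrm_one, zero_add] at h3
    have : x.2.2.re = ε := by
      rcases max_cases x.2.2.re 0 with h | h
      · rw [← h.1]; exact h3
      · rw [h.1] at h3; exact absurd h3 hε.ne
    exact Complex.ext (by simpa using this) (by simpa using h4)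
  · intro hτ
    apply hK.one _ hX _ (vv_unit L x.2.1) vv_det
    rw [hτ] at hQ'
    rw [hQ1] at hQ'
    rw [hQ', smul_smul, mul_inv_cancel₀ hζ0, one_smul]

theorem HH_norm (hε1 : ε ≤ 1) (hε : 0 < ε) {s : ℝ} {x : EE m} (hs : s ≤ 1) 
    (h1 : (Matrix.of x.1)ᴴ * Matrix.of x.1 = 1) (h3 : x.2.2 = ε) (h4 : max (tt x.2.1) s ≠ 1) : ‖x‖ < 3 ∧ s ≠ 1 := by
  have hz : ‖x.2.1‖ < 2 := by
    by_contra h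
    apply h4
    rw [tt_one (not_lt.1 h)]
    exact max_eq_left hs
  refine ⟨?_, ?_⟩
  · rw [Prod.norm_def, Prod.norm_def]
    refine max_lt ?_ (max_lt (by linarith) ?_)
    · refine lt_of_le_of_lt ?_ (show (1:ℝ) < 3 by norm_num)
      refine (pi_norm_le_iff_of_nonneg zero_le_one).2 fun i => (pi_norm_le_iff_of_nonneg zero_le_one).2 fun j => ?_
      exact entry_norm_bound_of_unitary (U := Matrix.of x.1) (Matrix.mem_unitaryGroup_iff'.2 h1) i j
    · rw [h3, Complex.norm_real, Real.norm_of_nonneg hε.le]; linarith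
  · rintro rfl
    exact h4 (max_eq_right (tt_mem _).2)

theorem HH_inv (hL : LP m L) (hm : 0 < m) (hK : HK ζ K) (hζ1 : ζ ^ (m + 1) = 1) (hζs : star ζ * ζ = 1) (s : ℝ) (x : EE m) (i : Fin m) (hi : 1 ≤ ‖x.2.1 i‖) :
    HH ζ L ε K s (x.1, Function.update x.2.1 i (ζ * x.2.1 i), x.2.2) = HH ζ L ε K s x := by
  have hn : ‖ζ‖ = 1 := by
    have := congrArg norm hζs
    rw [norm_mul, norm_star, norm_one] at this
    nlinarith [norm_nonneg ζ]
  have h1 : tt (Function.update x.2.1 i (ζ * x.2.1 i)) = tt x.2.1 := by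
    have : ‖Function.update x.2.1 i (ζ * x.2.1 i)‖ = ‖x.2.1‖ := by
      simp only [Pi.norm_def]
      congr 2
      ext j
      by_cases h : j = i
      · subst h; simp [hn]
      · simp [h]
    rw [tt, this, tt]
  simp only [HH]
  rw [h1, vv_rot hL hm hi hζ1]
  congr 1
  rw [QQ, QQ, hK.inv, hK.inv]
  congr 2
  simp only [conjTranspose_smul, Matrix.mul_smul, Matrix.smul_mul, smul_smul, hζs, one_smul]

theorem HH_cont (hK : HK ζ K) : Continuous (Function.uncurry (HH ζ L ε K)) := by
  have hX : Continuous fun q : ℝ × EE m => (Matrix.of q.2.1 : Matrix (Fin m) (Fin m) ℂ) := by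
    show Continuous fun q : ℝ × EE m => q.2.1
    fun_prop
  have hbX : Continuous fun q : ℝ × EE m => blk 1 (Matrix.of q.2.1 : Matrix (Fin m) (Fin m) ℂ) := by
    refine continuous_matrix fun i j => ?_
    refine Fin.cases ?_ (fun i => ?_) i <;> refine Fin.cases ?_ (fun j => ?_) j
    · exact continuous_const
    · exact continuous_const
    · exact continuous_const
    · exact hX.matrix_elem i j
  have hv : Continuous fun q : ℝ × EE m => (vv m L q.2.2.1 : Mt m) :=
    continuous_subtype_val.comp (vv_cont.comp (by fun_prop))
  have hτ : Continuous fun q : ℝ × EE m => max (tt q.2.2.1) q.1 := by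
    have := tt_cont (m := m)
    fun_prop
  have hQ : Continuous fun q : ℝ × EE m => QQ ζ K (max (tt q.2.2.1) q.1) (Matrix.of q.2.1) (vv m L q.2.2.1 : Mt m) := by
    have k1 := hK.cont.comp (hτ.prodMk (hX.prodMk hv))
    have k0 := hK.cont.comp ((continuous_const (y := (0:ℝ))).prodMk (hX.prodMk hv))
    have k2 := ((hbX.matrix_mul hv).matrix_mul hbX.matrix_conjTranspose).matrix_mul hv.matrix_conjTranspose
    exact (k2.add (k1.sub k0)).const_smul ζ⁻¹
  have hA := hQ.sub hQ.matrix_conjTranspose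
  have hXX := (hX.matrix_mul hX.matrix_conjTranspose).sub (continuous_const (y := (1 : Matrix (Fin m) (Fin m) ℂ)))
  refine Continuous.prodMk ?_ (Continuous.prodMk ?_ ?_)
  · refine continuous_pi fun i => continuous_pi fun j => ?_
    exact ((hXX.matrix_elem i j).add (hA.matrix_elem _ _)).sub ((hA.matrix_elem 0 0).mul continuous_const)
  · exact continuous_pi fun k => hA.matrix_elem _ _
  · have := nrm_cont.comp hQ
    have h2 : Continuous fun q : ℝ × EE m => q.2.2.2 := by fun_prop
    refine Continuous.sub (Complex.continuous_ofReal.comp ((continuous_const.sub this).sub ?_)) (Continuous.mul (Complex.continuous_ofReal.comp (Complex.continuous_im.comp h2)) continuous_const)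
    exact (Complex.continuous_re.comp h2).max continuous_const

end PartT

end WrapT

section WrapV
set_option linter.unusedSectionVars false
section PartV
open Matrix Filter Topology

variable {m : ℕ} {ζ : ℂ} {K : ℝ → Matrix (Fin m) (Fin m) ℂ → Mt m → Mt m} {L ε : ℝ}

/-- undeformed commutator -/
noncomputable def Q0 (ζ : ℂ) (L : ℝ) (x : EE m) : Mt m :=
  ζ⁻¹ • (blk 1 (Matrix.of x.1) * (vv m L x.2.1 : Mt m) * (blk 1 (Matrix.of x.1))ᴴ * (vv m L x.2.1 : Mt m)ᴴ)

/-- local smooth form -/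
noncomputable def HF (ζ : ℂ) (L ε : ℝ) (x : EE m) : EE m :=
  (fun i j => (Matrix.of x.1 * (Matrix.of x.1)ᴴ - 1) i j + (Q0 ζ L x - (Q0 ζ L x)ᴴ) i.succ j.succ
      - (Q0 ζ L x - (Q0 ζ L x)ᴴ) 0 0 * (1 : Matrix (Fin m) (Fin m) ℂ) i j,
    fun k => (Q0 ζ L x - (Q0 ζ L x)ᴴ) k.succ 0, ((ε - nrm (Q0 ζ L x) : ℝ) : ℂ) - x.2.2)

theorem HH_eq_HF {x : EE m} (hz : ‖x.2.1‖ ≤ 3/2) (hy : 0 ≤ x.2.2.re) : HH ζ L ε K 0 x = HF ζ L ε x := by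
  have hQ : QQ ζ K (max (tt x.2.1) 0) (Matrix.of x.1) (vv m L x.2.1 : Mt m) = Q0 ζ L x := by
    rw [tt_zero hz, max_self, QQ, sub_self, add_zero, Q0]
  rw [HH, OO, hQ, HF, max_eq_left hy]
  refine Prod.ext rfl (Prod.ext rfl ?_)
  apply Complex.ext <;> simp

theorem HH_ev {x : EE m} (hz : ‖x.2.1‖ < 3/2) (hy : 0 < x.2.2.re) : HF ζ L ε =ᶠ[𝓝 x] HH ζ L ε K 0 := by
  have h1 : ∀ᶠ y : EE m in 𝓝 x, ‖y.2.1‖ < 3/2 := (isOpen_lt (by fun_prop) continuous_const).mem_nhds hz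
  have h2 : ∀ᶠ y : EE m in 𝓝 x, 0 < y.2.2.re :=
    (isOpen_lt continuous_const (Complex.continuous_re.comp (by fun_prop))).mem_nhds hy
  filter_upwards [h1, h2] with y a b
  exact (HH_eq_HF a.le b.le).symm

theorem Q0_smooth {x : EE m} (hv : MC (fun y => (vv m L y : Mt m)) x.2.1) : MC (fun y : EE m => Q0 ζ L y) x := by
  have h1 : MC (fun y : EE m => (vv m L y.2.1 : Mt m)) x := by
    intro a b
    have h : ContDiffAt ℝ 1 (fun y : EE m => y.2.1) x := by fun_prop
    exact ContDiffAt.comp (g := fun y => (vv m L y : Mt m) a b) x (hv a b) h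
  have h2 : MC (fun y : EE m => blk 1 (Matrix.of y.1)) x := by
    intro i j
    refine Fin.cases ?_ (fun i => ?_) i <;> refine Fin.cases ?_ (fun j => ?_) j
    · exact contDiffAt_const
    · exact contDiffAt_const
    · exact contDiffAt_const
    · show ContDiffAt ℝ 1 (fun y : EE m => y.1 i j) x
      fun_prop
  have h3 := ((h2.mul h1).mul h2.star).mul h1.star
  intro i j
  exact contDiffAt_const.mul (h3 i j)

theorem HF_smooth {x : EE m} (hv : MC (fun y => (vv m L y : Mt m)) x.2.1) : ContDiffAt ℝ 1 (HF ζ L ε) x := by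
  have hQ := Q0_smooth (ζ := ζ) hv
  have hA : ∀ i j, ContDiffAt ℝ 1 (fun y : EE m => (Q0 ζ L y - (Q0 ζ L y)ᴴ) i j) x := fun i j => (hQ i j).sub (hQ.star i j)
  have hX : ∀ i j, ContDiffAt ℝ 1 (fun y : EE m => y.1 i j) x := fun i j => by fun_prop
  refine ContDiffAt.prodMk ?_ (ContDiffAt.prodMk ?_ ?_)
  · refine contDiffAt_pi.2 fun i => contDiffAt_pi.2 fun j => ?_
    refine ContDiffAt.sub (ContDiffAt.add ?_ (hA _ _)) ((hA 0 0).mul contDiffAt_const)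
    simp only [Matrix.sub_apply, mul_apply, conjTranspose_apply, of_apply]
    exact ContDiffAt.sub (ContDiffAt.sum fun l _ => (hX i l).mul (contDiffAt_star (hX j l))) contDiffAt_const
  · exact contDiffAt_pi.2 fun k => hA _ _
  · refine ContDiffAt.sub ?_ (by fun_prop)
    have hn : ContDiffAt ℝ 1 (fun y : EE m => ε - nrm (Q0 ζ L y)) x := by
      refine contDiffAt_const.sub ?_
      unfold nrm
      exact ContDiffAt.sum fun i _ => ContDiffAt.sum fun j _ => ((hQ i j).sub contDiffAt_const).norm_sq ℝ
    exact ContDiffAt.comp x (Complex.ofRealCLM.contDiff.contDiffAt) hn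

theorem nrm_deriv {Q : ℝ → Mt m} {Q' : Mt m} (h : MD Q Q') (h0 : Q 0 = 1) : HasDerivAt (fun s => nrm (Q s)) 0 0 := by
  unfold nrm
  have : HasDerivAt (fun s => ∑ i, ∑ j, ‖Q s i j - (1 : Mt m) i j‖ ^ 2) (∑ i : Fin (m+1), ∑ j : Fin (m+1), (0:ℝ)) 0 := by
    refine HasDerivAt.fun_sum fun i _ => HasDerivAt.fun_sum fun j _ => ?_
    have := ((h i j).sub_const ((1 : Mt m) i j)).norm_sq
    simpa [h0] using this
  simpa using this

theorem HF_deriv (hζ : ζ ≠ 0) {x : EE m} (hX : (Matrix.of x.1)ᴴ * Matrix.of x.1 = 1) (hQ : Q0 ζ L x = 1) {δ : EE m} {w : Mt m}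
    (hw : MD (fun s : ℝ => (vv m L (x.2.1 + s • δ.2.1) : Mt m)) w) :
    HasDerivAt (fun s : ℝ => HF ζ L ε (x + s • δ))
      (out (Matrix.of δ.1 * (Matrix.of x.1)ᴴ) (nn (vv m L x.2.1) (Matrix.of δ.1 * (Matrix.of x.1)ᴴ)
        (TH (blk 1 (Matrix.of x.1)) (w * (vv m L x.2.1 : Mt m)ᴴ))) δ.2.2) 0 := by
  have hv0 : (vv m L (x.2.1 + (0:ℝ) • δ.2.1) : Mt m) = vv m L x.2.1 := by simp
  have hh : ζ⁻¹ • (blk 1 (Matrix.of x.1) * (vv m L (x.2.1 + (0:ℝ) • δ.2.1) : Mt m) * (blk 1 (Matrix.of x.1))ᴴ * (vv m L (x.2.1 + (0:ℝ) • δ.2.1) : Mt m)ᴴ) = 1 := by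
    rw [hv0]; exact hQ
  have hA := dA (D := Matrix.of δ.1) hζ hX (fun s => vv_unit' L _) hw hh
  have hQd := dQ (D := Matrix.of δ.1) hζ hX (fun s => vv_unit' L _) hw hh
  have eq0 : ∀ s : ℝ, ζ⁻¹ • (blk 1 (Matrix.of x.1 + s • Matrix.of δ.1) * (vv m L (x.2.1 + s • δ.2.1) : Mt m) * (blk 1 (Matrix.of x.1 + s • Matrix.of δ.1))ᴴ * (vv m L (x.2.1 + s • δ.2.1) : Mt m)ᴴ)
     = Q0 ζ L (x + s • δ) := fun s => rfl
  simp only [eq0] at hA hQd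
  rw [hv0] at hA
  have hn := nrm_deriv hQd (by simpa using hQ)
  refine HasDerivAt.prodMk ?_ (HasDerivAt.prodMk ?_ ?_)
  · refine hasDerivAt_pi.2 fun i => hasDerivAt_pi.2 fun j => ?_
    refine HasDerivAt.sub (HasDerivAt.add ?_ (hA _ _)) ((hA 0 0).mul_const _)
    have hl : ∀ a b, HasDerivAt (fun s : ℝ => x.1 a b + s • δ.1 a b) (δ.1 a b) 0 := by
      intro a b
      have := ((hasDerivAt_id (0:ℝ)).smul_const (δ.1 a b)).const_add (x.1 a b)
      simpa using this
    have h1 : HasDerivAt (fun s : ℝ => ∑ l, (x.1 i l + s • δ.1 i l) * star (x.1 j l + s • δ.1 j l) - (1 : Matrix (Fin m) (Fin m) ℂ) i j)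
        (∑ l, (δ.1 i l * star (x.1 j l) + x.1 i l * star (δ.1 j l))) 0 := by
      refine HasDerivAt.sub_const _ (HasDerivAt.fun_sum fun l _ => ?_)
      have := (hl i l).fun_mul (hl j l).star
      refine this.congr_deriv ?_
      simp
    refine h1.congr_deriv ?_
    rw [Finset.sum_add_distrib]
    simp only [Matrix.add_apply, conjTranspose_mul, conjTranspose_conjTranspose, mul_apply, conjTranspose_apply, of_apply]
  · exact hasDerivAt_pi.2 fun k => hA _ _
  · have h1 : HasDerivAt (fun s : ℝ => ((ε - nrm (Q0 ζ L (x + s • δ)) : ℝ) : ℂ)) ((-0 : ℝ) : ℂ) 0 :=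
      (hn.const_sub ε).ofReal_comp
    have h2 : HasDerivAt (fun s : ℝ => x.2.2 + s • δ.2.2) δ.2.2 0 := by
      have := ((hasDerivAt_id (0:ℝ)).smul_const (δ.2.2)).const_add (x.2.2)
      simpa using this
    have := h1.fun_sub h2
    refine this.congr_deriv ?_
    simp

theorem HH_strict (hL : LP m L) (hζ : ζ ≠ 0) (hζp : ∀ n, 1 ≤ n → n ≤ m → ζ ^ n ≠ 1) (hε : 0 < ε) {x : EE m}
    (hX : (Matrix.of x.1)ᴴ * Matrix.of x.1 = 1) (hQ : Q0 ζ L x = 1) (hy : x.2.2 = ε) (hc : Cyc (vv m L x.2.1 : Mt m))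
    (σ : Equiv.Perm (Fin m)) (hσ : ∀ i, phi (σ i) (x.2.1 i) = 0) :
    ∃ A : EE m →L[ℝ] EE m, HasStrictFDerivAt (HH ζ L ε K 0) A x ∧ 0 < LinearMap.det (MM (SH m)) * A.det := by
  have hz : ‖x.2.1‖ < 3/2 := by
    refine lt_of_le_of_lt ((pi_norm_le_iff_of_nonneg (by norm_num : (0:ℝ) ≤ 1)).2 fun i => ?_) (by norm_num)
    rw [phi_zero_norm (hσ i)]
    linarith [xk_lt (σ i)]
  have hv := vv_smooth hL σ hσ
  have hs : HasStrictFDerivAt (HF ζ L ε) (fderiv ℝ (HF ζ L ε) x) x := (HF_smooth hv).hasStrictFDerivAt one_ne_zero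
  refine ⟨_, hs.congr_of_eventuallyEq (HH_ev hz (by rw [hy]; simpa using hε)), ?_⟩
  obtain ⟨c, hc0, hcd⟩ := vv_deriv hL σ hσ
  let w : (Fin m → ℂ) → Mt m := fun δ => Matrix.of fun i j => fderiv ℝ (fun y => (vv m L y : Mt m) i j) x.2.1 δ
  have hw : ∀ δ, MD (fun s : ℝ => (vv m L (x.2.1 + s • δ) : Mt m)) (w δ) := by
    intro δ i j
    exact (((hv i j).differentiableAt one_ne_zero).hasFDerivAt.hasLineDerivAt δ)
  have hv0 : ∀ δ, (vv m L (x.2.1 + (0:ℝ) • δ) : Mt m) = vv m L x.2.1 := by simp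
  refine sign3 (vv_unit L x.2.1) hc hX σ (fun k => 2 * ((ζ⁻¹) ^ (k.val + 1) - 1) * c k) ?_ _
    (fun δ => TH (blk 1 (Matrix.of x.1)) (w δ * (vv m L x.2.1 : Mt m)ᴴ)) ?_ ?_ ?_ ?_
  · intro k
    refine mul_ne_zero (mul_ne_zero two_ne_zero ?_) (hc0 k)
    rw [inv_pow, sub_ne_zero]
    intro h
    exact hζp (k.val + 1) (by omega) (by omega) (inv_eq_one.1 h)
  · intro δ
    apply TH_star
    have := om_star (fun s => vv_unit' L (x.2.1 + s • δ)) (hw δ)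
    rwa [hv0] at this
  · intro δ k hk
    rw [tau_TH hζ hX (vv_unit L x.2.1) hQ, hcd δ k hk _ (hw δ)]; ring
  · have : w 0 = 0 := by ext i j; simp [w]
    simp [this, TH]
  · intro δ
    have h1 : HasLineDerivAt ℝ (HF ζ L ε) _ x δ := hs.hasFDerivAt.hasLineDerivAt δ
    exact HasDerivAt.unique h1 (HF_deriv hζ hX hQ (hw δ.2.1))

end PartV

end WrapV

section WrapW
set_option linter.unusedSectionVars false
section PartW
open Matrix Filter Topology

variable {m : ℕ} {ζ : ℂ} {K : ℝ → Matrix (Fin m) (Fin m) ℂ → Mt m → Mt m} {L ε : ℝ}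

/-- zeros of phi k -/
noncomputable def ZZ (k : ℕ) : Finset ℂ := (Polynomial.nthRoots (k + 1) ((xk k : ℂ) ^ (k + 1))).toFinset

theorem mem_ZZ (k : ℕ) (z : ℂ) : z ∈ ZZ k ↔ phi k z = 0 := by
  rw [ZZ, Multiset.mem_toFinset, Polynomial.mem_nthRoots (Nat.succ_pos k), phi_zero_iff]

theorem card_ZZ (k : ℕ) : (ZZ k).card = k + 1 := by
  have hx : (xk k : ℂ) ≠ 0 := by exact_mod_cast (xk_pos k).ne'
  have hx2 : (xk k : ℂ) ^ (k + 1) ≠ 0 := pow_ne_zero _ hx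
  obtain ⟨μ, hμ⟩ : ∃ μ : ℂ, IsPrimitiveRoot μ (k + 1) := ⟨_, Complex.isPrimitiveRoot_exp (k + 1) (by omega)⟩
  have h1 : (Polynomial.nthRoots (k + 1) ((xk k : ℂ) ^ (k + 1))).Nodup := hμ.nthRoots_nodup hx2
  rw [ZZ, Multiset.toFinset_card_of_nodup h1, hμ.card_nthRoots, if_pos ⟨_, rfl⟩]

open Classical in
/-- all zeros in the z variables -/
noncomputable def P0 (m : ℕ) : Finset (Fin m → ℂ) :=
  Finset.univ.biUnion fun σ : Equiv.Perm (Fin m) => Fintype.piFinset fun i => ZZ (σ i)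

theorem mem_P0 (z : Fin m → ℂ) : z ∈ P0 m ↔ ∃ σ : Equiv.Perm (Fin m), ∀ i, phi (σ i) (z i) = 0 := by
  simp only [P0, Finset.mem_biUnion, Finset.mem_univ, true_and, Fintype.mem_piFinset, mem_ZZ]

theorem card_P0 : (P0 m).card = m.factorial * m.factorial := by
  classical
  rw [P0, Finset.card_biUnion]
  · have : ∀ σ : Equiv.Perm (Fin m), (Fintype.piFinset fun i => ZZ (σ i)).card = m.factorial := by
      intro σ
      rw [Fintype.card_piFinset]
      simp only [card_ZZ]
      rw [Equiv.prod_comp σ (fun i : Fin m => (i : ℕ) + 1), Fin.prod_univ_eq_prod_range (fun i => i + 1) m, Finset.prod_range_add_one_eq_factorial]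
    simp [this, Finset.card_univ, Fintype.card_perm]
  · intro σ _ τ _ hne
    simp only [Function.onFun]
    rw [Finset.disjoint_left]
    intro z h1 h2
    rw [Fintype.mem_piFinset] at h1 h2
    apply hne
    ext i
    have a := phi_zero_norm ((mem_ZZ _ _).1 (h1 i))
    have b := phi_zero_norm ((mem_ZZ _ _).1 (h2 i))
    exact xk_inj (a.symm.trans b)

/-- lower block -/
noncomputable def XL (ζ : ℂ) (v : Mt m) : Matrix (Fin m) (Fin m) ℂ := (XX ζ v).submatrix Fin.succ Fin.succ

theorem XX_blk {v : Mt m} (hv : vᴴ * v = 1) (hc : Cyc v) (hζs : star ζ * ζ = 1) : XX ζ v = blk 1 (XL ζ v) := by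
  have h0 : XX ζ v *ᵥ ee m 0 = ee m 0 := by
    have := XX_cc (ζ := ζ) hv hc 0 (by omega)
    simpa [cc] using this
  have hU := XX_unit hv hc hζs
  have hU' : (XX ζ v)ᴴ * XX ζ v = 1 := mul_eq_one_comm.1 hU
  have h1 : (XX ζ v)ᴴ *ᵥ ee m 0 = ee m 0 := by
    have := congrArg ((XX ζ v)ᴴ *ᵥ ·) h0
    simp only [mulVec_mulVec, hU', one_mulVec] at this
    exact this.symm
  have e : ∀ (M : Mt m) i, (M *ᵥ ee m 0) i = M i 0 := by
    intro M i
    simp [ee_eq]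
  have c0 : ∀ i, XX ζ v i 0 = ee m 0 i := fun i => by rw [← e (XX ζ v) i, h0]
  have c1 : ∀ i, star (XX ζ v 0 i) = ee m 0 i := fun i => by
    have := e (XX ζ v)ᴴ i
    rw [h1] at this
    exact this.symm
  have e0 : ee m 0 0 = 1 := by simp [ee_eq]
  have e1 : ∀ j : Fin m, ee m 0 j.succ = 0 := by simp [ee_eq]
  apply blk_ext
  · rw [c0, e0, blk_00]
  · intro j
    have := c1 j.succ
    rw [e1, star_eq_zero] at this
    rw [this, blk_0s]
  · intro j
    rw [c0, e1, blk_s0]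
  · intro i j
    rfl

theorem Q0_one_iff {x : EE m} (hζ1 : ζ ^ (m + 1) = 1) (hζp : ∀ n, 1 ≤ n → n ≤ m → ζ ^ n ≠ 1) (hζs : star ζ * ζ = 1) :
    ((Matrix.of x.1)ᴴ * Matrix.of x.1 = 1 ∧ Q0 ζ L x = 1) ↔ (Cyc (vv m L x.2.1 : Mt m) ∧ Matrix.of x.1 = XL ζ (vv m L x.2.1 : Mt m)) := by
  have hζ0 : ζ ≠ 0 := by rintro rfl; simp at hζs
  constructor
  · rintro ⟨h1, h2⟩
    have hb : (blk 1 (Matrix.of x.1))ᴴ * blk 1 (Matrix.of x.1) = 1 := by rw [blk_star, blk_mul, h1, star_one, one_mul, blk_one]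
    obtain ⟨c1, -⟩ := comm_rel hζ0 hb (vv_unit L x.2.1) h2
    have hc := comm_cyc hζp c1 (by rw [blk_ee, one_smul]) (by rw [ee_blk, one_smul])
    refine ⟨hc, ?_⟩
    have := comm_uniq (vv_unit L x.2.1) hc c1 (by rw [blk_ee, one_smul])
    rw [XX_blk (vv_unit L x.2.1) hc hζs] at this
    exact blk_inj this
  · rintro ⟨hc, hX⟩
    have hb := XX_blk (vv_unit L x.2.1) hc hζs
    rw [← hX] at hb
    have hU := XX_unit (vv_unit L x.2.1) hc hζs
    have hC := XX_comm (vv_unit L x.2.1) hc hζ1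
    rw [hb] at hU hC
    refine ⟨?_, ?_⟩
    · have : blk 1 ((Matrix.of x.1)ᴴ * Matrix.of x.1) = blk 1 1 := by
        rw [blk_one, ← mul_eq_one_comm.1 hU, blk_star, blk_mul, star_one, one_mul]
      exact blk_inj this
    · rw [Q0, hC, Matrix.smul_mul, Matrix.smul_mul, smul_smul, inv_mul_cancel₀ hζ0, one_smul, Matrix.mul_assoc (vv m L x.2.1 : Mt m), hU, Matrix.mul_one, vv_unit']

/-- the rotation -/
noncomputable def rot (ζ : ℂ) (i : Fin m) : EE m →L[ℝ] EE m :=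
  LinearMap.toContinuousLinearMap
  { toFun := fun x => (x.1, fun j => (if j = i then ζ else 1) * x.2.1 j, x.2.2)
    map_add' := by
      intro x y
      refine Prod.ext rfl (Prod.ext ?_ rfl)
      ext j; simp [mul_add]
    map_smul' := by
      intro c x
      refine Prod.ext rfl (Prod.ext ?_ rfl)
      ext j; exact mul_smul_comm c _ (x.2.1 j) }

theorem rot_apply (ζ : ℂ) (i : Fin m) (x : EE m) : rot ζ i x = (x.1, fun j => (if j = i then ζ else 1) * x.2.1 j, x.2.2) := rfl

theorem rot_eq (ζ : ℂ) (i : Fin m) (x : EE m) : rot ζ i x = (x.1, Function.update x.2.1 i (ζ * x.2.1 i), x.2.2) := by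
  rw [rot_apply]
  refine Prod.ext rfl (Prod.ext ?_ rfl)
  ext j
  by_cases h : j = i
  · subst h; simp
  · simp [h]

theorem rot_pow (ζ : ℂ) (i : Fin m) (n : ℕ) (x : EE m) : (rot ζ i ^ n) x = (x.1, fun j => (if j = i then ζ else 1) ^ n * x.2.1 j, x.2.2) := by
  induction n with
  | zero => simp
  | succ n ih =>
    rw [pow_succ', ContinuousLinearMap.mul_apply, ih, rot_apply]
    refine Prod.ext rfl (Prod.ext ?_ rfl)
    ext j; simp only; ring

theorem core (hm : 0 < m) (hp : (m + 1).Prime) (hodd : Odd (m + 1)) (hζ : IsPrimitiveRoot ζ (m + 1)) (hK : HK ζ K) : False := by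
  have hζ1 := hζ.pow_eq_one
  have hn : ‖ζ‖ = 1 := hζ.norm'_eq_one (by omega)
  have hζs : star ζ * ζ = 1 := by
    rw [Complex.star_def, ← Complex.normSq_eq_conj_mul_self, Complex.normSq_eq_norm_sq, hn]; simp
  have hζ0 : ζ ≠ 0 := by rintro rfl; simp at hζs
  have hζp : ∀ n, 1 ≤ n → n ≤ m → ζ ^ n ≠ 1 := fun n h1 h2 h => hζ.pow_ne_one_of_pos_of_lt (by omega) (by omega) h
  have hζne : ζ ≠ 1 := by have := hζp 1 le_rfl hm; simpa using this
  obtain ⟨L, hL⟩ := exists_LP m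
  obtain ⟨ε, hε, hε1, hiso⟩ := isolation m
  let pt : (Fin m → ℂ) → EE m := fun z => (XL ζ (vv m L z : Mt m), z, (ε : ℂ))
  have hpt : Function.Injective pt := fun a b h => congrArg (fun x => x.2.1) h
  classical
  let P : Finset (EE m) := (P0 m).image pt
  have hPmem : ∀ x ∈ P, (Matrix.of x.1)ᴴ * Matrix.of x.1 = 1 ∧ Q0 ζ L x = 1 ∧ x.2.2 = ε ∧ Cyc (vv m L x.2.1 : Mt m) ∧
      ∃ σ : Equiv.Perm (Fin m), ∀ i, phi (σ i) (x.2.1 i) = 0 := by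
    intro x hx
    obtain ⟨z, hz, rfl⟩ := Finset.mem_image.1 hx
    have hσ := (mem_P0 z).1 hz
    have hc := (cyc_iff hL hm z).2 hσ
    have := (Q0_one_iff (L := L) (x := pt z) hζ1 hζp hζs).2 ⟨hc, rfl⟩
    exact ⟨this.1, this.2, rfl, hc, hσ⟩
  have hPz : ∀ x ∈ P, ∀ i, ‖x.2.1 i‖ < 1/2 := by
    intro x hx i
    obtain ⟨-, -, -, -, σ, hσ⟩ := hPmem x hx
    rw [phi_zero_norm (hσ i)]; exact xk_lt _
  have hPn : ∀ x ∈ P, ‖x.2.1‖ ≤ 3/2 := by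
    intro x hx
    refine (pi_norm_le_iff_of_nonneg (by norm_num)).2 fun i => ?_
    linarith [hPz x hx i]
  have hLex : ∀ x : EE m, ∃ A : EE m →L[ℝ] EE m, x ∈ P → HasStrictFDerivAt (HH ζ L ε K 0) A x ∧ 0 < LinearMap.det (MM (SH m)) * A.det := by
    intro x
    by_cases hx : x ∈ P
    · obtain ⟨a, b, c, d, σ, hσ⟩ := hPmem x hx
      obtain ⟨A, hA⟩ := HH_strict (K := K) hL hζ0 hζp hε a b c d σ hσ
      exact ⟨A, fun _ => hA⟩
    · exact ⟨0, fun h => absurd h hx⟩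
  choose LL hLL using hLex
  have hnt : Nontrivial (EE m) := ⟨0, (0, 0, 1), fun h => by
    have := congrArg (fun x => x.2.2) h
    simp at this⟩
  have main := thmD hp hodd (E := EE m) (m := m) (rot ζ) ?_ ?_ (fun i x => ‖x.2.1 i‖) ?_ ?_ ?_
    (fun x => ∑ i, ∑ j, ‖x.1 i j‖ ^ 2 + ∑ i, ‖x.2.1 i‖ ^ 2 + ‖x.2.2‖ ^ 2) ?_ ?_ ?_ ?_
    (HH ζ L ε K) (HH_cont hK) (R := 3) (by norm_num) ?_ ?_ ?_ P ?_ ?_ ?_ LL ?_ ?_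
  · rw [Finset.card_image_of_injective _ hpt, card_P0, hp.dvd_mul, or_self, hp.dvd_factorial] at main
    omega
  · intro i
    refine ContinuousLinearMap.ext fun x => ?_
    rw [rot_pow]
    refine Prod.ext rfl (Prod.ext ?_ rfl)
    ext j
    by_cases h : j = i <;> simp [h, hζ1]
  · intro i x
    rw [rot_apply, Prod.norm_def, Prod.norm_def, Prod.norm_def, Prod.norm_def]
    congr 2
    simp only [Pi.norm_def]
    congr 2
    ext j
    by_cases h : j = i <;> simp [h, hn]
  · intro i
    refine LipschitzWith.of_dist_le_mul fun x y => ?_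
    rw [NNReal.coe_one, one_mul, dist_eq_norm, Real.norm_eq_abs]
    refine (abs_norm_sub_norm_le _ _).trans ?_
    rw [dist_eq_norm]
    refine (norm_le_pi_norm (x.2.1 - y.2.1) i).trans ?_
    exact (norm_fst_le (x - y).2).trans (norm_snd_le (x - y))
  · intro i j x
    simp only [rot_apply]
    by_cases h : j = i <;> simp [h, hn]
  · intro i x hx
    have := congrFun (congrArg (fun x => x.2.1) hx) i
    simp only [rot_apply, if_true] at this
    have h0 : (ζ - 1) * x.2.1 i = 0 := by rw [sub_mul, this, one_mul, sub_self]
    rcases mul_eq_zero.1 h0 with h | h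
    · exact absurd (sub_eq_zero.1 h) hζne
    · simp only [h, norm_zero, le_refl]
  · refine ContDiff.add (ContDiff.add (ContDiff.sum fun i _ => ContDiff.sum fun j _ => ContDiff.norm_sq ℝ ?_) (ContDiff.sum fun i _ => ContDiff.norm_sq ℝ ?_)) (ContDiff.norm_sq ℝ ?_) <;> fun_prop
  · simp
  · intro x
    have a1 : ‖x.1‖ ^ 2 ≤ ∑ i, ∑ j, ‖x.1 i j‖ ^ 2 := by
      rw [← Real.le_sqrt (norm_nonneg _) (by positivity)]
      refine (pi_norm_le_iff_of_nonneg (Real.sqrt_nonneg _)).2 fun i => (pi_norm_le_iff_of_nonneg (Real.sqrt_nonneg _)).2 fun j => ?_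
      rw [Real.le_sqrt (norm_nonneg _) (by positivity)]
      refine le_trans ?_ (Finset.single_le_sum (f := fun i => ∑ j, ‖x.1 i j‖ ^ 2) (fun _ _ => by positivity) (Finset.mem_univ i))
      exact Finset.single_le_sum (f := fun j => ‖x.1 i j‖ ^ 2) (fun _ _ => by positivity) (Finset.mem_univ j)
    have a2 : ‖x.2.1‖ ^ 2 ≤ ∑ i, ‖x.2.1 i‖ ^ 2 := by
      rw [← Real.le_sqrt (norm_nonneg _) (by positivity)]
      refine (pi_norm_le_iff_of_nonneg (Real.sqrt_nonneg _)).2 fun i => ?_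
      rw [Real.le_sqrt (norm_nonneg _) (by positivity)]
      exact Finset.single_le_sum (f := fun i => ‖x.2.1 i‖ ^ 2) (fun _ _ => by positivity) (Finset.mem_univ i)
    have b1 : 0 ≤ ‖x.1‖ ^ 2 := by positivity
    have b2 : 0 ≤ ‖x.2.1‖ ^ 2 := by positivity
    have b3 : 0 ≤ ‖x.2.2‖ ^ 2 := by positivity
    rw [Prod.norm_def, Prod.norm_def]
    rcases max_choice ‖x.1‖ (max ‖x.2.1‖ ‖x.2.2‖) with h | h
    · rw [h]; linarith
    · rw [h]
      rcases max_choice ‖x.2.1‖ ‖x.2.2‖ with h | h <;> rw [h] <;> linarith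
  · intro i x
    simp only [rot_apply]
    congr 2
    refine Finset.sum_congr rfl fun j _ => ?_
    by_cases h : j = i <;> simp [h, hn]
  · intro s hs x hx h
    obtain ⟨a, b, c, d⟩ := HH_zero hζ1 hζs hK hε hiso hs h
    exact absurd (HH_norm hε1 hε hs.2 a c d).1 (not_lt.2 hx)
  · intro x h
    obtain ⟨a, b, c, d⟩ := HH_zero hζ1 hζs hK hε hiso ⟨zero_le_one, le_rfl⟩ h
    exact (HH_norm hε1 hε le_rfl a c d).2 rfl
  · intro i x hx
    rw [rot_eq]
    exact HH_inv hL hm hK hζ1 hζs 0 x i hx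
  · intro x hx h
    obtain ⟨a, b, c, d⟩ := HH_zero hζ1 hζs hK hε hiso ⟨le_rfl, zero_le_one⟩ h
    have hz : ‖x.2.1‖ ≤ 3/2 := (pi_norm_le_iff_of_nonneg (by norm_num)).2 fun i => (hx i).trans (by norm_num)
    rw [tt_zero hz, max_self, QQ, sub_self, add_zero] at b
    obtain ⟨e, g⟩ := (Q0_one_iff (L := L) (x := x) hζ1 hζp hζs).1 ⟨a, b⟩
    refine Finset.mem_image.2 ⟨x.2.1, (mem_P0 _).2 ((cyc_iff hL hm _).1 e), ?_⟩
    exact Prod.ext g.symm (Prod.ext rfl c.symm)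
  · intro x hx
    obtain ⟨a, b, c, -⟩ := hPmem x hx
    have : QQ ζ K (max (tt x.2.1) 0) (Matrix.of x.1) (vv m L x.2.1 : Mt m) = 1 := by
      rw [tt_zero (hPn x hx), max_self, QQ, sub_self, add_zero]; exact b
    rw [HH, this, c]
    exact OO_one hε (mul_eq_one_comm.1 a)
  · intro x hx i
    have := hPz x hx i
    linarith
  · intro x hx
    exact (hLL x hx).1
  · rcases lt_trichotomy (LinearMap.det (MM (SH m))) 0 with h | h | h
    · right
      intro x hx
      have := (hLL x hx).2
      by_contra h2
      exact absurd this (not_lt.2 (mul_nonpos_of_nonpos_of_nonneg h.le (not_lt.1 h2)))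
    · left
      intro x hx
      have := (hLL x hx).2
      rw [h, zero_mul] at this
      exact absurd this (lt_irrefl _)
    · left
      intro x hx
      exact pos_of_mul_pos_right (hLL x hx).2 h.le

end PartW

end WrapW

section WrapX
set_option linter.unusedSectionVars false
section PartX
open Matrix Filter Topology

variable {m : ℕ}

theorem exists_rot (U : Mt m) : ∃ θ : ℝ, (-1 : ℂ) ∉ spectrum ℂ (Complex.exp (θ * Complex.I) • U) := by
  have h1 : (Metric.sphere (0:ℂ) 1).Infinite := by
    apply IsPreconnected.infinite_of_nontrivial (isPreconnected_sphere (by rw [Complex.rank_real_complex]; norm_num) 0 1)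
    exact ⟨1, by simp, -1, by simp, by norm_num⟩
  obtain ⟨w, hw, hw2⟩ := h1.exists_notMem_finite (Matrix.finite_spectrum U)
  have hw1 : ‖w‖ = 1 := by simpa using hw
  have hw0 : w ≠ 0 := by rintro rfl; simp at hw1
  refine ⟨Complex.arg (-w⁻¹), ?_⟩
  have he : Complex.exp (Complex.arg (-w⁻¹) * Complex.I) = -w⁻¹ := by
    have := Complex.norm_mul_exp_arg_mul_I (-w⁻¹)
    rwa [norm_neg, norm_inv, hw1, inv_one, Complex.ofReal_one, one_mul] at this
  rw [he]
  intro h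
  apply hw2
  rw [spectrum.mem_iff] at h ⊢
  intro h3
  apply h
  have h4 : algebraMap ℂ (Mt m) (-1) - -w⁻¹ • U = (-w⁻¹) • (algebraMap ℂ (Mt m) w - U) := by
    rw [Algebra.algebraMap_eq_smul_one, Algebra.algebraMap_eq_smul_one, smul_sub, smul_smul, neg_mul, inv_mul_cancel₀ hw0]
  rw [h4]
  have : IsUnit (-w⁻¹) := by simpa using hw0
  obtain ⟨u, hu⟩ := this
  obtain ⟨a, ha⟩ := h3
  rw [← ha, ← hu]
  exact ⟨u • a, rfl⟩

open scoped Matrix.Norms.L2Operator in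
theorem joined_aux (u : UU m) (h : (-1:ℂ) ∉ spectrum ℂ (u : Mt m)) :
    @Joined (UU m) instTopologicalSpaceSubtype 1 u :=
  Unitary.joined 1 u ((Unitary.norm_sub_one_lt_two_iff u.2).2 h)

theorem det_unit {M : Mt m} (h : Mᴴ * M = 1) : star M.det * M.det = 1 := by
  have := congrArg Matrix.det h
  rwa [det_mul, det_conjTranspose, det_one] at this

theorem exists_path (U : Mt m) (hU : Uᴴ * U = 1) (hd : U.det = 1) :
    ∃ γ : ℝ → Mt m, Continuous γ ∧ (∀ t, (γ t)ᴴ * γ t = 1) ∧ (∀ t, (γ t).det = 1) ∧ γ 0 = 1 ∧ γ 1 = U := by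
  obtain ⟨θ, hθ⟩ := exists_rot U
  have hexp : ∀ t : ℝ, star (Complex.exp (t * Complex.I)) * Complex.exp (t * Complex.I) = 1 := by
    intro t
    rw [Complex.star_def, ← Complex.normSq_eq_conj_mul_self, Complex.normSq_eq_norm_sq, Complex.norm_exp_ofReal_mul_I]; simp
  have hu : (Complex.exp (θ * Complex.I) • U) ∈ unitaryGroup (Fin (m+1)) ℂ := by
    rw [mem_unitaryGroup_iff', star_eq_conjTranspose, conjTranspose_smul, Matrix.smul_mul, Matrix.mul_smul, smul_smul, hU, hexp, one_smul]
  obtain ⟨γ⟩ := joined_aux ⟨_, hu⟩ hθ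
  let a : ℝ → Mt m := fun t => Complex.exp (((-θ * t : ℝ) : ℂ) * Complex.I) • (γ.extend t : Mt m)
  have ha : Continuous a := by
    have h1 : Continuous fun t => (γ.extend t : Mt m) := continuous_subtype_val.comp γ.extend.continuous
    have h2 : Continuous fun t : ℝ => Complex.exp (((-θ * t : ℝ) : ℂ) * Complex.I) := by fun_prop
    exact h2.smul h1
  have hau : ∀ t, (a t)ᴴ * a t = 1 := by
    intro t
    have h1 : ((γ.extend t : UU m) : Mt m)ᴴ * (γ.extend t : Mt m) = 1 := mem_unitaryGroup_iff'.1 (γ.extend t).2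
    simp only [a]
    rw [conjTranspose_smul, Matrix.smul_mul, Matrix.mul_smul, smul_smul, h1, hexp, one_smul]
  have ha0 : a 0 = 1 := by simp [a]
  have ha1 : a 1 = U := by
    simp only [a, γ.extend_one, smul_smul, ← Complex.exp_add]
    simp
  let d : ℝ → Mt m := fun t => diagonal fun i => if i = 0 then star (a t).det else 1
  have hdc : Continuous d := by
    refine Continuous.matrix_diagonal (continuous_pi fun i => ?_)
    by_cases h : i = 0
    · simp only [h, if_true]
      exact ha.matrix_det.star
    · simp only [h, if_false]; exact continuous_const
  have hdu : ∀ t, (d t)ᴴ * d t = 1 := by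
    intro t
    simp only [d]
    rw [diagonal_conjTranspose, diagonal_mul_diagonal, ← diagonal_one]
    congr 1; ext i
    have := det_unit (hau t)
    by_cases h : i = 0
    · simp only [Pi.star_apply, h, if_true, star_star]; rw [mul_comm]; exact this
    · simp [h]
  have hdd : ∀ t, (d t).det = star (a t).det := by
    intro t
    simp only [d, det_diagonal]
    rw [Finset.prod_ite_eq' ]
    simp
  refine ⟨fun t => a t * d t, ha.matrix_mul hdc, ?_, ?_, ?_, ?_⟩
  · intro t
    simp only
    rw [conjTranspose_mul, Matrix.mul_assoc, ← Matrix.mul_assoc _ (a t), hau, Matrix.one_mul, hdu]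
  · intro t
    simp only
    rw [det_mul, hdd, mul_comm, det_unit (hau t)]
  · simp only [d, ha0]
    simp
  · simp only [d, ha1, hd]
    simp

end PartX

end WrapX

section WrapY
set_option linter.unusedSectionVars false
section PartY
open Matrix Filter Topology

variable {m : ℕ} {ζ : ℂ}

open Classical in
/-- element of SU with given matrix -/
noncomputable def su (M : Mt m) : SU (m + 1) :=
  if h : Mᴴ * M = 1 ∧ M.det = 1 then ⟨⟨M, mem_unitaryGroup_iff'.2 h.1⟩, h.2⟩ else 1

theorem su_coe {M : Mt m} (h1 : Mᴴ * M = 1) (h2 : M.det = 1) : (((su M : SU (m+1)) : UU m) : Mt m) = M := by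
  rw [su, dif_pos ⟨h1, h2⟩]

theorem SU_ext {a b : SU (m + 1)} (h : ((a : UU m) : Mt m) = ((b : UU m) : Mt m)) : a = b := Subtype.ext (Subtype.ext h)

theorem SU_unit (a : SU (m + 1)) : ((a : UU m) : Mt m)ᴴ * ((a : UU m) : Mt m) = 1 := mem_unitaryGroup_iff'.1 (a : UU m).2

theorem SU_det (a : SU (m + 1)) : ((a : UU m) : Mt m).det = 1 := a.2

theorem SU_mul (a b : SU (m + 1)) : ((a * b : SU (m+1)) : Mt m) = ((a : UU m) : Mt m) * ((b : UU m) : Mt m) := rfl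

theorem SU_inv (a : SU (m + 1)) : ((a⁻¹ : SU (m+1)) : Mt m) = ((a : UU m) : Mt m)ᴴ := rfl

theorem SU_inducing : IsInducing (fun a : SU (m + 1) => ((a : UU m) : Mt m)) :=
  IsInducing.subtypeVal.comp IsInducing.subtypeVal

theorem su_cont {T : Type*} [TopologicalSpace T] {M : T → Mt m} (hM : Continuous M) (h1 : ∀ t, (M t)ᴴ * M t = 1) (h2 : ∀ t, (M t).det = 1) :
    Continuous fun t => su (M t) := by
  rw [SU_inducing.continuous_iff]
  refine hM.congr fun t => ?_
  exact (su_coe (h1 t) (h2 t)).symm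

theorem smul_unit {c : ℂ} (hc : star c * c = 1) {M : Mt m} (h : Mᴴ * M = 1) : (c • M)ᴴ * (c • M) = 1 := by
  rw [conjTranspose_smul, Matrix.smul_mul, Matrix.mul_smul, smul_smul, h, hc, one_smul]

theorem star_mul_self_of_pow {c : ℂ} {n : ℕ} (hn : n ≠ 0) (h : star (c ^ n) * c ^ n = 1) : star c * c = 1 := by
  have h1 : ‖c‖ ^ n = 1 := by
    have := congrArg norm h
    rw [norm_mul, norm_star, norm_one, norm_pow] at this
    have h0 : 0 ≤ ‖c‖ ^ n := by positivity
    nlinarith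
  have h2 : ‖c‖ = 1 := (pow_eq_one_iff_of_nonneg (norm_nonneg c) hn).1 h1
  rw [Complex.star_def, ← Complex.normSq_eq_conj_mul_self, Complex.normSq_eq_norm_sq, h2]; simp

/-- scaling by a root of unity does not change the class -/
theorem mk_smul {c : ℂ} (hc : c ^ (m + 1) = 1) {M : Mt m} (h1 : Mᴴ * M = 1) (h2 : M.det = 1) :
    (QuotientGroup.mk (su (c • M)) : PU (m + 1)) = QuotientGroup.mk (su M) := by
  have hcs : star c * c = 1 := star_mul_self_of_pow (n := m + 1) (by omega) (by rw [hc]; simp)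
  have hd : (c • M).det = 1 := by rw [det_smul, h2, mul_one, Fintype.card_fin, hc]
  symm
  rw [QuotientGroup.eq]
  have e : (su M)⁻¹ * su (c • M) = su (c • (1 : Mt m)) := by
    apply SU_ext
    rw [SU_mul, SU_inv, su_coe h1 h2, su_coe (smul_unit hcs h1) hd, su_coe (smul_unit hcs (by simp)) (by simp [det_smul, hc]),
      Matrix.mul_smul, h1]
  rw [e, Subgroup.mem_center_iff]
  intro g
  apply SU_ext
  rw [SU_mul, SU_mul, su_coe (smul_unit hcs (by simp)) (by simp [det_smul, hc])]
  simp

/-- base -/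
def BS (m : ℕ) : Set (ℝ × Matrix (Fin m) (Fin m) ℂ × Mt m) :=
  {q | q.1 ∈ Set.Icc (0:ℝ) 1 ∧ q.2.1ᴴ * q.2.1 = 1 ∧ q.2.2ᴴ * q.2.2 = 1 ∧ q.2.2.det = 1}

/-- cover -/
def BT (m : ℕ) : Set ((ℝ × Matrix (Fin m) (Fin m) ℂ × Mt m) × ℂ) :=
  {q | q.1 ∈ BS m ∧ q.2 ^ (m + 1) = q.1.2.1.det}

theorem BS_closed : IsClosed (BS m) := by
  refine IsClosed.inter (isClosed_Icc.preimage continuous_fst) (IsClosed.inter ?_ (IsClosed.inter ?_ ?_))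
  · have h : Continuous fun q : ℝ × Matrix (Fin m) (Fin m) ℂ × Mt m => q.2.1 := by fun_prop
    exact isClosed_eq (h.matrix_conjTranspose.matrix_mul h) continuous_const
  · have h : Continuous fun q : ℝ × Matrix (Fin m) (Fin m) ℂ × Mt m => q.2.2 := by fun_prop
    exact isClosed_eq (h.matrix_conjTranspose.matrix_mul h) continuous_const
  · have h : Continuous fun q : ℝ × Matrix (Fin m) (Fin m) ℂ × Mt m => q.2.2 := by fun_prop
    exact isClosed_eq h.matrix_det continuous_const

theorem BT_closed : IsClosed (BT m) := by
  refine IsClosed.inter (BS_closed.preimage continuous_fst) ?_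
  have h : Continuous fun q : (ℝ × Matrix (Fin m) (Fin m) ℂ × Mt m) × ℂ => q.1.2.1 := by fun_prop
  exact isClosed_eq (continuous_snd.pow _) h.matrix_det

theorem box_compact (n : ℕ) : IsCompact {M : Matrix (Fin n) (Fin n) ℂ | ∀ i j, ‖M i j‖ ≤ 1} := by
  have h : IsCompact (Set.pi Set.univ fun _ : Fin n => Set.pi Set.univ fun _ : Fin n => Metric.closedBall (0:ℂ) 1) :=
    isCompact_univ_pi fun _ => isCompact_univ_pi fun _ => isCompact_closedBall _ _
  have e : (Set.pi Set.univ fun _ : Fin n => Set.pi Set.univ fun _ : Fin n => Metric.closedBall (0:ℂ) 1)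
      = {M : Fin n → Fin n → ℂ | ∀ i j, ‖M i j‖ ≤ 1} := by
    ext M
    simp [Set.mem_pi]
  rw [e] at h
  exact h

theorem unit_det {n : ℕ} {M : Matrix (Fin n) (Fin n) ℂ} (h : Mᴴ * M = 1) : star M.det * M.det = 1 := by
  have := congrArg Matrix.det h
  rwa [det_mul, det_conjTranspose, det_one] at this

theorem BT_star {q : (ℝ × Matrix (Fin m) (Fin m) ℂ × Mt m) × ℂ} (hq : q ∈ BT m) : star q.2 * q.2 = 1 := by
  refine star_mul_self_of_pow (n := m + 1) (by omega) ?_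
  rw [hq.2]; exact unit_det hq.1.2.1

theorem BT_compact : IsCompact (BT m) := by
  have h : IsCompact ((Set.Icc (0:ℝ) 1 ×ˢ ({M : Matrix (Fin m) (Fin m) ℂ | ∀ i j, ‖M i j‖ ≤ 1} ×ˢ {M : Mt m | ∀ i j, ‖M i j‖ ≤ 1})) ×ˢ Metric.closedBall (0:ℂ) 1) :=
    (isCompact_Icc.prod ((box_compact m).prod (box_compact (m+1)))).prod (isCompact_closedBall _ _)
  refine h.of_isClosed_subset BT_closed fun q hq => ?_
  refine ⟨⟨hq.1.1, ?_, ?_⟩, ?_⟩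
  · exact fun i j => entry_norm_bound_of_unitary (mem_unitaryGroup_iff'.2 hq.1.2.1) i j
  · exact fun i j => entry_norm_bound_of_unitary (mem_unitaryGroup_iff'.2 hq.1.2.2.1) i j
  · have := congrArg norm (BT_star hq)
    rw [norm_mul, norm_star, norm_one] at this
    rw [mem_closedBall_zero_iff]
    nlinarith [norm_nonneg q.2]

/-- projection -/
def BP (q : BT m) : BS m := ⟨q.1.1, q.2.1⟩

theorem BP_quot : IsQuotientMap (BP (m := m)) := by
  haveI : CompactSpace (BT m) := isCompact_iff_compactSpace.1 BT_compact
  have hc : Continuous (BP (m := m)) := (continuous_fst.comp continuous_subtype_val).subtype_mk _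
  refine hc.isClosedMap.isQuotientMap hc ?_
  intro s
  obtain ⟨z, hz⟩ := IsAlgClosed.exists_pow_nat_eq (s.1.2.1.det) (n := m + 1) (by omega)
  exact ⟨⟨(s.1, z), s.2, hz⟩, rfl⟩

theorem lift_unit {q : (ℝ × Matrix (Fin m) (Fin m) ℂ × Mt m) × ℂ} (hq : q ∈ BT m) :
    (q.2⁻¹ • blk 1 q.1.2.1)ᴴ * (q.2⁻¹ • blk 1 q.1.2.1) = 1 ∧ (q.2⁻¹ • blk 1 q.1.2.1).det = 1 ∧ q.2 ≠ 0 := by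
  have hs := BT_star hq
  have h0 : q.2 ≠ 0 := by intro h; rw [h] at hs; simp at hs
  refine ⟨smul_unit ?_ ?_, ?_, h0⟩
  · rw [star_inv₀, ← mul_inv, hs, inv_one]
  · rw [blk_star, blk_mul, hq.1.2.1, star_one, one_mul, blk_one]
  · rw [det_smul, blk_det, Fintype.card_fin, ← hq.2, inv_pow, inv_mul_cancel₀ (pow_ne_zero _ h0)]

theorem final (hm : 0 < m) (hp : (m + 1).Prime) (hodd : Odd (m + 1))
    (f g : C(PU (m+1) × PU (m+1), SU (m+1)))
    (hf : ∀ u v : SU (m+1), f (QuotientGroup.mk u, QuotientGroup.mk v) = u * v * u⁻¹ * v⁻¹)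
    (F : f.Homotopy g) (c0 : SU (m+1)) (hc0 : ∀ x, g x ≠ c0) : False := by
  obtain ⟨ζ, hζ⟩ : ∃ ζ : ℂ, IsPrimitiveRoot ζ (m + 1) := ⟨_, Complex.isPrimitiveRoot_exp (m + 1) (by omega)⟩
  have hζ1 := hζ.pow_eq_one
  have hζs : star ζ * ζ = 1 := star_mul_self_of_pow (n := m + 1) (by omega) (by rw [hζ1]; simp)
  obtain ⟨γ, hγc, hγu, hγd, hγ0, hγ1⟩ := exists_path (ζ • ((c0⁻¹ : SU (m+1)) : Mt m)) (smul_unit hζs (SU_unit _))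
    (by rw [det_smul, SU_det, Fintype.card_fin, hζ1, mul_one])
  let pj : ℝ → unitInterval := Set.projIcc (0:ℝ) 1 zero_le_one
  let GT : (ℝ × Matrix (Fin m) (Fin m) ℂ × Mt m) × ℂ → SU (m+1) := fun q =>
    su (γ q.1.1) * F (pj q.1.1, (QuotientGroup.mk (su (q.2⁻¹ • blk 1 q.1.2.1)), QuotientGroup.mk (su q.1.2.2)))
  have hGT : Continuous fun q : BT m => GT q.1 := by
    have c1 : Continuous fun q : BT m => q.1.1.1 := continuous_subtype_val.fst.fst
    have c2 : Continuous fun q : BT m => q.1.1.2.1 := continuous_subtype_val.fst.snd.fst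
    have c3 : Continuous fun q : BT m => q.1.1.2.2 := continuous_subtype_val.fst.snd.snd
    have c4 : Continuous fun q : BT m => (q.1.2)⁻¹ := continuous_subtype_val.snd.inv₀ fun q => (lift_unit q.2).2.2
    have hb : Continuous fun q : BT m => blk 1 q.1.1.2.1 := by
      refine continuous_matrix fun i j => ?_
      refine Fin.cases ?_ (fun i => ?_) i <;> refine Fin.cases ?_ (fun j => ?_) j
      · exact continuous_const
      · exact continuous_const
      · exact continuous_const
      · exact c2.matrix_elem i j
    have e1 : Continuous fun q : BT m => su (γ q.1.1.1) := su_cont (hγc.comp c1) (fun _ => hγu _) (fun _ => hγd _)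
    have e2 : Continuous fun q : BT m => su (q.1.2⁻¹ • blk 1 q.1.1.2.1) :=
      su_cont (c4.smul hb) (fun q => (lift_unit q.2).1) (fun q => (lift_unit q.2).2.1)
    have e3 : Continuous fun q : BT m => su q.1.1.2.2 := su_cont c3 (fun q => q.2.1.2.2.1) (fun q => q.2.1.2.2.2)
    refine e1.mul (F.continuous.comp (Continuous.prodMk (continuous_projIcc.comp c1) (Continuous.prodMk ?_ ?_)))
    · exact continuous_quot_mk.comp e2
    · exact continuous_quot_mk.comp e3
  have hGwd : ∀ s a b, (s, a) ∈ BT m → (s, b) ∈ BT m → GT (s, a) = GT (s, b) := by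
    intro s a b ha hb
    have ha0 : a ≠ 0 := (lift_unit ha).2.2
    have hb0 : b ≠ 0 := (lift_unit hb).2.2
    have hr : (b / a) ^ (m + 1) = 1 := by
      have h1 : a ^ (m+1) = s.2.1.det := ha.2
      have h2 : b ^ (m+1) = s.2.1.det := hb.2
      rw [div_pow, h1, ← h2, div_self (pow_ne_zero _ hb0)]
    have h3 := mk_smul hr (lift_unit hb).1 (lift_unit hb).2.1
    have h4 : (b / a) • (b⁻¹ • blk 1 s.2.1) = a⁻¹ • blk 1 s.2.1 := by
      rw [smul_smul]; congr 1; field_simp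
    simp only at h3
    rw [h4] at h3
    simp only [GT]
    rw [h3]
  have hsurj := BP_quot (m := m).surjective
  choose sec hsec using hsurj
  let G : BS m → Mt m := fun s => ((GT (sec s).1 : UU m) : Mt m)
  have hGeq : ∀ q : BT m, G (BP q) = ((GT q.1 : UU m) : Mt m) := by
    intro q
    have h1 := hsec (BP q)
    have h2 : (sec (BP q)).1.1 = q.1.1 := congrArg Subtype.val h1
    have := hGwd q.1.1 (sec (BP q)).1.2 q.1.2 (by rw [← h2]; exact (sec (BP q)).2) q.2
    simp only [G]
    rw [← this, ← h2]
  have hGc : Continuous G := by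
    rw [BP_quot.continuous_iff]
    have : G ∘ BP = fun q : BT m => ((GT q.1 : UU m) : Mt m) := funext hGeq
    rw [this]
    exact SU_inducing.continuous.comp hGT
  have hGv : ∀ q : BT m, G ⟨q.1.1, q.2.1⟩ = ((GT q.1 : UU m) : Mt m) := hGeq
  obtain ⟨Kt, hKt⟩ : ∃ Kt : C(ℝ × Matrix (Fin m) (Fin m) ℂ × Mt m, Mt m), ∀ s : BS m, Kt s.1 = G s := by
    have hcl : @IsClosed (ℝ × (Fin m → Fin m → ℂ) × (Fin (m+1) → Fin (m+1) → ℂ)) _ (BS m) := BS_closed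
    let G' : C((BS m : Set (ℝ × (Fin m → Fin m → ℂ) × (Fin (m+1) → Fin (m+1) → ℂ))), Fin (m+1) → Fin (m+1) → ℂ) := ⟨G, hGc⟩
    obtain ⟨k, hk⟩ := G'.exists_restrict_eq hcl
    refine ⟨⟨k, k.continuous⟩, fun s => ?_⟩
    exact DFunLike.congr_fun hk s
  let K : ℝ → Matrix (Fin m) (Fin m) ℂ → Mt m → Mt m := fun τ X V =>
    ((m + 1 : ℂ)⁻¹) • ∑ j ∈ Finset.range (m + 1), Kt (τ, X, ζ ^ j • V)
  have hlam : ∀ s : BS m, ∃ z : ℂ, (s.1, z) ∈ BT m := by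
    intro s
    obtain ⟨z, hz⟩ := IsAlgClosed.exists_pow_nat_eq (s.1.2.1.det) (n := m + 1) (by omega)
    exact ⟨z, s.2, hz⟩
  have hKv : ∀ τ X V z, ((τ, X, V), z) ∈ BT m → K τ X V = ((GT ((τ, X, V), z) : UU m) : Mt m) := by
    intro τ X V z h
    have hj : ∀ j : ℕ, Kt (τ, X, ζ ^ j • V) = ((GT ((τ, X, V), z) : UU m) : Mt m) := by
      intro j
      have hr : (ζ ^ j) ^ (m + 1) = 1 := by rw [← pow_mul, mul_comm, pow_mul, hζ1, one_pow]
      have hrs : star (ζ ^ j) * ζ ^ j = 1 := star_mul_self_of_pow (n := m + 1) (by omega) (by rw [hr]; simp)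
      have h1 : ((τ, X, ζ ^ j • V), z) ∈ BT m := by
        refine ⟨⟨h.1.1, h.1.2.1, smul_unit hrs h.1.2.2.1, ?_⟩, h.2⟩
        have : V.det = 1 := h.1.2.2.2
        show (ζ ^ j • V).det = 1
        rw [det_smul, Fintype.card_fin, hr, this, one_mul]
      rw [hKt ⟨_, h1.1⟩, hGv ⟨_, h1⟩]
      have := mk_smul hr h.1.2.2.1 h.1.2.2.2
      simp only at this
      simp only [GT]
      rw [this]
    simp only [K, hj, Finset.sum_const, Finset.card_range, ← Nat.cast_smul_eq_nsmul ℂ, smul_smul]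
    have : ((m + 1 : ℂ)⁻¹ * ((m + 1 : ℕ) : ℂ)) = 1 := by
      push_cast
      exact inv_mul_cancel₀ (by exact_mod_cast (Nat.succ_ne_zero m))
    rw [this, one_smul]
  refine core (K := K) hm hp hodd hζ ⟨?_, ?_, ?_, ?_, ?_⟩
  · have hc : Continuous fun q : ℝ × Matrix (Fin m) (Fin m) ℂ × Mt m =>
        ∑ j ∈ Finset.range (m+1), Kt (q.1, q.2.1, ζ ^ j • q.2.2) :=
      continuous_finset_sum _ fun j _ => Kt.continuous.comp (by fun_prop)
    exact hc.const_smul ((m + 1 : ℂ)⁻¹)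
  · intro τ hτ X hX V hV hd
    obtain ⟨z, hz⟩ := hlam ⟨(τ, X, V), hτ, hX, hV, hd⟩
    rw [hKv τ X V z hz]
    exact ⟨SU_unit _, SU_det _⟩
  · intro X hX V hV hd
    obtain ⟨z, hz⟩ := hlam ⟨(0, X, V), ⟨le_rfl, zero_le_one⟩, hX, hV, hd⟩
    rw [hKv 0 X V z hz]
    obtain ⟨l1, l2, l3⟩ := lift_unit hz
    simp only at l1 l2 l3
    have hpj : pj 0 = 0 := Set.projIcc_left _
    have hs := BT_star hz
    simp only at hs
    have : GT ((0, X, V), z) = su (γ 0) * (su (z⁻¹ • blk 1 X) * su V * (su (z⁻¹ • blk 1 X))⁻¹ * (su V)⁻¹) := by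
      simp only [GT, hpj, F.apply_zero, hf]
    rw [this]
    simp only [SU_mul, SU_inv]
    rw [su_coe (hγu 0) (hγd 0), hγ0, su_coe l1 l2, su_coe hV hd, Matrix.one_mul]
    simp only [conjTranspose_smul, Matrix.smul_mul, Matrix.mul_smul, smul_smul]
    have : star z⁻¹ * z⁻¹ = 1 := by rw [star_inv₀, ← mul_inv, hs, inv_one]
    rw [this, one_smul]
  · intro X hX V hV hd h
    obtain ⟨z, hz⟩ := hlam ⟨(1, X, V), ⟨zero_le_one, le_rfl⟩, hX, hV, hd⟩
    rw [hKv 1 X V z hz] at h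
    have hpj : pj 1 = 1 := Set.projIcc_right _
    simp only [GT, hpj, F.apply_one] at h
    refine hc0 (QuotientGroup.mk (su (z⁻¹ • blk 1 X)), QuotientGroup.mk (su V)) ?_
    generalize g (QuotientGroup.mk (su (z⁻¹ • blk 1 X)), QuotientGroup.mk (su V)) = y at h
    rw [SU_mul, su_coe (hγu 1) (hγd 1), hγ1, Matrix.smul_mul] at h
    have hζ0 : ζ ≠ 0 := by rintro rfl; simp at hζs
    have h2 := smul_right_injective (Mt m) hζ0 h
    have h3 : c0⁻¹ * y = 1 := SU_ext h2
    exact (inv_mul_eq_one.1 h3).symm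
  · intro τ X V
    simp only [K]
    congr 1
    simp only [smul_smul, ← pow_succ]
    rw [Finset.sum_range_succ, Finset.sum_range_succ', hζ1, pow_zero]

end PartY


end WrapY

theorem surjective_of_homotopic_to_commutatorMap_PU
    (p : ℕ) (hp : p.Prime) (hodd : Odd p)
    (f : C(PU p × PU p, SU p))
    (hf : ∀ u v : SU p,
      f (QuotientGroup.mk u, QuotientGroup.mk v) = u * v * u⁻¹ * v⁻¹)
    (g : C(PU p × PU p, SU p)) (hg : g.Homotopic f) :
    Function.Surjective g := by
  obtain ⟨m, rfl⟩ : ∃ m, p = m + 1 := ⟨p - 1, by have := hp.pos; omega⟩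
  intro c0
  by_contra h
  push Not at h
  obtain ⟨F⟩ := hg.symm
  have := hp.two_le
  exact final (by omega) hp hodd f g hf F c0 h
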